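/- arXiv:1207.5126 — 2 statements merged into one kernel-verified Lean document; each statement's English description precedes it below -/
import Mathlib

section
/- Let 𝓛 be an algebraic de Branges space and let W : ℝ → (0,∞] be a weight (lower semicontinuous, not identically ∞) with 𝓛 ⊆ C₀(W). If 𝓛 is not dense in C₀(W), then the W-weighted Krein class 𝒦(𝓛,W) is nonempty. -/
open Filter MeasureTheory Asymptotics
open scoped ENNReal NNReal Topology

/-- A weight: a lower semicontinuous function `W : ℝ → (0,∞]` not identically `∞`. -/
def IsWeight (W : ℝ → ℝ≥0∞) : Prop :=
  LowerSemicontinuous W ∧ (∀ x, 0 < W x) ∧ ¬ (∀ x, W x = ⊤)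

/-- Membership in `C₀(W)` for an extended weight: `f : ℝ → ℂ` continuous with
`|f(x)|/W(x) → 0` as `|x| → ∞` (the quotient is taken in `ℝ≥0∞`, so it is `0`
where `W = ∞`). -/
def MemC0e (W : ℝ → ℝ≥0∞) (f : ℝ → ℂ) : Prop :=
  Continuous f ∧ Tendsto (fun x => (‖f x‖₊ : ℝ≥0∞) / W x) (cocompact ℝ) (nhds 0)

/-- The seminorm of `C₀(W)`: `‖f‖ = sup_x |f(x)|/W(x)` (computed in `ℝ≥0∞`). -/
noncomputable def eC0norm (W : ℝ → ℝ≥0∞) (f : ℝ → ℂ) : ℝ≥0∞ :=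
  ⨆ x : ℝ, (‖f x‖₊ : ℝ≥0∞) / W x

/-- An algebraic de Branges space: a linear space of entire functions, invariant
under division of zeros and under `F ↦ F^#`. -/
def IsAlgebraicDeBranges (L : Submodule ℂ (ℂ → ℂ)) : Prop :=
  (∀ F ∈ L, Differentiable ℂ F) ∧
  (∀ F ∈ L, ∀ w : ℂ, F w = 0 → ∃ G ∈ L, ∀ z : ℂ, z ≠ w → G z = F z / (z - w)) ∧
  (∀ F ∈ L, (fun z => (starRingEnd ℂ) (F ((starRingEnd ℂ) z))) ∈ L)

/-- `𝓛 ⊆ C₀(W)`: each member of `L` restricts to an element of `C₀(W)`. -/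
def SubsetC0e (W : ℝ → ℝ≥0∞) (L : Submodule ℂ (ℂ → ℂ)) : Prop :=
  ∀ F ∈ L, MemC0e W (fun x : ℝ => F (x : ℂ))

/-- Density of (the restrictions to `ℝ` of) `L` in `C₀(W)` w.r.t. the seminorm. -/
def DenseInC0e (W : ℝ → ℝ≥0∞) (L : Submodule ℂ (ℂ → ℂ)) : Prop :=
  ∀ f : ℝ → ℂ, MemC0e W f → ∀ ε : ℝ≥0∞, 0 < ε →
    ∃ F ∈ L, eC0norm W (fun x : ℝ => f x - F (x : ℂ)) < ε

/-- The open upper half-plane. -/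
def UpperHalf : Set ℂ := {z | 0 < z.im}

/-- The open lower half-plane. -/
def LowerHalf : Set ℂ := {z | z.im < 0}

/-- The (possibly meromorphic) quotient `F/G` is of bounded type on `S`:
`F/G = g₁/g₂` with `g₁, g₂` bounded and holomorphic on `S` and `g₂` not
identically zero; the identity `F/G = g₁/g₂` is expressed as `F·g₂ = G·g₁` on `S`. -/
def BddTypeQuot (S : Set ℂ) (F G : ℂ → ℂ) : Prop :=
  ∃ g₁ g₂ : ℂ → ℂ, DifferentiableOn ℂ g₁ S ∧ DifferentiableOn ℂ g₂ S ∧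
    (∃ C : ℝ, ∀ z ∈ S, ‖g₁ z‖ ≤ C) ∧ (∃ C : ℝ, ∀ z ∈ S, ‖g₂ z‖ ≤ C) ∧
    (¬ ∀ z ∈ S, g₂ z = 0) ∧ (∀ z ∈ S, F z * g₂ z = G z * g₁ z)

/-- The `W`-weighted Krein class `𝒦(𝓛,W)` with respect to `L`. -/
def KreinClass (L : Submodule ℂ (ℂ → ℂ)) (W : ℝ → ℝ≥0∞) : Set (ℂ → ℂ) :=
  {B | Differentiable ℂ B ∧
    -- (K1)
    (∃ z : ℂ, B z = 0) ∧
    (∀ z : ℂ, B z = 0 → z.im = 0 ∧ deriv B z ≠ 0) ∧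
    (∀ z : ℂ, B z = (starRingEnd ℂ) (B ((starRingEnd ℂ) z))) ∧
    -- (K2)
    (∀ F ∈ L, BddTypeQuot UpperHalf F B ∧ BddTypeQuot LowerHalf F B) ∧
    -- (K3)
    (∀ F ∈ L, (fun y : ℝ => F ((y : ℂ) * Complex.I)) =o[atTop ⊔ atBot]
        (fun y : ℝ => B ((y : ℂ) * Complex.I))) ∧
    -- (K4)
    (∑' x : {t : ℝ // B (t : ℂ) = 0}, W x.1 / (‖deriv B (x.1 : ℂ)‖₊ : ℝ≥0∞)) ≠ ⊤}

open scoped BoundedContinuousFunction ComplexConjugate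

/-- A functional form of Hahn-Banach for seminorms: a vector at positive distance from a subspace is
separated from it by a functional dominated by the seminorm. -/
theorem Seminorm.exists_linearMap_of_dist_pos {V : Type*} [AddCommGroup V] [Module ℝ V]
    (N : Seminorm ℝ V) (M : Submodule ℝ V) (f : V) {ε : ℝ} (hε : 0 < ε)
    (h : ∀ m ∈ M, ε ≤ N (f - m)) :
    ∃ φ : V →ₗ[ℝ] ℝ, (∀ v, |φ v| ≤ N v) ∧ (∀ m ∈ M, φ m = 0) ∧ φ f ≠ 0 := by
  have hfM : f ∉ M := fun hf => by
    have := h f hf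
    simp at this
    linarith
  let g : V →ₗ.[ℝ] ℝ := (⟨M, 0⟩ : V →ₗ.[ℝ] ℝ).supSpanSingleton f ε hfM
  obtain ⟨φ, hφ, hφN⟩ := exists_extension_of_le_sublinear g N
    (fun c hc x => by rw [map_smul_eq_mul, Real.norm_of_nonneg hc.le])
    (fun x y => map_add_le_add N x y) (by
      rintro ⟨x, hx⟩
      obtain ⟨m, hm, y, hy, rfl⟩ := Submodule.mem_sup.1 hx
      obtain ⟨t, rfl⟩ := Submodule.mem_span_singleton.1 hy
      have : g ⟨m + t • f, hx⟩ = t * ε := by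
        have := LinearPMap.supSpanSingleton_apply_mk (⟨M, 0⟩ : V →ₗ.[ℝ] ℝ) f ε hfM m hm t
        simpa [g] using this
      rw [this]
      rcases le_or_gt t 0 with ht | ht
      · exact (mul_nonpos_of_nonpos_of_nonneg ht hε.le).trans (apply_nonneg _ _)
      · have h1 := h (-(t⁻¹ • m)) (M.neg_mem (M.smul_mem _ hm))
        have h2 : m + t • f = t • (f - -(t⁻¹ • m)) := by
          rw [sub_neg_eq_add, smul_add, smul_smul, mul_inv_cancel₀ ht.ne', one_smul, add_comm]
        change t * ε ≤ N (m + t • f)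
        rw [h2, map_smul_eq_mul, Real.norm_of_nonneg ht.le]
        gcongr)
  refine ⟨φ, fun v => abs_le.2 ⟨?_, hφN v⟩, fun m hm => ?_, ?_⟩
  · have := hφN (-v)
    rw [map_neg, map_neg_eq_map] at this
    linarith
  · have hx : m ∈ g.domain := Submodule.mem_sup_left hm
    have h1 := hφ ⟨m, hx⟩
    have := LinearPMap.supSpanSingleton_apply_mk (⟨M, 0⟩ : V →ₗ.[ℝ] ℝ) f ε hfM m hm 0
    simp only [zero_smul, add_zero] at this
    simpa [g] using h1.trans this
  · have hx : f ∈ g.domain := Submodule.mem_sup_right (Submodule.mem_span_singleton_self f)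
    have h1 := hφ ⟨f, hx⟩
    have := LinearPMap.supSpanSingleton_apply_mk (⟨M, 0⟩ : V →ₗ.[ℝ] ℝ) f ε hfM 0 M.zero_mem 1
    simp only [one_smul, zero_add] at this
    have h2 := h1.trans this
    simp at h2
    simp [h2, hε.ne']

/-- The functionals dominated by a seminorm and vanishing on a subspace. -/
def Seminorm.polarAnnihilator {V : Type*} [AddCommGroup V] [Module ℝ V]
    (N : Seminorm ℝ V) (M : Submodule ℝ V) : Set (V → ℝ) :=
  {φ | (∃ l : V →ₗ[ℝ] ℝ, φ = l) ∧ (∀ v, |φ v| ≤ N v) ∧ ∀ m ∈ M, φ m = 0}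

theorem Seminorm.isCompact_polarAnnihilator {V : Type*} [AddCommGroup V] [Module ℝ V]
    (N : Seminorm ℝ V) (M : Submodule ℝ V) : IsCompact (N.polarAnnihilator M) := by
  have hK : IsCompact (Set.univ.pi fun v : V => Set.Icc (-(N v)) (N v)) :=
    isCompact_univ_pi fun v => isCompact_Icc
  refine hK.of_isClosed_subset ?_ ?_
  · have : N.polarAnnihilator M = ((⋂ (v : V) (w : V), {φ | φ (v + w) = φ v + φ w}) ∩
        (⋂ (c : ℝ) (v : V), {φ | φ (c • v) = c * φ v})) ∩
        ((⋂ v : V, {φ | |φ v| ≤ N v}) ∩ ⋂ m ∈ M, {φ | φ m = 0}) := by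
      ext φ
      simp only [polarAnnihilator, Set.mem_ofPred_eq, Set.mem_inter_iff, Set.mem_iInter]
      refine and_congr ⟨?_, ?_⟩ Iff.rfl
      · rintro ⟨l, rfl⟩
        simp
      · rintro ⟨h1, h2⟩
        exact ⟨⟨⟨φ, h1⟩, h2⟩, rfl⟩
    rw [this]
    refine IsClosed.inter (IsClosed.inter ?_ ?_) (IsClosed.inter ?_ ?_)
    · exact isClosed_iInter fun v => isClosed_iInter fun w =>
        isClosed_eq (by fun_prop) (by fun_prop)
    · exact isClosed_iInter fun v => isClosed_iInter fun w =>
        isClosed_eq (by fun_prop) (by fun_prop)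
    · exact isClosed_iInter fun v => isClosed_le (by fun_prop) (by fun_prop)
    · exact isClosed_iInter fun v => isClosed_iInter fun _ => isClosed_eq (by fun_prop) (by fun_prop)
  · intro φ hφ v _
    exact abs_le.1 (hφ.2.1 v)

/-- A linear functional bounded by `a` on the unit ball of a seminorm is dominated by `a` times the
seminorm. -/
theorem Seminorm.abs_le_mul_of_le_on_ball {V : Type*} [AddCommGroup V] [Module ℝ V]
    (N : Seminorm ℝ V) (φ : V →ₗ[ℝ] ℝ) {a : ℝ} (h : ∀ v, N v ≤ 1 → φ v ≤ a) (v : V) :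
    |φ v| ≤ a * N v := by
  have key : ∀ v, φ v ≤ a * N v := by
    intro v
    have ha : 0 ≤ a := by simpa using h 0 (by simp)
    refine le_of_forall_pos_le_add fun ε hε => ?_
    obtain ⟨δ, hδ, hδε⟩ : ∃ δ > 0, a * δ ≤ ε := by
      refine ⟨ε / (a + 1), by positivity, ?_⟩
      rw [mul_div_assoc', div_le_iff₀ (by positivity)]
      nlinarith
    have hpos : 0 < N v + δ := by positivity
    have h1 := h ((N v + δ)⁻¹ • v) (by
      rw [map_smul_eq_mul, Real.norm_of_nonneg (by positivity), inv_mul_le_iff₀ hpos]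
      linarith)
    rw [map_smul, smul_eq_mul, inv_mul_le_iff₀ hpos] at h1
    nlinarith
  refine abs_le.2 ⟨?_, key v⟩
  have := key (-v)
  rw [map_neg, map_neg_eq_map] at this
  linarith

/-- Extreme annihilators: if a subspace `M` is at positive distance from some vector, there is a
nonzero functional `φ` vanishing on `M` such that every functional vanishing on `M` and dominated by
the total variation of `φ` (computed through the family `T`) is a multiple of `φ`. -/
theorem Seminorm.exists_extreme_annihilator {V ι : Type*} [AddCommGroup V] [Module ℝ V]
    (N : Seminorm ℝ V) (M : Submodule ℝ V) (f : V) {ε : ℝ} (hε : 0 < ε)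
    (h : ∀ m ∈ M, ε ≤ N (f - m)) (T : ι → V →ₗ[ℝ] V)
    (hT : ∀ i u v, N u ≤ 1 → N v ≤ 1 → N (u + v + T i (u - v)) ≤ 2) :
    ∃ φ : V →ₗ[ℝ] ℝ, φ ≠ 0 ∧ (∀ v, |φ v| ≤ N v) ∧ (∀ m ∈ M, φ m = 0) ∧
      ∀ ψ : V →ₗ[ℝ] ℝ, (∀ m ∈ M, ψ m = 0) →
        (∀ v, ∀ δ > 0, ∃ i, ψ v ≤ φ (T i v) + δ) → ∃ c : ℝ, ψ = c • φ := by
  obtain ⟨φ₀, h1, h2, h3⟩ := N.exists_linearMap_of_dist_pos M f hε h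
  have hmem : (φ₀ : V → ℝ) ∈ N.polarAnnihilator M := ⟨⟨φ₀, rfl⟩, h1, h2⟩
  obtain ⟨φ', hφ'⟩ := (N.isCompact_polarAnnihilator M).extremePoints_nonempty ⟨_, hmem⟩
  obtain ⟨⟨⟨φ, rfl⟩, hφN, hφM⟩, hext⟩ := mem_extremePoints.1 hφ'
  refine ⟨φ, ?_, hφN, hφM, fun ψ hψM hψ => ?_⟩
  · rintro rfl
    have hneg : (-φ₀ : V →ₗ[ℝ] ℝ) ∈ ((fun l : V →ₗ[ℝ] ℝ => (l : V → ℝ)) ⁻¹'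
        N.polarAnnihilator M) :=
      ⟨⟨-φ₀, rfl⟩, by simpa using h1, by simpa using h2⟩
    have := (hext _ hmem _ hneg ⟨1 / 2, 1 / 2, by norm_num, by norm_num, by norm_num, by
      ext v; simp⟩).1
    exact h3 (by simpa using congrFun this f)
  · have hsum : ∀ u v, N u ≤ 1 → N v ≤ 1 → (φ + ψ) u + (φ - ψ) v ≤ 2 := by
      intro u v hu hv
      refine le_of_forall_pos_le_add fun δ hδ => ?_
      obtain ⟨i, hi⟩ := hψ (u - v) δ hδ
      have h4 := (abs_le.1 (hφN (u + v + T i (u - v)))).2.trans (hT i u v hu hv)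
      simp only [map_add, map_sub, LinearMap.add_apply, LinearMap.sub_apply] at *
      linarith
    set A : Set ℝ := (φ + ψ) '' {u | N u ≤ 1} with hA
    have hAne : A.Nonempty := ⟨0, 0, by simp, by simp⟩
    have hAbdd : BddAbove A := ⟨2, by
      rintro _ ⟨u, hu, rfl⟩
      simpa using hsum u 0 hu (by simp)⟩
    set a := sSup A with ha
    have hle : ∀ u, N u ≤ 1 → (φ + ψ) u ≤ a := fun u hu => le_csSup hAbdd ⟨u, hu, rfl⟩
    have hle' : ∀ v, N v ≤ 1 → (φ - ψ) v ≤ 2 - a := by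
      intro v hv
      have : a ≤ 2 - (φ - ψ) v := csSup_le hAne (by
        rintro _ ⟨u, hu, rfl⟩
        linarith [hsum u v hu hv])
      linarith
    have ha0 : 0 ≤ a := by simpa using hle 0 (by simp)
    have ha2 : 0 ≤ 2 - a := by simpa using hle' 0 (by simp)
    have b1 := N.abs_le_mul_of_le_on_ball (φ + ψ) hle
    have b2 := N.abs_le_mul_of_le_on_ball (φ - ψ) hle'
    rcases ha0.eq_or_lt with h0 | h0
    · refine ⟨-1, ?_⟩
      ext v
      have := b1 v
      rw [← h0, zero_mul, abs_nonpos_iff] at this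
      simp only [LinearMap.add_apply] at this
      simp only [LinearMap.smul_apply, smul_eq_mul]
      linarith
    rcases ha2.eq_or_lt with h0' | h0'
    · refine ⟨1, ?_⟩
      ext v
      have := b2 v
      rw [← h0', zero_mul, abs_nonpos_iff] at this
      simp only [LinearMap.sub_apply] at this
      simp only [LinearMap.smul_apply, smul_eq_mul]
      linarith
    have m1 : ((a⁻¹ • (φ + ψ) : V →ₗ[ℝ] ℝ) : V → ℝ) ∈ N.polarAnnihilator M := by
      refine ⟨⟨_, rfl⟩, fun v => ?_, fun m hm => by simp [hφM m hm, hψM m hm]⟩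
      rw [LinearMap.smul_apply, smul_eq_mul, abs_mul, abs_of_pos (inv_pos.2 h0),
        inv_mul_le_iff₀ h0]
      exact b1 v
    have m2 : (((2 - a)⁻¹ • (φ - ψ) : V →ₗ[ℝ] ℝ) : V → ℝ) ∈ N.polarAnnihilator M := by
      refine ⟨⟨_, rfl⟩, fun v => ?_, fun m hm => by simp [hφM m hm, hψM m hm]⟩
      rw [LinearMap.smul_apply, smul_eq_mul, abs_mul, abs_of_pos (inv_pos.2 h0'),
        inv_mul_le_iff₀ h0']
      exact b2 v
    have := (hext _ m1 _ m2 ⟨a / 2, (2 - a) / 2, by positivity, by positivity, by ring, by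
      ext v
      simp only [Pi.add_apply, Pi.smul_apply, LinearMap.smul_apply, smul_eq_mul,
        LinearMap.add_apply, LinearMap.sub_apply]
      field_simp
      ring⟩).1
    refine ⟨a - 1, ?_⟩
    ext v
    have hv := congrFun this v
    simp only [LinearMap.smul_apply, smul_eq_mul, LinearMap.add_apply] at hv ⊢
    field_simp at hv
    linarith

open scoped BoundedContinuousFunction

/-- The real continuous functions `f` with `f * v` vanishing at infinity. -/
def WeightedC0 (v : ℝ → ℝ) : Submodule ℝ (ℝ → ℝ) where
  carrier := {f | Continuous f ∧ Tendsto (fun t => f t * v t) (cocompact ℝ) (𝓝 0)}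
  add_mem' := by
    rintro f g ⟨hf, hf'⟩ ⟨hg, hg'⟩
    refine ⟨hf.add hg, ?_⟩
    simpa [add_mul] using hf'.add hg'
  zero_mem' := ⟨continuous_const, by simp⟩
  smul_mem' := by
    rintro c f ⟨hf, hf'⟩
    refine ⟨hf.const_smul c, ?_⟩
    simpa [mul_assoc] using hf'.const_mul c

namespace WeightedC0

variable {v : ℝ → ℝ}

/-- Multiplication by a bounded continuous function. -/
def mul (h : ℝ →ᵇ ℝ) : WeightedC0 v →ₗ[ℝ] WeightedC0 v where
  toFun f := ⟨fun t => h t * f.1 t, h.continuous.mul f.2.1, by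
    have := f.2.2.norm.const_mul ‖h‖
    rw [norm_zero, mul_zero] at this
    refine squeeze_zero_norm (fun t => ?_) this
    rw [mul_assoc, norm_mul]
    gcongr
    exact h.norm_coe_le_norm t⟩
  map_add' f g := by ext t; simp [mul_add]
  map_smul' c f := by ext t; simp; ring

@[simp]
theorem mul_apply (h : ℝ →ᵇ ℝ) (f : WeightedC0 v) (t : ℝ) : (mul h f).1 t = h t * f.1 t := rfl

theorem exists_forall_le_of_usc (hv : UpperSemicontinuous v) {K : Set ℝ} (hK : IsCompact K) :
    ∃ C, 0 < C ∧ ∀ t ∈ K, v t ≤ C := by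
  obtain ⟨C, hC⟩ := (hv.upperSemicontinuousOn K).bddAbove_of_isCompact hK
  exact ⟨max C 1, by positivity, fun t ht => (hC ⟨t, ht, rfl⟩).trans (le_max_left _ _)⟩

theorem exists_isCompact_bound (f : WeightedC0 v) {ε : ℝ} (hε : 0 < ε) :
    ∃ K : Set ℝ, IsCompact K ∧ ∀ t ∉ K, |f.1 t * v t| < ε := by
  have h := f.2.2 (Metric.ball_mem_nhds 0 hε)
  rw [Filter.mem_map, mem_cocompact] at h
  obtain ⟨K, hK, h⟩ := h
  refine ⟨K, hK, fun t ht => ?_⟩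
  simpa using h ht

theorem bddAbove_range (hv0 : ∀ t, 0 ≤ v t) (hv : UpperSemicontinuous v) (f : WeightedC0 v) :
    BddAbove (Set.range fun t => |f.1 t| * v t) := by
  obtain ⟨K, hK, h⟩ := exists_isCompact_bound f one_pos
  obtain ⟨C, hC, hCK⟩ := exists_forall_le_of_usc hv hK
  obtain ⟨D, hD⟩ := hK.exists_bound_of_continuousOn f.2.1.continuousOn
  refine ⟨max 1 (D * C), ?_⟩
  rintro _ ⟨t, rfl⟩
  by_cases ht : t ∈ K
  · exact le_max_of_le_right (mul_le_mul (hD t ht) (hCK t ht) (hv0 t)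
      ((abs_nonneg _).trans (hD t ht)))
  · have := h t ht
    rw [abs_mul, abs_of_nonneg (hv0 t)] at this
    exact le_max_of_le_left this.le

/-- The weighted supremum seminorm. -/
noncomputable def seminorm (hv0 : ∀ t, 0 ≤ v t) (hv : UpperSemicontinuous v) :
    Seminorm ℝ (WeightedC0 v) :=
  Seminorm.of (fun f => ⨆ t, |f.1 t| * v t)
    (fun f g => by
      refine ciSup_le fun t => ?_
      have h1 := le_ciSup (bddAbove_range hv0 hv f) t
      have h2 := le_ciSup (bddAbove_range hv0 hv g) t
      have h3 : |(f + g).1 t| ≤ |f.1 t| + |g.1 t| := abs_add_le _ _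
      have := mul_le_mul_of_nonneg_right h3 (hv0 t)
      beta_reduce at h1 h2
      linarith)
    (fun c f => by
      rw [Real.norm_eq_abs, Real.mul_iSup_of_nonneg (abs_nonneg c)]
      congr 1
      ext t
      change |c * f.1 t| * v t = _
      rw [abs_mul, mul_assoc])

theorem le_seminorm (hv0 : ∀ t, 0 ≤ v t) (hv : UpperSemicontinuous v) (f : WeightedC0 v) (t : ℝ) :
    |f.1 t| * v t ≤ seminorm hv0 hv f :=
  le_ciSup (bddAbove_range hv0 hv f) t

theorem seminorm_le (hv0 : ∀ t, 0 ≤ v t) (hv : UpperSemicontinuous v) (f : WeightedC0 v) {c : ℝ}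
    (h : ∀ t, |f.1 t| * v t ≤ c) : seminorm hv0 hv f ≤ c :=
  ciSup_le h

/-- A nonzero functional on `WeightedC0 v`, bounded by one, vanishing on `M`, and such that every
functional vanishing on `M` and dominated by its total variation is a multiple of it. -/
structure ExtremeAnnihilator (v : ℝ → ℝ) (M : Submodule ℝ (WeightedC0 v))
    (φ : WeightedC0 v →ₗ[ℝ] ℝ) : Prop where
  nonneg : ∀ t, 0 ≤ v t
  usc : UpperSemicontinuous v
  ne_zero : φ ≠ 0
  bound : ∀ (f : WeightedC0 v) (c : ℝ), (∀ t, |f.1 t| * v t ≤ c) → |φ f| ≤ c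
  ann : ∀ m ∈ M, φ m = 0
  ext : ∀ ψ : WeightedC0 v →ₗ[ℝ] ℝ, (∀ m ∈ M, ψ m = 0) →
    (∀ f, ∀ δ > 0, ∃ h : ℝ →ᵇ ℝ, ‖h‖ ≤ 1 ∧ ψ f ≤ φ (mul h f) + δ) → ∃ c : ℝ, ψ = c • φ

theorem exists_extremeAnnihilator (hv0 : ∀ t, 0 ≤ v t) (hv : UpperSemicontinuous v)
    (M : Submodule ℝ (WeightedC0 v)) (f : WeightedC0 v) {ε : ℝ} (hε : 0 < ε)
    (h : ∀ m ∈ M, ∃ t, ε ≤ |f.1 t - m.1 t| * v t) :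
    ∃ φ, ExtremeAnnihilator v M φ := by
  obtain ⟨φ, h1, h2, h3, h4⟩ := (seminorm hv0 hv).exists_extreme_annihilator M f hε
    (fun m hm => by
      obtain ⟨t, ht⟩ := h m hm
      exact ht.trans (le_seminorm hv0 hv (f - m) t))
    (fun i : {h : ℝ →ᵇ ℝ // ‖h‖ ≤ 1} => mul i.1) (by
      rintro ⟨i, hi⟩ u w hu hw
      refine seminorm_le hv0 hv _ fun t => ?_
      change |u.1 t + w.1 t + i t * (u.1 t - w.1 t)| * v t ≤ 2
      have hit := abs_le.1 ((i.norm_coe_le_norm t).trans hi)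
      have hut := (le_seminorm hv0 hv u t).trans hu
      have hwt := (le_seminorm hv0 hv w t).trans hw
      have h1 : |u.1 t + w.1 t + i t * (u.1 t - w.1 t)| ≤
          (1 + i t) * |u.1 t| + (1 - i t) * |w.1 t| := by
        have : u.1 t + w.1 t + i t * (u.1 t - w.1 t) =
          (1 + i t) * u.1 t + (1 - i t) * w.1 t := by ring
        rw [this]
        refine (abs_add_le _ _).trans_eq ?_
        rw [abs_mul, abs_mul, abs_of_nonneg (by linarith [hit.1] : 0 ≤ 1 + i t),
          abs_of_nonneg (by linarith [hit.2] : 0 ≤ 1 - i t)]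
      have h2 := mul_le_mul_of_nonneg_right h1 (hv0 t)
      nlinarith [hit.1, hit.2])
  refine ⟨φ, hv0, hv, h1, fun f c hc => (h2 f).trans (seminorm_le hv0 hv f hc), h3, ?_⟩
  intro ψ hψ hδ
  refine h4 ψ hψ fun f δ hδ' => ?_
  obtain ⟨k, hk, hk'⟩ := hδ f δ hδ'
  exact ⟨⟨k, hk⟩, hk'⟩

/-- The total variation of a functional, as a function on `WeightedC0 v`. -/
noncomputable def variation (φ : WeightedC0 v →ₗ[ℝ] ℝ) (f : WeightedC0 v) : ℝ :=
  ⨆ h : {h : ℝ →ᵇ ℝ // ‖h‖ ≤ 1}, |φ (mul h.1 f)|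

instance : Nonempty {h : ℝ →ᵇ ℝ // ‖h‖ ≤ 1} := ⟨⟨0, by simp⟩⟩

namespace ExtremeAnnihilator

variable {M : Submodule ℝ (WeightedC0 v)} {φ : WeightedC0 v →ₗ[ℝ] ℝ}

theorem bddAbove_variation (H : ExtremeAnnihilator v M φ) (f : WeightedC0 v) :
    BddAbove (Set.range fun h : {h : ℝ →ᵇ ℝ // ‖h‖ ≤ 1} => |φ (mul h.1 f)|) := by
  obtain ⟨C, hC⟩ := bddAbove_range H.nonneg H.usc f
  refine ⟨C, ?_⟩
  rintro _ ⟨⟨h, hh⟩, rfl⟩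
  refine H.bound _ _ fun t => ?_
  rw [mul_apply, abs_mul, mul_assoc]
  have h1 : |f.1 t| * v t ≤ C := hC ⟨t, rfl⟩
  have h2 : |h t| ≤ 1 := (h.norm_coe_le_norm t).trans hh
  have h3 : 0 ≤ |f.1 t| * v t := mul_nonneg (abs_nonneg _) (H.nonneg t)
  nlinarith

theorem variation_nonneg (φ : WeightedC0 v →ₗ[ℝ] ℝ) (f : WeightedC0 v) : 0 ≤ variation φ f :=
  Real.iSup_nonneg fun _ => abs_nonneg _

theorem abs_mul_le (H : ExtremeAnnihilator v M φ) (f : WeightedC0 v) (h : ℝ →ᵇ ℝ) {c : ℝ}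
    (hc : ∀ t, |h t| ≤ c) : |φ (mul h f)| ≤ c * variation φ f := by
  have hc0 : 0 ≤ c := (abs_nonneg _).trans (hc 0)
  rcases hc0.eq_or_lt with h0 | h0
  · have : mul h f = 0 := by
      ext t
      have := hc t
      rw [← h0, abs_nonpos_iff] at this
      simp [this]
    simp [this, ← h0]
  · have h1 : ‖c⁻¹ • h‖ ≤ 1 := by
      rw [BoundedContinuousFunction.norm_le zero_le_one]
      intro t
      change |c⁻¹ * h t| ≤ 1
      rw [abs_mul, abs_of_pos (inv_pos.2 h0), inv_mul_le_iff₀ h0, mul_one]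
      exact hc t
    have h2 := le_ciSup (H.bddAbove_variation f) ⟨_, h1⟩
    have h3 : mul h f = c • mul (c⁻¹ • h) f := by
      ext t
      change h t * f.1 t = c * (c⁻¹ * h t * f.1 t)
      field_simp
    rw [h3, map_smul, smul_eq_mul, abs_mul, abs_of_pos h0]
    gcongr
    exact h2

/-- The total variation seminorm. -/
noncomputable def variationSeminorm (H : ExtremeAnnihilator v M φ) :
    Seminorm ℝ (WeightedC0 v) :=
  Seminorm.of (variation φ)
    (fun f g => by
      refine ciSup_le fun h => ?_
      rw [map_add, map_add]
      exact (abs_add_le _ _).trans (add_le_add (le_ciSup (H.bddAbove_variation f) h)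
        (le_ciSup (H.bddAbove_variation g) h)))
    (fun c f => by
      simp only [variation, map_smul, smul_eq_mul, abs_mul]
      rw [Real.norm_eq_abs, Real.mul_iSup_of_nonneg (abs_nonneg c)])

theorem exists_eq_smul_of_le_variation (H : ExtremeAnnihilator v M φ)
    (ψ : WeightedC0 v →ₗ[ℝ] ℝ) (hψM : ∀ m ∈ M, ψ m = 0) (hψ : ∀ f, |ψ f| ≤ variation φ f) :
    ∃ c : ℝ, ψ = c • φ := by
  refine H.ext ψ hψM fun f δ hδ => ?_
  obtain ⟨⟨h, hh⟩, hlt⟩ := exists_lt_of_lt_ciSup (sub_lt_self (variation φ f) hδ)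
  have h1 := (abs_le.1 (hψ f)).2
  rcases le_total 0 (φ (mul h f)) with hs | hs
  · refine ⟨h, hh, ?_⟩
    simp only [abs_of_nonneg hs] at hlt
    linarith
  · refine ⟨-h, by rwa [norm_neg], ?_⟩
    have : mul (-h) f = -mul h f := by
      ext t
      change -h t * f.1 t = -(h t * f.1 t)
      ring
    rw [this, map_neg]
    simp only [abs_of_nonpos hs] at hlt
    linarith

/-- The annihilated subspace is dense in the kernel for the total variation seminorm. -/
theorem exists_variation_sub_lt (H : ExtremeAnnihilator v M φ) {f : WeightedC0 v} (hf : φ f = 0)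
    {ε : ℝ} (hε : 0 < ε) : ∃ m ∈ M, variation φ (f - m) < ε := by
  by_contra! hcon
  obtain ⟨ψ, h1, h2, h3⟩ := H.variationSeminorm.exists_linearMap_of_dist_pos M f hε hcon
  obtain ⟨c, rfl⟩ := H.exists_eq_smul_of_le_variation ψ h2 h1
  exact h3 (by simp [hf])

/-- A bounded multiplier carrying `φ` to another annihilator of `M` acts as a constant. -/
theorem exists_const_of_mul_ann (H : ExtremeAnnihilator v M φ) (h : ℝ →ᵇ ℝ)
    (hM : ∀ m ∈ M, φ (mul h m) = 0) : ∃ c : ℝ, ∀ f, φ (mul h f) = c * φ f := by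
  set C := ‖h‖ + 1 with hC
  have hC0 : 0 < C := by positivity
  obtain ⟨c, hc⟩ := H.exists_eq_smul_of_le_variation (C⁻¹ • (φ ∘ₗ mul h))
    (fun m hm => by simp [hM m hm]) (fun f => by
      rw [LinearMap.smul_apply, smul_eq_mul, abs_mul, abs_of_pos (inv_pos.2 hC0),
        inv_mul_le_iff₀ hC0]
      exact H.abs_mul_le f h fun t => (h.norm_coe_le_norm t).trans (by linarith))
  refine ⟨C * c, fun f => ?_⟩
  have := LinearMap.congr_fun hc f
  simp only [LinearMap.smul_apply, smul_eq_mul, LinearMap.comp_apply] at this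
  rw [mul_assoc, ← this]
  field_simp

end ExtremeAnnihilator

end WeightedC0

open scoped BoundedContinuousFunction

namespace WeightedC0

variable {v : ℝ → ℝ}

/-- A continuous function with compact support, as an element of `WeightedC0 v`. -/
def ofCompact (f : ℝ → ℝ) (hf : Continuous f) {x r : ℝ} (h : ∀ t, r ≤ |t - x| → f t = 0) :
    WeightedC0 v :=
  ⟨f, hf, by
    refine tendsto_const_nhds.congr' ?_
    have : ∀ᶠ t in cocompact ℝ, t ∉ Metric.closedBall x r :=
      (isCompact_closedBall x r).compl_mem_cocompact
    filter_upwards [this] with t ht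
    rw [Metric.mem_closedBall, Real.dist_eq, not_le] at ht
    rw [h t ht.le, zero_mul]⟩

/-- A piecewise linear bump function, equal to `1` on `[x - r, x + r]` and supported in
`[x - 2 r, x + 2 r]`. -/
noncomputable def bump (x r : ℝ) : ℝ →ᵇ ℝ :=
  BoundedContinuousFunction.ofNormedAddCommGroup (fun t => max 0 (min 1 (2 - |t - x| / r)))
    (by fun_prop) 1 (fun t => by
      rw [Real.norm_of_nonneg (le_max_left _ _)]
      exact max_le zero_le_one (min_le_left _ _))

theorem bump_apply (x r t : ℝ) : bump x r t = max 0 (min 1 (2 - |t - x| / r)) := rfl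

theorem bump_nonneg (x r t : ℝ) : 0 ≤ bump x r t := le_max_left _ _

theorem bump_le_one (x r t : ℝ) : bump x r t ≤ 1 := max_le zero_le_one (min_le_left _ _)

theorem bump_eq_one {x r t : ℝ} (hr : 0 < r) (h : |t - x| ≤ r) : bump x r t = 1 := by
  have : |t - x| / r ≤ 1 := (div_le_one hr).2 h
  rw [bump_apply, min_eq_left (by linarith), max_eq_right zero_le_one]

theorem bump_eq_zero {x r t : ℝ} (hr : 0 < r) (h : 2 * r ≤ |t - x|) : bump x r t = 0 := by
  have : 2 ≤ |t - x| / r := (le_div_iff₀ hr).2 h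
  rw [bump_apply, max_eq_left ((min_le_right _ _).trans (by linarith))]

/-- The support of a functional. -/
def support (φ : WeightedC0 v →ₗ[ℝ] ℝ) : Set ℝ :=
  {x | ∀ δ > 0, ∃ g : WeightedC0 v, (∀ t, δ ≤ |t - x| → g.1 t = 0) ∧ φ g ≠ 0}

theorem notMem_support {φ : WeightedC0 v →ₗ[ℝ] ℝ} {x : ℝ} :
    x ∉ support φ ↔ ∃ δ > 0, ∀ g : WeightedC0 v, (∀ t, δ ≤ |t - x| → g.1 t = 0) → φ g = 0 := by
  simp only [support, Set.mem_ofPred_eq]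
  push Not
  rfl

theorem map_eq_zero_of_disjoint_support {φ : WeightedC0 v →ₗ[ℝ] ℝ} (g : WeightedC0 v)
    (hg : IsCompact (tsupport g.1)) (hS : Disjoint (tsupport g.1) (support φ)) : φ g = 0 := by
  have : ∀ x ∈ tsupport g.1, ∃ δ > 0, ∀ g : WeightedC0 v,
      (∀ t, δ ≤ |t - x| → g.1 t = 0) → φ g = 0 := fun x hx =>
    notMem_support.1 (Set.disjoint_left.1 hS hx)
  choose! δ hδ hφ using this
  obtain ⟨s, hs, hsub⟩ := hg.elim_nhds_subcover (fun x => Metric.ball x (δ x))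
    fun x hx => Metric.ball_mem_nhds x (hδ x hx)
  obtain ⟨f, hf1, hf2, hf3, -⟩ := exists_continuous_sum_one_of_isOpen_isCompact
    (s := fun i : Fin s.card => Metric.ball (s.equivFin.symm i : ℝ) (δ (s.equivFin.symm i)))
    (fun i => Metric.isOpen_ball) hg (by
      intro x hx
      obtain ⟨y, hy, hxy⟩ := Set.mem_iUnion₂.1 (hsub hx)
      refine Set.mem_iUnion.2 ⟨s.equivFin ⟨y, hy⟩, ?_⟩
      simpa using hxy)
  let F : Fin s.card → ℝ →ᵇ ℝ := fun i =>
    BoundedContinuousFunction.ofNormedAddCommGroup (f i) (f i).continuous 1 (fun t => by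
      rw [Real.norm_of_nonneg (hf3 i t).1]
      exact (hf3 i t).2)
  have hsum : g = ∑ i, mul (F i) g := by
    ext t
    have h1 : (∑ i, mul (F i) g).1 t = ∑ i, f i t * g.1 t := by
      rw [Submodule.coe_sum, Finset.sum_apply]
      rfl
    rw [h1, ← Finset.sum_mul]
    by_cases ht : t ∈ tsupport g.1
    · have := hf2 ht
      simp only [Finset.sum_apply, Pi.one_apply] at this
      rw [this, one_mul]
    · rw [image_eq_zero_of_notMem_tsupport ht, mul_zero]
  rw [hsum, map_sum]
  refine Finset.sum_eq_zero fun i _ => hφ _ (hs _ (s.equivFin.symm i).2) _ fun t ht => ?_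
  have : t ∉ tsupport (f i) := fun h => by
    have := hf1 i h
    rw [Metric.mem_ball, Real.dist_eq] at this
    linarith
  change f i t * g.1 t = 0
  rw [image_eq_zero_of_notMem_tsupport this, zero_mul]

/-- A point where a continuous multiplier annihilating `φ` does not vanish is not in the support. -/
theorem notMem_support_of_mul {φ : WeightedC0 v →ₗ[ℝ] ℝ} {x : ℝ} {u : ℝ → ℝ} (hu : Continuous u)
    (hx : u x ≠ 0) (h : ∀ (k : ℝ → ℝ) (g : WeightedC0 v), Continuous k →
      (∃ r, ∀ t, r ≤ |t - x| → k t = 0) → (∀ t, g.1 t = k t * u t) → φ g = 0) :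
    x ∉ support φ := by
  have hη : 0 < u x ^ 2 / 2 := by positivity
  have : ∀ᶠ t in 𝓝 x, u x ^ 2 / 2 < u t ^ 2 :=
    (hu.pow 2).continuousAt.eventually_const_lt (by rw [Pi.pow_apply]; linarith)
  obtain ⟨δ, hδ, hball⟩ := Metric.eventually_nhds_iff.1 this
  refine notMem_support.2 ⟨δ, hδ, fun g hg => ?_⟩
  refine h (fun t => g.1 t * (u t / max (u t ^ 2) (u x ^ 2 / 2))) g
    (g.2.1.mul (hu.div (by fun_prop) fun t => (lt_max_of_lt_right hη).ne'))
    ⟨δ, fun t ht => by simp [hg t ht]⟩ fun t => ?_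
  by_cases ht : δ ≤ |t - x|
  · simp [hg t ht]
  · have h1 := hball (y := t) (by rw [Real.dist_eq]; linarith)
    rw [max_eq_left h1.le]
    have : u t ≠ 0 := fun h0 => by
      rw [h0] at h1
      linarith
    field_simp

namespace ExtremeAnnihilator

variable {M : Submodule ℝ (WeightedC0 v)} {φ : WeightedC0 v →ₗ[ℝ] ℝ}

/-- A function far out is small: multiplication by wide bumps converges in norm. -/
theorem exists_bump_bound (H : ExtremeAnnihilator v M φ) (f : WeightedC0 v) {ε : ℝ} (hε : 0 < ε) :
    ∃ R > 0, ∀ t, |f.1 t - bump 0 R t * f.1 t| * v t ≤ ε := by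
  obtain ⟨K, hK, hKε⟩ := exists_isCompact_bound f hε
  obtain ⟨R, hR⟩ := hK.isBounded.subset_closedBall 0
  refine ⟨max R 1, by positivity, fun t => ?_⟩
  by_cases ht : t ∈ K
  · have := hR ht
    rw [Metric.mem_closedBall, Real.dist_eq] at this
    rw [bump_eq_one (by positivity) (this.trans (le_max_left _ _))]
    simpa using hε.le
  · have h1 := hKε t ht
    rw [abs_mul, abs_of_nonneg (H.nonneg t)] at h1
    have h2 : f.1 t - bump 0 (max R 1) t * f.1 t = (1 - bump 0 (max R 1) t) * f.1 t := by ring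
    have h3 := bump_nonneg 0 (max R 1) t
    have h4 := bump_le_one 0 (max R 1) t
    rw [h2, abs_mul, abs_of_nonneg (by linarith), mul_assoc]
    have h5 : 0 ≤ |f.1 t| * v t := mul_nonneg (abs_nonneg _) (H.nonneg t)
    nlinarith

theorem map_eq_zero_of_eqOn_support (H : ExtremeAnnihilator v M φ) (f : WeightedC0 v)
    (hf : ∀ x ∈ support φ, f.1 x = 0) : φ f = 0 := by
  have key : ∀ ε > 0, |φ f| ≤ 2 * ε := by
    intro ε hε
    obtain ⟨R, hR, hRε⟩ := H.exists_bump_bound f hε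
    obtain ⟨C, hC, hCv⟩ := exists_forall_le_of_usc H.usc
      (isCompact_closedBall (0 : ℝ) (2 * R))
    set δ := ε / C with hδ
    have hδ0 : 0 < δ := by positivity
    set f₁ : ℝ → ℝ := fun t => bump 0 R t * f.1 t with hf₁
    have hf₁c : Continuous f₁ := (bump 0 R).continuous.mul f.2.1
    have hf₁0 : ∀ t, 2 * R ≤ |t - 0| → f₁ t = 0 := fun t ht => by
      simp only [f₁, bump_eq_zero hR ht, zero_mul]
    set h₀ : ℝ → ℝ := fun t => f₁ t - max (-δ) (min δ (f₁ t)) with hh₀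
    have hh0 : ∀ t, |f₁ t| < δ → h₀ t = 0 := fun t ht => by
      have := abs_lt.1 ht
      simp only [h₀]
      rw [min_eq_right this.2.le, max_eq_right this.1.le, sub_self]
    let h : WeightedC0 v := ofCompact h₀ (by fun_prop) (x := 0) (r := 2 * R) fun t ht =>
      hh0 t (by rw [hf₁0 t ht]; simpa using hδ0)
    have hsub : tsupport h.1 ⊆ {t | δ ≤ |f₁ t|} := by
      refine closure_minimal (fun t ht => ?_) (isClosed_le (by fun_prop) (by fun_prop))
      by_contra hcon
      exact ht (hh0 t (not_le.1 hcon))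
    have hcomp : IsCompact (tsupport h.1) := by
      refine (isCompact_closedBall (0 : ℝ) (2 * R)).of_isClosed_subset (isClosed_tsupport _) ?_
      refine closure_minimal (fun t ht => ?_) Metric.isClosed_closedBall
      by_contra hcon
      rw [Metric.mem_closedBall, Real.dist_eq, not_le] at hcon
      exact ht (hh0 t (by rw [hf₁0 t hcon.le]; simpa using hδ0))
    have hφh : φ h = 0 := by
      refine map_eq_zero_of_disjoint_support h hcomp (Set.disjoint_left.2 fun t ht hS => ?_)
      have := hsub ht
      simp only [Set.mem_ofPred_eq, f₁, hf t hS, mul_zero, abs_zero] at this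
      linarith
    have hbd : |φ (f - h)| ≤ 2 * ε := by
      refine H.bound _ _ fun t => ?_
      have e1 : (f - h).1 t = (f.1 t - f₁ t) + max (-δ) (min δ (f₁ t)) := by
        change f.1 t - (f₁ t - max (-δ) (min δ (f₁ t))) = _
        ring
      have e2 : |max (-δ) (min δ (f₁ t))| * v t ≤ ε := by
        by_cases ht : t ∈ Metric.closedBall (0 : ℝ) (2 * R)
        · have : |max (-δ) (min δ (f₁ t))| ≤ δ :=
            abs_le.2 ⟨le_max_left _ _, max_le (by linarith) (min_le_left _ _)⟩
          calc _ ≤ δ * C := mul_le_mul this (hCv t ht) (H.nonneg t) hδ0.le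
            _ = ε := by rw [hδ]; field_simp
        · rw [Metric.mem_closedBall, Real.dist_eq, not_le] at ht
          rw [hf₁0 t ht.le, min_eq_right hδ0.le, max_eq_right (by linarith)]
          simpa using hε.le
      rw [e1]
      have := mul_le_mul_of_nonneg_right (abs_add_le (f.1 t - f₁ t) (max (-δ) (min δ (f₁ t))))
        (H.nonneg t)
      have := hRε t
      simp only [f₁] at *
      linarith
    rwa [map_sub, hφh, sub_zero] at hbd
  by_contra hne
  have := key (|φ f| / 4) (by positivity)
  have h0 : 0 < |φ f| := by positivity
  linarith

theorem support_nonempty (H : ExtremeAnnihilator v M φ) : (support φ).Nonempty := by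
  by_contra hS
  rw [Set.not_nonempty_iff_eq_empty] at hS
  refine H.ne_zero ?_
  ext f
  exact H.map_eq_zero_of_eqOn_support f (by simp [hS])

end ExtremeAnnihilator

end WeightedC0

namespace WeightedC0

variable {v : ℝ → ℝ}

/-- The real part of a bounded continuous function. -/
noncomputable def rePart (h : ℝ →ᵇ ℂ) : ℝ →ᵇ ℝ :=
  BoundedContinuousFunction.ofNormedAddCommGroup (fun t => (h t).re) (by fun_prop) ‖h‖
    fun t => (Complex.abs_re_le_norm _).trans (h.norm_coe_le_norm t)

/-- The imaginary part of a bounded continuous function. -/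
noncomputable def imPart (h : ℝ →ᵇ ℂ) : ℝ →ᵇ ℝ :=
  BoundedContinuousFunction.ofNormedAddCommGroup (fun t => (h t).im) (by fun_prop) ‖h‖
    fun t => (Complex.abs_im_le_norm _).trans (h.norm_coe_le_norm t)

@[simp] theorem rePart_apply (h : ℝ →ᵇ ℂ) (t : ℝ) : rePart h t = (h t).re := rfl

@[simp] theorem imPart_apply (h : ℝ →ᵇ ℂ) (t : ℝ) : imPart h t = (h t).im := rfl

/-- The complex-linear functional `h ↦ φ (h g)` on bounded continuous complex functions. -/
noncomputable def pairing (φ : WeightedC0 v →ₗ[ℝ] ℝ) (g : WeightedC0 v) : (ℝ →ᵇ ℂ) →ₗ[ℂ] ℂ where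
  toFun h := ⟨φ (mul (rePart h) g), φ (mul (imPart h) g)⟩
  map_add' h k := by
    have h1 : mul (rePart (h + k)) g = mul (rePart h) g + mul (rePart k) g := by
      ext t
      change (h t + k t).re * g.1 t = (h t).re * g.1 t + (k t).re * g.1 t
      rw [Complex.add_re, add_mul]
    have h2 : mul (imPart (h + k)) g = mul (imPart h) g + mul (imPart k) g := by
      ext t
      change (h t + k t).im * g.1 t = (h t).im * g.1 t + (k t).im * g.1 t
      rw [Complex.add_im, add_mul]
    apply Complex.ext <;> simp [h1, h2]
  map_smul' c h := by
    have h1 : mul (rePart (c • h)) g = c.re • mul (rePart h) g - c.im • mul (imPart h) g := by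
      ext t
      change (c * h t).re * g.1 t = c.re * ((h t).re * g.1 t) - c.im * ((h t).im * g.1 t)
      rw [Complex.mul_re]
      ring
    have h2 : mul (imPart (c • h)) g = c.re • mul (imPart h) g + c.im • mul (rePart h) g := by
      ext t
      change (c * h t).im * g.1 t = c.re * ((h t).im * g.1 t) + c.im * ((h t).re * g.1 t)
      rw [Complex.mul_im]
      ring
    apply Complex.ext <;> simp [h1, h2]

theorem pairing_apply (φ : WeightedC0 v →ₗ[ℝ] ℝ) (g : WeightedC0 v) (h : ℝ →ᵇ ℂ) :
    pairing φ g h = ⟨φ (mul (rePart h) g), φ (mul (imPart h) g)⟩ := rfl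

/-- The pairing is additive in the second variable. -/
theorem pairing_sub (φ : WeightedC0 v →ₗ[ℝ] ℝ) (f g : WeightedC0 v) (h : ℝ →ᵇ ℂ) :
    pairing φ (f - g) h = pairing φ f h - pairing φ g h := by
  apply Complex.ext <;> simp [pairing_apply]

/-- The Cauchy kernel `t ↦ 1 / (t - w)` as a bounded function (zero for real `w`). -/
noncomputable def cauchyKernel (w : ℂ) : ℝ →ᵇ ℂ :=
  if h : w.im ≠ 0 then
    BoundedContinuousFunction.ofNormedAddCommGroup (fun t : ℝ => ((t : ℂ) - w)⁻¹)
      (by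
        refine Continuous.inv₀ (by fun_prop) fun t h0 => h ?_
        have := congrArg Complex.im h0
        simpa using this) |w.im|⁻¹
      (fun t => by
        rw [norm_inv]
        refine inv_anti₀ (abs_pos.2 h) ?_
        have := Complex.abs_im_le_norm ((t : ℂ) - w)
        simpa using this)
  else 0

theorem cauchyKernel_apply {w : ℂ} (hw : w.im ≠ 0) (t : ℝ) :
    cauchyKernel w t = ((t : ℂ) - w)⁻¹ := by
  rw [cauchyKernel, dif_pos hw]
  rfl

theorem ofReal_sub_ne_zero {w : ℂ} (hw : w.im ≠ 0) (t : ℝ) : (t : ℂ) - w ≠ 0 := fun h0 => hw (by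
  have := congrArg Complex.im h0
  simpa using this)

theorem norm_cauchyKernel_le (w : ℂ) : ‖cauchyKernel w‖ ≤ |w.im|⁻¹ := by
  by_cases hw : w.im ≠ 0
  · rw [cauchyKernel, dif_pos hw]
    exact BoundedContinuousFunction.norm_ofNormedAddCommGroup_le _ (inv_nonneg.2 (abs_nonneg _)) _
  · rw [cauchyKernel, dif_neg hw, norm_zero]
    positivity

theorem cauchyKernel_sub {w z : ℂ} (hw : w.im ≠ 0) (hz : z.im ≠ 0) :
    cauchyKernel w - cauchyKernel z = (w - z) • (cauchyKernel w * cauchyKernel z) := by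
  ext t
  simp only [BoundedContinuousFunction.coe_sub, Pi.sub_apply, BoundedContinuousFunction.coe_smul,
    BoundedContinuousFunction.coe_mul, Pi.mul_apply, cauchyKernel_apply hw,
    cauchyKernel_apply hz, smul_eq_mul]
  have h1 := ofReal_sub_ne_zero hw t
  have h2 := ofReal_sub_ne_zero hz t
  field_simp
  ring

theorem continuousAt_cauchyKernel {w : ℂ} (hw : w.im ≠ 0) : ContinuousAt cauchyKernel w := by
  have hev : ∀ᶠ z in 𝓝 w, z.im ≠ 0 := Complex.continuous_im.continuousAt.eventually_ne hw
  rw [ContinuousAt, tendsto_iff_norm_sub_tendsto_zero]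
  have hlim : Tendsto (fun z : ℂ => ‖z - w‖ * (|z.im|⁻¹ * |w.im|⁻¹)) (𝓝 w) (𝓝 0) := by
    have : ContinuousAt (fun z : ℂ => ‖z - w‖ * (|z.im|⁻¹ * |w.im|⁻¹)) w := by
      refine ContinuousAt.mul (by fun_prop) (ContinuousAt.mul (ContinuousAt.inv₀ ?_ ?_) (by fun_prop))
      · exact Complex.continuous_im.abs.continuousAt
      · exact (abs_pos.2 hw).ne'
    simpa [ContinuousAt] using this
  refine squeeze_zero' (Eventually.of_forall fun _ => norm_nonneg _) ?_ hlim
  filter_upwards [hev] with z hz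
  rw [cauchyKernel_sub hz hw, norm_smul]
  gcongr
  exact (norm_mul_le _ _).trans (mul_le_mul (norm_cauchyKernel_le z) (norm_cauchyKernel_le w)
    (norm_nonneg _) (by positivity))

theorem hasDerivAt_cauchyKernel {w : ℂ} (hw : w.im ≠ 0) :
    HasDerivAt cauchyKernel (cauchyKernel w * cauchyKernel w) w := by
  rw [hasDerivAt_iff_tendsto_slope]
  have hev : ∀ᶠ z in 𝓝 w, z.im ≠ 0 := Complex.continuous_im.continuousAt.eventually_ne hw
  have h1 : Tendsto (fun z => cauchyKernel z * cauchyKernel w) (𝓝[≠] w)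
      (𝓝 (cauchyKernel w * cauchyKernel w)) :=
    ((continuousAt_cauchyKernel hw).tendsto.mono_left nhdsWithin_le_nhds).mul tendsto_const_nhds
  refine h1.congr' ?_
  filter_upwards [nhdsWithin_le_nhds hev, self_mem_nhdsWithin] with z hz hne
  rw [slope_def_module, cauchyKernel_sub hz hw, smul_smul,
    inv_mul_cancel₀ (sub_ne_zero.2 hne), one_smul]

/-- The Cauchy transform `w ↦ φ (g / (· - w))`. -/
noncomputable def cauchyTransform (φ : WeightedC0 v →ₗ[ℝ] ℝ) (g : WeightedC0 v) (w : ℂ) : ℂ :=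
  pairing φ g (cauchyKernel w)

theorem cauchyTransform_sub (φ : WeightedC0 v →ₗ[ℝ] ℝ) (f g : WeightedC0 v) (w : ℂ) :
    cauchyTransform φ (f - g) w = cauchyTransform φ f w - cauchyTransform φ g w :=
  pairing_sub φ f g _

/-- A real subspace of `WeightedC0 v` whose elements `m` extend to entire functions `E m`, closed
under the difference quotients `(F(w) G - G(w) F) / (· - w)`, and without common zeros. -/
structure IsDeBrangesSubspace (M : Submodule ℝ (WeightedC0 v)) (E : WeightedC0 v → ℂ → ℂ) :
    Prop where
  differentiable : ∀ m ∈ M, Differentiable ℂ (E m)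
  eq_ofReal : ∀ m ∈ M, ∀ t : ℝ, E m t = m.1 t
  quot : ∀ m ∈ M, ∀ n ∈ M, ∀ w : ℂ, w.im ≠ 0 → ∃ a ∈ M, ∃ b ∈ M, ∀ t : ℝ,
    (E m w * n.1 t - E n w * m.1 t) * ((t : ℂ) - w)⁻¹ = a.1 t + b.1 t * Complex.I
  exists_ne_zero : ∀ w : ℂ, ∃ m ∈ M, E m w ≠ 0

/-- Entire functions agreeing on the real line are equal. -/
theorem eq_of_eq_on_real {F G : ℂ → ℂ} (hF : Differentiable ℂ F) (hG : Differentiable ℂ G)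
    (h : ∀ t : ℝ, F t = G t) : F = G := by
  refine AnalyticOnNhd.eq_of_frequently_eq (z₀ := 0)
    (hF.differentiableOn.analyticOnNhd isOpen_univ |>.mono (Set.subset_univ _))
    (hG.differentiableOn.analyticOnNhd isOpen_univ |>.mono (Set.subset_univ _)) ?_
  have ht : Tendsto (fun n : ℕ => (((1 / ((n : ℝ) + 1) : ℝ)) : ℂ)) atTop (𝓝[≠] 0) := by
    refine tendsto_nhdsWithin_iff.2 ⟨?_, Eventually.of_forall fun n => ?_⟩
    · have := (Complex.continuous_ofReal.tendsto 0).comp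
        (tendsto_one_div_add_atTop_nhds_zero_nat (𝕜 := ℝ))
      simpa [Function.comp_def] using this
    · have : (0 : ℝ) < 1 / ((n : ℝ) + 1) := by positivity
      exact Complex.ofReal_ne_zero.2 this.ne'
  exact ht.frequently (Frequently.of_forall fun n => h _)

namespace IsDeBrangesSubspace

variable {M : Submodule ℝ (WeightedC0 v)} {E : WeightedC0 v → ℂ → ℂ}

theorem map_sub (D : IsDeBrangesSubspace M E) {m n : WeightedC0 v} (hm : m ∈ M) (hn : n ∈ M)
    (w : ℂ) : E (m - n) w = E m w - E n w := by
  refine congrFun (eq_of_eq_on_real (D.differentiable _ (M.sub_mem hm hn))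
    ((D.differentiable m hm).sub (D.differentiable n hn)) fun t => ?_) w
  rw [Pi.sub_apply, D.eq_ofReal _ (M.sub_mem hm hn), D.eq_ofReal _ hm, D.eq_ofReal _ hn]
  exact Complex.ofReal_sub _ _

theorem map_conj (D : IsDeBrangesSubspace M E) {m : WeightedC0 v} (hm : m ∈ M) (w : ℂ) :
    E m (conj w) = conj (E m w) := by
  have h := congrFun (eq_of_eq_on_real (F := E m) (G := conj ∘ E m ∘ conj)
    (D.differentiable m hm) (fun z => differentiableAt_conj_conj_iff.2 (D.differentiable m hm _)) fun t => by
      simp [D.eq_ofReal m hm]) (conj w)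
  simpa using h

end IsDeBrangesSubspace

namespace ExtremeAnnihilator

variable {M : Submodule ℝ (WeightedC0 v)} {φ : WeightedC0 v →ₗ[ℝ] ℝ} {E : WeightedC0 v → ℂ → ℂ}

theorem norm_pairing_le (H : ExtremeAnnihilator v M φ) (g : WeightedC0 v) (h : ℝ →ᵇ ℂ) :
    ‖pairing φ g h‖ ≤ 2 * variation φ g * ‖h‖ := by
  have h1 := H.abs_mul_le g (rePart h) fun t =>
    (Complex.abs_re_le_norm _).trans (h.norm_coe_le_norm t)
  have h2 := H.abs_mul_le g (imPart h) fun t =>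
    (Complex.abs_im_le_norm _).trans (h.norm_coe_le_norm t)
  refine (Complex.norm_le_abs_re_add_abs_im _).trans ?_
  simp only [pairing_apply]
  linarith

theorem norm_cauchyTransform_le (H : ExtremeAnnihilator v M φ) (g : WeightedC0 v) (w : ℂ) :
    ‖cauchyTransform φ g w‖ ≤ 2 * variation φ g * |w.im|⁻¹ := by
  refine (H.norm_pairing_le g _).trans ?_
  have := variation_nonneg φ g
  gcongr
  exact norm_cauchyKernel_le w

theorem differentiableAt_cauchyTransform (H : ExtremeAnnihilator v M φ) (g : WeightedC0 v) {w : ℂ}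
    (hw : w.im ≠ 0) : DifferentiableAt ℂ (cauchyTransform φ g) w :=
  (((pairing φ g).mkContinuous _ (H.norm_pairing_le g)).differentiableAt.comp w
    (hasDerivAt_cauchyKernel hw).differentiableAt : _)

theorem mul_cauchyTransform_comm (H : ExtremeAnnihilator v M φ) (D : IsDeBrangesSubspace M E)
    {m n : WeightedC0 v} (hm : m ∈ M) (hn : n ∈ M) {w : ℂ} (hw : w.im ≠ 0) :
    E m w * cauchyTransform φ n w = E n w * cauchyTransform φ m w := by
  obtain ⟨a, ha, b, hb, hab⟩ := D.quot m hm n hn w hw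
  rw [cauchyTransform, cauchyTransform, ← smul_eq_mul, ← smul_eq_mul, ← map_smul, ← map_smul,
    ← sub_eq_zero]
  have key : ∀ t : ℝ, (E m w * cauchyKernel w t) * n.1 t - (E n w * cauchyKernel w t) * m.1 t =
      a.1 t + b.1 t * Complex.I := fun t => by
    rw [← hab t, cauchyKernel_apply hw]
    ring
  have h1 : mul (rePart (E m w • cauchyKernel w)) n - mul (rePart (E n w • cauchyKernel w)) m
      = a := by
    ext t
    have := congrArg Complex.re (key t)
    simp only [Complex.sub_re, Complex.re_mul_ofReal, Complex.add_re, Complex.ofReal_re,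
      Complex.re_ofReal_mul, Complex.I_re, mul_zero, add_zero] at this
    exact this
  have h2 : mul (imPart (E m w • cauchyKernel w)) n - mul (imPart (E n w • cauchyKernel w)) m
      = b := by
    ext t
    have := congrArg Complex.im (key t)
    simp only [Complex.sub_im, Complex.im_mul_ofReal, Complex.add_im, Complex.ofReal_im,
      Complex.im_ofReal_mul, Complex.I_im, mul_one, zero_add] at this
    exact this
  have h3 := H.ann a ha
  have h4 := H.ann b hb
  rw [← h1, map_sub] at h3
  rw [← h2, map_sub] at h4
  exact Complex.ext h3 h4

/-- A multiplier carrying `φ` to an annihilator is constant on the support. -/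
theorem exists_eq_const_on_support (H : ExtremeAnnihilator v M φ) (h : ℝ →ᵇ ℝ)
    (hM : ∀ m ∈ M, φ (mul h m) = 0) : ∃ c : ℝ, ∀ x ∈ support φ, h x = c := by
  obtain ⟨c, hc⟩ := H.exists_const_of_mul_ann h hM
  refine ⟨c, fun x hx => ?_⟩
  by_contra hne
  refine notMem_support_of_mul (u := fun t => h t - c) (by fun_prop) (sub_ne_zero.2 hne) ?_ hx
  rintro k g hk ⟨r, hr⟩ hg
  have : g = mul h (ofCompact k hk hr) - c • ofCompact k hk hr := by
    ext t
    rw [hg]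
    change _ = h t * k t - c * k t
    ring
  rw [this, map_sub, map_smul, hc, smul_eq_mul, sub_self]

theorem not_support_subset_singleton (H : ExtremeAnnihilator v M φ)
    (D : IsDeBrangesSubspace M E) (s : ℝ) : ¬ support φ ⊆ {s} := by
  intro hs
  obtain ⟨n, hn, hns⟩ := D.exists_ne_zero s
  rw [D.eq_ofReal n hn, Complex.ofReal_ne_zero] at hns
  refine H.ne_zero ?_
  ext f
  have := H.map_eq_zero_of_eqOn_support (f - (f.1 s / n.1 s) • n) (fun x hx => by
    rw [hs hx]
    change f.1 s - f.1 s / n.1 s * n.1 s = 0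
    field_simp
    ring)
  rw [map_sub, map_smul, H.ann n hn, smul_zero, sub_zero] at this
  simpa using this

/-- The Cauchy transform of `m ∈ M` vanishes off the real line only at zeros of `m`. -/
theorem cauchyTransform_ne_zero (H : ExtremeAnnihilator v M φ) (D : IsDeBrangesSubspace M E)
    {m : WeightedC0 v} (hm : m ∈ M) {w : ℂ} (hw : w.im ≠ 0) (hmw : E m w ≠ 0) :
    cauchyTransform φ m w ≠ 0 := by
  intro h0
  have hall : ∀ n ∈ M, cauchyTransform φ n w = 0 := fun n hn => by
    have := H.mul_cauchyTransform_comm D hm hn hw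
    rw [h0, mul_zero] at this
    exact (mul_eq_zero.1 this).resolve_left hmw
  obtain ⟨c₁, h1⟩ := H.exists_eq_const_on_support (rePart (cauchyKernel w))
    fun n hn => congrArg Complex.re (hall n hn)
  obtain ⟨c₂, h2⟩ := H.exists_eq_const_on_support (imPart (cauchyKernel w))
    fun n hn => congrArg Complex.im (hall n hn)
  obtain ⟨s, hs⟩ := H.support_nonempty
  refine H.not_support_subset_singleton D s fun x hx => ?_
  have : cauchyKernel w x = cauchyKernel w s :=
    Complex.ext ((h1 x hx).trans (h1 s hs).symm) ((h2 x hx).trans (h2 s hs).symm)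
  rw [cauchyKernel_apply hw, cauchyKernel_apply hw, inv_inj, sub_left_inj] at this
  exact Complex.ofReal_injective this

end ExtremeAnnihilator

end WeightedC0

/-- A Harnack-type inequality: a bounded zero-free holomorphic function on a disc is bounded below
in terms of its value at the center. -/
theorem Complex.le_norm_of_forall_ne_zero {g : ℂ → ℂ} {c : ℂ} {R K b : ℝ} (hR : 0 < R)
    (hg : DifferentiableOn ℂ g (Metric.ball c R)) (h0 : ∀ z ∈ Metric.ball c R, g z ≠ 0)
    (hK : ∀ z ∈ Metric.ball c R, ‖g z‖ ≤ K) (hb : 0 < b) (hbc : b ≤ ‖g c‖) {z : ℂ}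
    (hz : z ∈ Metric.ball c R) :
    b * Real.exp (-(2 * (Real.log (K / b) + 1) * R / (R - ‖z - c‖))) ≤ ‖g z‖ := by
  have hc := Metric.mem_ball_self (x := c) hR
  have hld : DifferentiableOn ℂ (logDeriv g) (Metric.ball c R) :=
    (hg.deriv Metric.isOpen_ball).div hg h0
  obtain ⟨q, hq0, hq⟩ := hld.isExactOn_ball.with_val_at c 0
  have hqd : DifferentiableOn ℂ q (Metric.ball c R) := fun x hx =>
    (hq x hx).differentiableAt.differentiableWithinAt
  obtain ⟨a, ha0, ha⟩ := (logDeriv_eqOn_iff hg hqd.cexp Metric.isOpen_ball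
    (convex_ball c R).isPreconnected (fun x _ => Complex.exp_ne_zero _) h0).1 (fun x hx => by
      have h1 : HasDerivAt (fun x => Complex.exp (q x)) _ x := (hq x hx).cexp
      rw [logDeriv_apply (fun x => Complex.exp (q x)), h1.deriv,
        mul_div_cancel_left₀ _ (Complex.exp_ne_zero _)])
  have hac : g c = a := by simpa [hq0] using ha hc
  have hgn : ∀ x ∈ Metric.ball c R, ‖g x‖ = ‖g c‖ * Real.exp (q x).re := fun x hx => by
    rw [ha hx, hac, Pi.smul_apply, norm_smul, Complex.norm_exp]
  have hKb : 1 ≤ K / b := (one_le_div hb).2 (hbc.trans (hK c hc))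
  have hlog := Real.log_nonneg hKb
  have hre : ∀ x ∈ Metric.ball c R, (q x).re ≤ Real.log (K / b) := fun x hx => by
    rw [Real.le_log_iff_exp_le (by linarith), le_div_iff₀ hb, mul_comm]
    refine le_trans ?_ (hK x hx)
    rw [hgn x hx]
    gcongr
  have hshift : ∀ ζ ∈ Metric.ball (0 : ℂ) R, c + ζ ∈ Metric.ball c R := fun ζ hζ => by
    simpa using hζ
  have hz' : z - c ∈ Metric.ball (0 : ℂ) R := by simpa [dist_eq_norm] using hz
  have hBC := Complex.borelCaratheodory_zero (f := fun ζ => q (c + ζ))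
    (M := Real.log (K / b) + 1) (by linarith)
    (hqd.comp (by fun_prop) hshift) (fun ζ hζ => (hre _ (hshift ζ hζ)).trans (by linarith)) hR
    hz' (by simpa using hq0)
  rw [add_sub_cancel] at hBC
  have hzn : ‖z - c‖ < R := by simpa using hz'
  have h1 := neg_le_of_abs_le (Complex.abs_re_le_norm (q z))
  rw [hgn z hz]
  gcongr
  refine le_trans ?_ h1
  refine neg_le_neg (hBC.trans ?_)
  gcongr

/-- A function holomorphic in the upper half-plane near a real point, without zeros there and of at
most polynomial growth at the real line, admits a lower bound `c exp (-A / Im z)`. -/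
theorem Complex.exists_mul_exp_le_norm {g : ℂ → ℂ} {x₀ ρ K : ℝ} (hρ : 0 < ρ)
    (hg : ∀ z, 0 < z.im → DifferentiableAt ℂ g z)
    (h0 : ∀ z ∈ Metric.ball (x₀ : ℂ) (3 * ρ), 0 < z.im → g z ≠ 0)
    (hK : ∀ z, 0 < z.im → ‖g z‖ ≤ K * |z.im|⁻¹) :
    ∃ c > 0, ∃ A > 0, ∀ z : ℂ, |z.re - x₀| ≤ ρ → 0 < z.im → z.im ≤ ρ →
      c * Real.exp (-(A / z.im)) ≤ ‖g z‖ := by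
  have him : ∀ x : ℝ, ((x : ℂ) + ρ * Complex.I).im = ρ := fun x => by simp
  have hmem : ∀ x ∈ Set.Icc (x₀ - ρ) (x₀ + ρ), ∀ w ∈ Metric.ball ((x : ℂ) + ρ * Complex.I) ρ,
      w ∈ Metric.ball (x₀ : ℂ) (3 * ρ) := fun x hx w hw => by
    rw [mem_ball_iff_norm] at hw ⊢
    have h1 : ‖(x : ℂ) - x₀‖ ≤ ρ := by
      rw [← Complex.ofReal_sub, Complex.norm_real, Real.norm_eq_abs, abs_le]
      constructor <;> linarith [hx.1, hx.2]
    have h2 : ‖(ρ : ℂ) * Complex.I‖ = ρ := by simp [abs_of_pos hρ]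
    have h3 : w - x₀ = (w - (x + ρ * Complex.I)) + (x - x₀) + ρ * Complex.I := by ring
    rw [h3]
    refine (norm_add₃_le).trans_lt ?_
    linarith
  have hcont : ContinuousOn (fun x : ℝ => ‖g (x + ρ * Complex.I)‖) (Set.Icc (x₀ - ρ) (x₀ + ρ)) :=
    fun x hx => by
      have := (hg (x + ρ * Complex.I) (by simpa using hρ)).continuousAt
      refine (ContinuousAt.norm ?_).continuousWithinAt
      exact ContinuousAt.comp (f := fun x : ℝ => (x : ℂ) + ρ * Complex.I) this (by fun_prop)
  obtain ⟨x₁, hx₁, hmin⟩ := isCompact_Icc.exists_isMinOn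
    (Set.nonempty_Icc.2 (by linarith : x₀ - ρ ≤ x₀ + ρ)) hcont
  have hb₀ : 0 < ‖g (x₁ + ρ * Complex.I)‖ := norm_pos_iff.2
    (h0 _ (hmem x₁ hx₁ _ (Metric.mem_ball_self hρ)) (by simpa using hρ))
  set b := ‖g (x₁ + ρ * Complex.I)‖ with hb
  refine ⟨b, hb₀, max 1 (2 * (Real.log (2 * ρ * K / (ρ ^ 2 * b)) + 1) * ρ), by positivity,
    fun z hzx hz0 hzρ => ?_⟩
  set c : ℂ := z.re + ρ * Complex.I with hc
  have hre : z.re ∈ Set.Icc (x₀ - ρ) (x₀ + ρ) := by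
    rw [abs_le] at hzx
    constructor <;> linarith
  have hdisc : ∀ w ∈ Metric.ball c ρ, ‖w - z.re‖ ^ 2 < 2 * ρ * w.im := fun w hw => by
    rw [mem_ball_iff_norm] at hw
    have := pow_lt_pow_left₀ hw (norm_nonneg _) two_ne_zero
    rw [Complex.sq_norm, Complex.normSq_apply] at this ⊢
    simp only [hc, Complex.sub_re, Complex.sub_im, Complex.add_re, Complex.add_im,
      Complex.ofReal_re, Complex.ofReal_im, Complex.mul_re, Complex.mul_im, Complex.I_re,
      Complex.I_im, mul_zero, mul_one, sub_zero, zero_add, add_zero] at this ⊢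
    nlinarith
  have himpos : ∀ w ∈ Metric.ball c ρ, 0 < w.im := fun w hw => by
    have := (sq_nonneg _).trans_lt (hdisc w hw)
    exact (pos_iff_pos_of_mul_pos this).1 (by positivity)
  have hcz : z - c = ((z.im - ρ : ℝ) : ℂ) * Complex.I := by
    apply Complex.ext <;> simp [hc]
  have hnorm : ‖z - c‖ = ρ - z.im := by
    rw [hcz, norm_mul, Complex.norm_I, mul_one, Complex.norm_real, Real.norm_eq_abs, abs_sub_comm,
      abs_of_nonneg (by linarith)]
  have hrez : z - z.re = z.im * Complex.I := by
    apply Complex.ext <;> simp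
  have hrec : c - z.re = ρ * Complex.I := by rw [hc]; ring
  have key := Complex.le_norm_of_forall_ne_zero (g := fun w => (w - z.re) ^ 2 * g w) (c := c)
    (R := ρ) (K := 2 * ρ * K) (b := ρ ^ 2 * b) hρ
    (fun w hw => ((by fun_prop : DifferentiableAt ℂ (fun w => (w - (z.re : ℂ)) ^ 2) w).mul
      (hg w (himpos w hw))).differentiableWithinAt)
    (fun w hw => mul_ne_zero (pow_ne_zero _ fun h => (himpos w hw).ne' (by
      have := congrArg Complex.im h
      simpa using this)) (h0 w (hmem _ hre w hw) (himpos w hw)))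
    (fun w hw => by
      have h1 := himpos w hw
      rw [norm_mul, norm_pow]
      refine (mul_le_mul (hdisc w hw).le (hK w h1) (norm_nonneg _) (by positivity)).trans_eq ?_
      rw [abs_of_pos h1]
      field_simp)
    (by positivity)
    (by
      rw [hrec, norm_mul, norm_pow, norm_mul, Complex.norm_I, mul_one, Complex.norm_real,
        Real.norm_of_nonneg hρ.le]
      gcongr
      exact hmin hre)
    (z := z) (by rw [mem_ball_iff_norm, hnorm]; linarith)
  rw [hnorm, sub_sub_cancel, hrez, norm_mul, norm_pow, norm_mul, Complex.norm_I, mul_one,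
    Complex.norm_real, Real.norm_of_nonneg hz0.le] at key
  have h2 : z.im ^ 2 * ‖g z‖ ≤ ρ ^ 2 * ‖g z‖ := by gcongr
  refine le_of_mul_le_mul_left ?_ (by positivity : 0 < ρ ^ 2)
  refine le_trans ?_ (key.trans h2)
  rw [← mul_assoc]
  gcongr
  exact le_max_right _ _

/-- A function holomorphic near the origin and dominated by `K exp (A / |Im z|)` off the real line is
bounded near the origin by a constant depending only on `K` and `A`. -/
theorem Complex.norm_le_of_norm_le_exp {F : ℂ → ℂ} (hF : Differentiable ℂ F) {ρ A K : ℝ}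
    (hρ : 0 < ρ) (hA : 0 < A) (hK0 : 0 ≤ K)
    (hK : ∀ z : ℂ, |z.re| ≤ ρ → z.im ≠ 0 → |z.im| ≤ ρ → ‖F z‖ ≤ K * Real.exp (A / |z.im|))
    {z : ℂ} (hz : ‖z‖ < ρ / 2) : ‖F z‖ ≤ K * Real.exp (16 * A / ρ) := by
  set U : Set ℂ := {z | |z.re| + |z.im| < ρ} with hU
  have hUo : IsOpen U := isOpen_lt (by fun_prop) continuous_const
  have hcl : ∀ z ∈ closure U, |z.re| + |z.im| ≤ ρ := fun z hz =>
    closure_lt_subset_le (by fun_prop) continuous_const hz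
  have hfr : ∀ z ∈ frontier U, |z.re| + |z.im| = ρ := fun z hz =>
    frontier_lt_subset_eq (f := fun z : ℂ => |z.re| + |z.im|) (by fun_prop) continuous_const hz
  have hbdd : Bornology.IsBounded U := Metric.isBounded_iff_subset_closedBall (0 : ℂ) |>.2
    ⟨ρ, fun z hz => by
      rw [mem_closedBall_zero_iff]
      exact (Complex.norm_le_abs_re_add_abs_im z).trans (le_of_lt hz)⟩
  obtain ⟨N, hN⟩ := hbdd.isCompact_closure.exists_bound_of_continuousOn hF.continuous.continuousOn
  set P : ℂ → ℂ := fun z => (z + ρ)⁻¹ + (ρ - z)⁻¹ with hP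
  have hre : ∀ w : ℂ, |w.im| ≤ w.re → 1 / 2 * ‖w‖⁻¹ ≤ (w⁻¹).re := fun w hw => by
    rcases eq_or_ne w 0 with rfl | h0
    · simp
    have hn := norm_pos_iff.2 h0
    have h1 := Complex.norm_le_abs_re_add_abs_im w
    rw [abs_of_nonneg ((abs_nonneg _).trans hw)] at h1
    rw [Complex.inv_re, Complex.normSq_eq_norm_sq, le_div_iff₀ (by positivity)]
    field_simp
    linarith
  have hsector : ∀ z ∈ closure U, |z.im| ≤ (z + ρ).re ∧ |z.im| ≤ (ρ - z).re := fun z hz => by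
    have := hcl z hz
    have h1 := neg_abs_le z.re
    have h2 := le_abs_self z.re
    simp only [Complex.add_re, Complex.sub_re, Complex.ofReal_re]
    constructor <;> linarith
  have hP1 : ∀ z ∈ closure U, 1 / 2 * ‖z + ρ‖⁻¹ ≤ (P z).re ∧ 1 / 2 * ‖ρ - z‖⁻¹ ≤ (P z).re :=
    fun z hz => by
      have h1 := hre (z + ρ) (by simpa using (hsector z hz).1)
      have h2 := hre (ρ - z) (by simpa using (hsector z hz).2)
      have h3 : 0 ≤ 1 / 2 * ‖z + ρ‖⁻¹ := by positivity
      have h4 : 0 ≤ 1 / 2 * ‖ρ - z‖⁻¹ := by positivity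
      simp only [hP, Complex.add_re]
      constructor <;> linarith
  classical
  set H : ℂ → ℂ := fun z => if z + ρ = 0 ∨ ρ - z = 0 then 0 else
    F z * Complex.exp (-(4 * A) * P z) with hH
  have hHeq : ∀ z : ℂ, z + ρ ≠ 0 → ρ - z ≠ 0 → H z = F z * Complex.exp (-(4 * A) * P z) :=
    fun z h1 h2 => if_neg (by tauto)
  have hHnorm : ∀ z : ℂ, z + ρ ≠ 0 → ρ - z ≠ 0 → ‖H z‖ = ‖F z‖ * Real.exp (-(4 * A * (P z).re)) :=
    fun z h1 h2 => by
      rw [hHeq z h1 h2, norm_mul, Complex.norm_exp]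
      congr 2
      have : -(4 * (A : ℂ)) = ((-(4 * A) : ℝ) : ℂ) := by push_cast; ring
      rw [this, Complex.re_ofReal_mul]
      ring
  have hHdiff : ∀ z : ℂ, z + ρ ≠ 0 → ρ - z ≠ 0 → DifferentiableAt ℂ H z := fun z h1 h2 => by
    have h3 : DifferentiableAt ℂ (fun z => F z * Complex.exp (-(4 * A) * P z)) z := by
      have := hF z
      simp only [hP]
      fun_prop (disch := assumption)
    refine h3.congr_of_eventuallyEq ?_
    have h4 : ∀ᶠ w : ℂ in 𝓝 z, w + ρ ≠ 0 :=
      ContinuousAt.eventually_ne (g := fun w : ℂ => w + ρ) (by fun_prop) h1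
    have h5 : ∀ᶠ w : ℂ in 𝓝 z, ρ - w ≠ 0 :=
      ContinuousAt.eventually_ne (g := fun w : ℂ => ρ - w) (by fun_prop) h2
    filter_upwards [h4, h5] with w hw1 hw2 using hHeq w hw1 hw2
  have hdecay : ∀ r p : ℝ, 0 < r → 1 / 2 * r⁻¹ ≤ p → Real.exp (-(4 * A * p)) ≤ r / (2 * A) :=
    fun r p hr hp => by
      have h1 : 2 * A / r ≤ 4 * A * p := by
        have := mul_le_mul_of_nonneg_left hp (by positivity : 0 ≤ 4 * A)
        refine le_trans (le_of_eq ?_) this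
        field_simp
        ring
      have h2 := Real.add_one_le_exp (4 * A * p)
      rw [Real.exp_neg, inv_le_comm₀ (Real.exp_pos _) (by positivity), inv_div]
      linarith
  have hN0 : ∀ z ∈ closure U, 0 ≤ N := fun z hz => (norm_nonneg _).trans (hN z hz)
  have hHb1 : ∀ z ∈ closure U, ‖H z‖ ≤ N * (‖z + ρ‖ / (2 * A)) ∧
      ‖H z‖ ≤ N * (‖ρ - z‖ / (2 * A)) := fun z hz => by
    have hN0 := hN0 z hz
    by_cases h : z + ρ = 0 ∨ ρ - z = 0
    · have : H z = 0 := if_pos h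
      rw [this, norm_zero]
      constructor <;> positivity
    · push Not at h
      rw [hHnorm z h.1 h.2]
      exact ⟨mul_le_mul (hN z hz) (hdecay _ _ (norm_pos_iff.2 h.1) (hP1 z hz).1)
        (Real.exp_pos _).le hN0, mul_le_mul (hN z hz) (hdecay _ _ (norm_pos_iff.2 h.2) (hP1 z hz).2)
        (Real.exp_pos _).le hN0⟩
  have hcont : ContinuousOn H (closure U) := fun z hz => by
    by_cases h : z + ρ = 0 ∨ ρ - z = 0
    · have h0 : H z = 0 := if_pos h
      rw [ContinuousWithinAt, h0]
      rcases h with h | h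
      · refine squeeze_zero_norm' (eventually_nhdsWithin_of_forall fun w hw => (hHb1 w hw).1) ?_
        have : ContinuousAt (fun w : ℂ => N * (‖w + ρ‖ / (2 * A))) z := by fun_prop
        simpa [ContinuousAt, h] using this.tendsto.mono_left (nhdsWithin_le_nhds (s := closure U))
      · refine squeeze_zero_norm' (eventually_nhdsWithin_of_forall fun w hw => (hHb1 w hw).2) ?_
        have : ContinuousAt (fun w : ℂ => N * (‖ρ - w‖ / (2 * A))) z := by fun_prop
        simpa [ContinuousAt, h] using this.tendsto.mono_left (nhdsWithin_le_nhds (s := closure U))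
    · push Not at h
      exact (hHdiff z h.1 h.2).continuousAt.continuousWithinAt
  have hne : ∀ z : ℂ, |z.re| < ρ → z + ρ ≠ 0 ∧ ρ - z ≠ 0 := fun z hz => by
    rw [abs_lt] at hz
    constructor
    · intro h
      have := congrArg Complex.re h
      simp only [Complex.add_re, Complex.ofReal_re, Complex.zero_re] at this
      linarith
    · intro h
      have := congrArg Complex.re h
      simp only [Complex.sub_re, Complex.ofReal_re, Complex.zero_re] at this
      linarith
  have hdcl : DiffContOnCl ℂ H U := ⟨fun z hz => by
    have hz' : |z.re| + |z.im| < ρ := hz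
    have := hne z (by linarith [abs_nonneg z.im])
    exact (hHdiff z this.1 this.2).differentiableWithinAt, hcont⟩
  have hbound : ∀ z ∈ frontier U, ‖H z‖ ≤ K := fun z hz => by
    by_cases h : z + ρ = 0 ∨ ρ - z = 0
    · have : H z = 0 := if_pos h
      rwa [this, norm_zero]
    · push Not at h
      have hzc := frontier_subset_closure hz
      have h1 := hfr z hz
      have h2 : 1 / 4 * |z.im|⁻¹ ≤ (P z).re ∧ z.im ≠ 0 := by
        rcases le_total 0 z.re with h3 | h3
        · rw [abs_of_nonneg h3] at h1
          have h4 := Complex.norm_le_abs_re_add_abs_im (ρ - z)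
          have h5 := norm_pos_iff.2 h.2
          have h6 : (ρ - z).re = |z.im| := by simp; linarith
          have h7 : |(ρ - z).im| = |z.im| := by simp
          rw [h6, h7, abs_abs] at h4
          have h8 : 0 < |z.im| := by linarith
          refine ⟨le_trans ?_ (hP1 z hzc).2, abs_pos.1 h8⟩
          have := inv_anti₀ h5 h4
          rw [← two_mul, mul_inv] at this
          linarith
        · rw [abs_of_nonpos h3] at h1
          have h4 := Complex.norm_le_abs_re_add_abs_im (z + ρ)
          have h5 := norm_pos_iff.2 h.1
          have h6 : (z + ρ).re = |z.im| := by simp; linarith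
          have h7 : |(z + ρ).im| = |z.im| := by simp
          rw [h6, h7, abs_abs] at h4
          have h8 : 0 < |z.im| := by linarith
          refine ⟨le_trans ?_ (hP1 z hzc).1, abs_pos.1 h8⟩
          have := inv_anti₀ h5 h4
          rw [← two_mul, mul_inv] at this
          linarith
      rw [hHnorm z h.1 h.2]
      have h3 : |z.re| ≤ ρ := by linarith [abs_nonneg z.im]
      have h4 : |z.im| ≤ ρ := by linarith [abs_nonneg z.re]
      refine (mul_le_mul_of_nonneg_right (hK z h3 h2.2 h4) (Real.exp_pos _).le).trans ?_
      rw [mul_assoc, ← Real.exp_add]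
      refine mul_le_of_le_one_right hK0 (Real.exp_le_one_iff.2 ?_)
      have := mul_le_mul_of_nonneg_left h2.1 (by positivity : 0 ≤ 4 * A)
      rw [div_eq_mul_inv]
      linarith
  have hzU : z ∈ U := by
    change |z.re| + |z.im| < ρ
    linarith [Complex.abs_re_le_norm z, Complex.abs_im_le_norm z]
  have hfin := Complex.norm_le_of_forall_mem_frontier_norm_le hbdd hdcl hbound (subset_closure hzU)
  have hz12 := hne z (by linarith [Complex.abs_re_le_norm z, norm_nonneg z])
  rw [hHnorm z hz12.1 hz12.2, Real.exp_neg, mul_inv_le_iff₀ (Real.exp_pos _)] at hfin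
  refine hfin.trans ?_
  gcongr
  have hρn : ‖(ρ : ℂ)‖ = ρ := by rw [Complex.norm_real, Real.norm_of_nonneg hρ.le]
  have hPn : (P z).re ≤ 4 / ρ := by
    refine (Complex.re_le_norm _).trans ((norm_add_le _ _).trans ?_)
    rw [norm_inv, norm_inv]
    have h1 : ρ / 2 ≤ ‖z + ρ‖ := by
      have := norm_sub_norm_le (ρ : ℂ) (-z)
      rw [norm_neg, sub_neg_eq_add, add_comm (ρ : ℂ)] at this
      linarith
    have h2 : ρ / 2 ≤ ‖ρ - z‖ := by
      have := norm_sub_norm_le (ρ : ℂ) z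
      linarith
    have h3 := inv_anti₀ (by positivity) h1
    have h4 := inv_anti₀ (by positivity) h2
    have h5 : (4 : ℝ) / ρ = (ρ / 2)⁻¹ + (ρ / 2)⁻¹ := by field_simp; norm_num
    linarith
  have := mul_le_mul_of_nonneg_left hPn (by positivity : 0 ≤ 4 * A)
  refine this.trans_eq ?_
  ring

namespace WeightedC0.ExtremeAnnihilator

variable {v : ℝ → ℝ} {M : Submodule ℝ (WeightedC0 v)} {φ : WeightedC0 v →ₗ[ℝ] ℝ}
  {E : WeightedC0 v → ℂ → ℂ}

/-- Point evaluations near a real point are bounded with respect to the total variation. -/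
theorem exists_norm_le_variation_of_real (H : ExtremeAnnihilator v M φ)
    (D : IsDeBrangesSubspace M E) (x₀ : ℝ) :
    ∃ δ > 0, ∃ K, ∀ m ∈ M, ∀ z ∈ Metric.ball (x₀ : ℂ) δ, ‖E m z‖ ≤ K * variation φ m := by
  obtain ⟨n, hn, hn0⟩ := D.exists_ne_zero x₀
  have hdn := D.differentiable n hn
  obtain ⟨r, hr, hball⟩ := Metric.eventually_nhds_iff_ball.1
    (hdn.continuous.continuousAt.eventually_ne hn0)
  obtain ⟨ρ, hρ, rfl⟩ : ∃ ρ, 0 < ρ ∧ r = 3 * ρ := ⟨r / 3, by positivity, by ring⟩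
  obtain ⟨N, hN⟩ := (isCompact_closedBall (x₀ : ℂ) (2 * ρ)).exists_bound_of_continuousOn
    hdn.continuous.continuousOn
  have hN0 : 0 ≤ N := (norm_nonneg _).trans (hN x₀ (Metric.mem_closedBall_self (by positivity)))
  obtain ⟨c, hc, A, hA, hlow⟩ := Complex.exists_mul_exp_le_norm (g := cauchyTransform φ n)
    (x₀ := x₀) (ρ := ρ) (K := 2 * variation φ n) hρ
    (fun z hz => H.differentiableAt_cauchyTransform n hz.ne')
    (fun z hz hz0 => H.cauchyTransform_ne_zero D hn hz0.ne' (hball z hz))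
    (fun z _ => H.norm_cauchyTransform_le n z)
  have hup : ∀ m ∈ M, ∀ z : ℂ, |z.re - x₀| ≤ ρ → 0 < z.im → z.im ≤ ρ →
      ‖E m z‖ ≤ 2 * N / c * variation φ m * Real.exp ((A + 1) / z.im) := fun m hm z h1 h2 h3 => by
    have hm0 := variation_nonneg φ m
    have h4 := congrArg norm (H.mul_cauchyTransform_comm D hm hn h2.ne')
    rw [norm_mul, norm_mul] at h4
    have h5 : ‖E n z‖ ≤ N := hN z (by
      rw [mem_closedBall_iff_norm]
      refine (Complex.norm_le_abs_re_add_abs_im _).trans ?_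
      simp only [Complex.sub_re, Complex.ofReal_re, Complex.sub_im, Complex.ofReal_im, sub_zero,
        abs_of_pos h2]
      linarith)
    have h6 : ‖cauchyTransform φ m z‖ ≤ 2 * variation φ m * Real.exp (1 / z.im) := by
      refine (H.norm_cauchyTransform_le m z).trans ?_
      rw [abs_of_pos h2, ← one_div]
      gcongr
      linarith [Real.add_one_le_exp (1 / z.im)]
    have h7 := mul_le_mul h5 h6 (norm_nonneg _) hN0
    rw [← h4] at h7
    have h8 := (mul_le_mul_of_nonneg_left (hlow z h1 h2 h3) (norm_nonneg (E m z))).trans h7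
    rw [Real.exp_neg, ← mul_assoc, mul_inv_le_iff₀ (Real.exp_pos _)] at h8
    rw [add_div, Real.exp_add]
    refine le_of_mul_le_mul_right (h8.trans_eq ?_) hc
    field_simp
  refine ⟨ρ / 2, by positivity, 2 * N / c * Real.exp (16 * (A + 1) / ρ), fun m hm z hz => ?_⟩
  have hm0 := variation_nonneg φ m
  have key := Complex.norm_le_of_norm_le_exp (F := fun z => E m (z + x₀))
    ((D.differentiable m hm).comp (by fun_prop)) (ρ := ρ) (A := A + 1)
    (K := 2 * N / c * variation φ m) hρ (by positivity) (by positivity) (fun z h1 h2 h3 => by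
      rcases lt_or_gt_of_ne h2 with h2 | h2
      · have := hup m hm (conj (z + x₀)) (by simpa using h1) (by simpa using h2)
          (by simpa [abs_of_neg h2] using h3)
        rw [D.map_conj hm, RCLike.norm_conj] at this
        simpa [abs_of_neg h2] using this
      · have := hup m hm (z + x₀) (by simpa using h1) (by simpa using h2)
          (by simpa [abs_of_pos h2] using h3)
        simpa [abs_of_pos h2] using this)
    (z := z - x₀) (by rwa [mem_ball_iff_norm] at hz)
  simp only [sub_add_cancel] at key
  refine key.trans_eq ?_
  ring

/-- Point evaluations are locally uniformly bounded with respect to the total variation. -/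
theorem exists_norm_le_variation (H : ExtremeAnnihilator v M φ)
    (D : IsDeBrangesSubspace M E) (z₀ : ℂ) :
    ∃ δ > 0, ∃ K, ∀ m ∈ M, ∀ z ∈ Metric.ball z₀ δ, ‖E m z‖ ≤ K * variation φ m := by
  by_cases hz₀ : z₀.im = 0
  · have : z₀ = (z₀.re : ℂ) := Complex.ext rfl hz₀
    rw [this]
    exact H.exists_norm_le_variation_of_real D _
  obtain ⟨n, hn, hn0⟩ := D.exists_ne_zero z₀
  have hC0 := H.cauchyTransform_ne_zero D hn hz₀ hn0
  have hcont : ContinuousAt (fun z => ‖E n z‖ * (2 * |z.im|⁻¹) / ‖cauchyTransform φ n z‖) z₀ := by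
    have h1 := (D.differentiable n hn).continuous.continuousAt (x := z₀)
    have h2 := (H.differentiableAt_cauchyTransform n hz₀).continuousAt
    have h3 := (abs_pos.2 hz₀).ne'
    refine ContinuousAt.div (h1.norm.mul (continuousAt_const.mul (ContinuousAt.inv₀ ?_ h3))) h2.norm
      (norm_ne_zero_iff.2 hC0)
    exact Complex.continuous_im.abs.continuousAt
  obtain ⟨K, hK⟩ := exists_gt (‖E n z₀‖ * (2 * |z₀.im|⁻¹) / ‖cauchyTransform φ n z₀‖)
  have hev := (hcont.eventually_lt_const hK).and
    ((Complex.continuous_im.continuousAt.eventually_ne hz₀).and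
    ((H.differentiableAt_cauchyTransform n hz₀).continuousAt.eventually_ne hC0))
  obtain ⟨δ, hδ, hball⟩ := Metric.eventually_nhds_iff_ball.1 hev
  refine ⟨δ, hδ, K, fun m hm z hz => ?_⟩
  obtain ⟨h1, h2, h3⟩ := hball z hz
  refine le_trans ?_ (mul_le_mul_of_nonneg_right h1.le (variation_nonneg φ m))
  have h4 := congrArg norm (H.mul_cauchyTransform_comm D hm hn h2)
  rw [norm_mul, norm_mul] at h4
  have h5 := norm_pos_iff.2 h3
  rw [div_mul_eq_mul_div, le_div_iff₀ h5, h4, mul_assoc]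
  gcongr
  refine (H.norm_cauchyTransform_le m z).trans_eq ?_
  ring

end WeightedC0.ExtremeAnnihilator

namespace WeightedC0.ExtremeAnnihilator

variable {v : ℝ → ℝ} {M : Submodule ℝ (WeightedC0 v)} {φ : WeightedC0 v →ₗ[ℝ] ℝ}
  {E : WeightedC0 v → ℂ → ℂ}

theorem exists_tendstoLocallyUniformly (H : ExtremeAnnihilator v M φ)
    (D : IsDeBrangesSubspace M E) {f : WeightedC0 v} {m : ℕ → WeightedC0 v} (hm : ∀ n, m n ∈ M)
    (hmf : Tendsto (fun n => variation φ (f - m n)) atTop (𝓝 0)) :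
    ∃ F : ℂ → ℂ, TendstoLocallyUniformly (fun n => E (m n)) F atTop := by
  have hvar : ∀ n k, variation φ (m n - m k) ≤ variation φ (f - m n) + variation φ (f - m k) :=
    fun n k => by
      have h1 : m n - m k = (f - m k) - (f - m n) := by abel
      rw [h1, add_comm]
      exact map_sub_le_add H.variationSeminorm _ _
  have hK : ∀ z₀ : ℂ, ∃ δ > 0, ∃ K, 0 < K ∧ ∀ z ∈ Metric.ball z₀ δ, ∀ n k,
      ‖E (m n) z - E (m k) z‖ ≤ K * (variation φ (f - m n) + variation φ (f - m k)) := fun z₀ => by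
    obtain ⟨δ, hδ, K, hK⟩ := H.exists_norm_le_variation D z₀
    refine ⟨δ, hδ, max K 1, by positivity, fun z hz n k => ?_⟩
    rw [← D.map_sub (hm n) (hm k)]
    refine (hK _ (M.sub_mem (hm n) (hm k)) z hz).trans ?_
    exact mul_le_mul (le_max_left _ _) (hvar n k) (variation_nonneg φ _) (by positivity)
  have hcauchy : ∀ z, ∃ y, Tendsto (fun n => E (m n) z) atTop (𝓝 y) := fun z => by
    obtain ⟨δ, hδ, K, hK0, hK⟩ := hK z
    refine cauchySeq_tendsto_of_complete (Metric.cauchySeq_iff.2 fun ε hε => ?_)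
    obtain ⟨N, hN⟩ := eventually_atTop.1
      (hmf.eventually_lt_const (by positivity : 0 < ε / (2 * K)))
    refine ⟨N, fun n hn k hk => ?_⟩
    rw [dist_eq_norm]
    refine (hK z (Metric.mem_ball_self hδ) n k).trans_lt ?_
    have := mul_lt_mul_of_pos_left (add_lt_add (hN n hn) (hN k hk)) hK0
    refine this.trans_eq ?_
    field_simp
    norm_num
  choose F hF using hcauchy
  refine ⟨F, Metric.tendstoLocallyUniformly_iff.2 fun ε hε z₀ => ?_⟩
  obtain ⟨δ, hδ, K, hK0, hK⟩ := hK z₀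
  refine ⟨Metric.ball z₀ δ, Metric.ball_mem_nhds _ hδ, ?_⟩
  filter_upwards [hmf.eventually_lt_const (by positivity : 0 < ε / K)] with n hn z hz
  rw [dist_comm, dist_eq_norm]
  have h1 : Tendsto (fun k => ‖E (m n) z - E (m k) z‖) atTop (𝓝 ‖E (m n) z - F z‖) :=
    (tendsto_const_nhds.sub (hF z)).norm
  have h2 : Tendsto (fun k => K * (variation φ (f - m n) + variation φ (f - m k))) atTop
      (𝓝 (K * (variation φ (f - m n) + 0))) := (tendsto_const_nhds.add hmf).const_mul K
  refine (le_of_tendsto_of_tendsto' h1 h2 fun k => hK z hz n k).trans_lt ?_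
  rw [add_zero, ← lt_div_iff₀' hK0]
  exact hn

/-- Functions annihilated by `φ` extend from the support of `φ` to entire functions. -/
theorem exists_entire_extension (H : ExtremeAnnihilator v M φ) (D : IsDeBrangesSubspace M E)
    {f : WeightedC0 v} (hf : φ f = 0) :
    ∃ F : ℂ → ℂ, Differentiable ℂ F ∧ (∀ z, F (conj z) = conj (F z)) ∧
      (∀ m ∈ M, ∀ w : ℂ, w.im ≠ 0 → F w * cauchyTransform φ m w = E m w * cauchyTransform φ f w) ∧
      ∀ t ∈ support φ, F t = f.1 t := by
  choose m hm hmf using fun n : ℕ => H.exists_variation_sub_lt hf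
    (Nat.one_div_pos_of_nat (n := n) (α := ℝ))
  have hlim : Tendsto (fun n => variation φ (f - m n)) atTop (𝓝 0) :=
    squeeze_zero (fun n => variation_nonneg φ _) (fun n => (hmf n).le)
      tendsto_one_div_add_atTop_nhds_zero_nat
  obtain ⟨F, hF⟩ := H.exists_tendstoLocallyUniformly D hm hlim
  have hFt : ∀ z, Tendsto (fun n => E (m n) z) atTop (𝓝 (F z)) := fun z =>
    (tendstoLocallyUniformlyOn_univ.2 hF).tendsto_at (Set.mem_univ z)
  have hFd : Differentiable ℂ F := by
    rw [← differentiableOn_univ]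
    exact (tendstoLocallyUniformlyOn_univ.2 hF).differentiableOn
      (Eventually.of_forall fun n => (D.differentiable _ (hm n)).differentiableOn) isOpen_univ
  have hconj : ∀ z, F (conj z) = conj (F z) := fun z => by
    refine tendsto_nhds_unique (hFt (conj z)) ?_
    simp only [D.map_conj (hm _)]
    exact (Complex.continuous_conj.tendsto _).comp (hFt z)
  refine ⟨F, hFd, hconj, fun n hn w hw => ?_, fun x hx => ?_⟩
  · have h1 : Tendsto (fun k => cauchyTransform φ (m k) w) atTop (𝓝 (cauchyTransform φ f w)) := by
      rw [tendsto_iff_norm_sub_tendsto_zero]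
      refine squeeze_zero (fun _ => norm_nonneg _) (fun k => ?_)
        (g := fun k => 2 * variation φ (f - m k) * |w.im|⁻¹)
        (by simpa using (hlim.const_mul 2).mul_const |w.im|⁻¹)
      rw [norm_sub_rev, ← cauchyTransform_sub]
      exact H.norm_cauchyTransform_le _ w
    refine tendsto_nhds_unique ((hFt w).mul_const _) ?_
    simp only [H.mul_cauchyTransform_comm D (hm _) hn hw]
    exact h1.const_mul _
  · have hreal : ∀ t : ℝ, F t = (F t).re := fun t => by
      have := hconj t
      rw [Complex.conj_ofReal] at this
      exact (Complex.conj_eq_iff_re.1 this.symm).symm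
    rw [hreal x, Complex.ofReal_inj]
    by_contra hne
    refine notMem_support_of_mul (u := fun t => f.1 t - (F t).re)
      (f.2.1.sub (Complex.continuous_re.comp (hFd.continuous.comp Complex.continuous_ofReal)))
      (sub_ne_zero.2 (Ne.symm hne)) ?_ hx
    rintro k g hk ⟨r, hr⟩ hg
    have hcomp := isCompact_closedBall x r
    obtain ⟨C, hC⟩ := hcomp.exists_bound_of_continuousOn hk.continuousOn
    obtain ⟨N, hN, hvN⟩ := exists_forall_le_of_usc H.usc hcomp
    have hkC : ∀ t, ‖k t‖ ≤ max C 1 := fun t => by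
      by_cases ht : t ∈ Metric.closedBall x r
      · exact (hC t ht).trans (le_max_left _ _)
      · rw [Metric.mem_closedBall, Real.dist_eq, not_le] at ht
        rw [hr t ht.le, norm_zero]
        positivity
    set k' : ℝ →ᵇ ℝ := BoundedContinuousFunction.ofNormedAddCommGroup k hk _ hkC
    have hunif : TendstoUniformlyOn (fun n => E (m n)) F atTop
        (((↑) : ℝ → ℂ) '' Metric.closedBall x r) :=
      (tendstoLocallyUniformlyOn_iff_tendstoUniformlyOn_of_compact
        (hcomp.image Complex.continuous_ofReal)).1 hF.tendstoLocallyUniformlyOn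
    have key : ∀ ε > 0, |φ g| ≤ 2 * ε := fun ε hε => by
      have h1 := hlim.eventually_lt_const (by positivity : 0 < ε / max C 1)
      have h2 := Metric.tendstoUniformlyOn_iff.1 hunif (ε / (max C 1 * N)) (by positivity)
      obtain ⟨n, hn1, hn2⟩ := (h1.and h2).exists
      have h3 : |φ (mul k' (f - m n))| ≤ ε := by
        refine (H.abs_mul_le _ k' hkC).trans ?_
        rw [← le_div_iff₀' (by positivity)]
        exact hn1.le
      have h4 : |φ (g - mul k' (f - m n))| ≤ ε := by
        refine H.bound _ _ fun t => ?_
        have h5 : (g - mul k' (f - m n)).1 t = k t * ((m n).1 t - (F t).re) := by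
          change g.1 t - k t * (f.1 t - (m n).1 t) = _
          rw [hg]
          ring
        rw [h5, abs_mul]
        by_cases ht : t ∈ Metric.closedBall x r
        · have h6 := (hn2 t ⟨t, ht, rfl⟩).le
          rw [D.eq_ofReal _ (hm n), hreal t, dist_comm, dist_eq_norm, ← Complex.ofReal_sub,
            Complex.norm_real, Real.norm_eq_abs] at h6
          refine (mul_le_mul (mul_le_mul (hkC t) h6 (abs_nonneg _) (by positivity)) (hvN t ht)
            (H.nonneg t) (by positivity)).trans_eq ?_
          field_simp
        · rw [Metric.mem_closedBall, Real.dist_eq, not_le] at ht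
          rw [hr t ht.le, abs_zero, zero_mul, zero_mul]
          exact hε.le
      have h7 : φ g = φ (mul k' (f - m n)) + φ (g - mul k' (f - m n)) := by
        rw [← map_add, add_sub_cancel]
      rw [h7]
      exact (abs_add_le _ _).trans (by linarith)
    refine abs_nonpos_iff.1 (le_of_forall_pos_le_add fun ε hε => ?_)
    linarith [key (ε / 2) (by positivity)]

end WeightedC0.ExtremeAnnihilator

namespace WeightedC0

variable {v : ℝ → ℝ} {M : Submodule ℝ (WeightedC0 v)} {φ : WeightedC0 v →ₗ[ℝ] ℝ}
  {E : WeightedC0 v → ℂ → ℂ}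

/-- The functional `φ` is purely atomic with locally finitely many atoms, of masses `μ`. -/
structure IsMass (φ : WeightedC0 v →ₗ[ℝ] ℝ) (μ : ℝ → ℝ) : Prop where
  isolated : ∀ x : ℝ, ∃ δ > 0, ∀ s ∈ support φ, s ≠ x → δ ≤ |s - x|
  ne_zero : ∀ s ∈ support φ, μ s ≠ 0
  map_eq : ∀ s ∈ support φ, ∀ g : WeightedC0 v, (∀ t ∈ support φ, t ≠ s → g.1 t = 0) →
    φ g = μ s * g.1 s

namespace ExtremeAnnihilator

theorem not_accPt_support (H : ExtremeAnnihilator v M φ) (D : IsDeBrangesSubspace M E) (x : ℝ) :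
    ¬ AccPt x (𝓟 (support φ)) := by
  intro hacc
  rw [accPt_iff_frequently_nhdsNE] at hacc
  obtain ⟨s₁, hs₁, h1⟩ := (hacc.and_eventually self_mem_nhdsWithin).exists
  have h1' : x ≠ s₁ := fun h => h1 h.symm
  obtain ⟨s₂, hs₂, h2, h12⟩ := (hacc.and_eventually (eventually_mem_nhdsWithin.and
    (nhdsWithin_le_nhds (eventually_ne_nhds h1')))).exists
  have h2 : s₂ ≠ x := h2
  have h1 : s₁ ≠ x := h1
  have p1 := abs_pos.2 (sub_ne_zero.2 h1)
  have p2 := abs_pos.2 (sub_ne_zero.2 h2)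
  have p3 := abs_pos.2 (sub_ne_zero.2 h12)
  obtain ⟨d, hd, d1, d2, d3⟩ : ∃ d > 0, d < |s₁ - x| ∧ d < |s₂ - x| ∧ 2 * d < |s₂ - s₁| := by
    refine ⟨min (min |s₁ - x| |s₂ - x|) |s₂ - s₁| / 3, by positivity, ?_, ?_, ?_⟩ <;>
    linarith [min_le_left (min |s₁ - x| |s₂ - x|) |s₂ - s₁|, min_le_left |s₁ - x| |s₂ - x|,
      min_le_right (min |s₁ - x| |s₂ - x|) |s₂ - s₁|, min_le_right |s₁ - x| |s₂ - x|]
  obtain ⟨g₁, hg₁, hφ₁⟩ := hs₁ d hd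
  obtain ⟨g₂, hg₂, hφ₂⟩ := hs₂ d hd
  obtain ⟨F, hF, -, -, hFS⟩ := H.exists_entire_extension D
    (f := φ g₂ • g₁ - φ g₁ • g₂) (by simp [mul_comm])
  have hf : ∀ t, (φ g₂ • g₁ - φ g₁ • g₂).1 t = φ g₂ * g₁.1 t - φ g₁ * g₂.1 t := fun t => rfl
  have hF0 : F = 0 := by
    refine AnalyticOnNhd.eq_of_frequently_eq (z₀ := (x : ℂ))
      (hF.differentiableOn.analyticOnNhd isOpen_univ |>.mono (Set.subset_univ _))
      (analyticOnNhd_const (v := (0 : ℂ))) ?_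
    have htend : Tendsto (fun t : ℝ => (t : ℂ)) (𝓝[≠] x) (𝓝[≠] (x : ℂ)) :=
      tendsto_nhdsWithin_iff.2 ⟨(Complex.continuous_ofReal.tendsto x).mono_left nhdsWithin_le_nhds,
        eventually_mem_nhdsWithin.mono fun t ht h => ht (Complex.ofReal_injective h)⟩
    refine htend.frequently ((hacc.and_eventually (nhdsWithin_le_nhds
      (((continuous_abs.comp (continuous_const.sub continuous_id)).continuousAt.eventually_const_lt
        (f := fun t => |s₁ - t|) d1).and
      ((continuous_abs.comp (continuous_const.sub continuous_id)).continuousAt.eventually_const_lt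
        (f := fun t => |s₂ - t|) d2)))).mono ?_)
    rintro t ⟨ht, h3, h4⟩
    rw [abs_sub_comm] at h3 h4
    rw [hFS t ht, hf, hg₁ t h3.le, hg₂ t h4.le]
    simp
  refine hφ₁ (H.map_eq_zero_of_eqOn_support g₁ fun t ht => ?_)
  by_cases h : d ≤ |t - s₁|
  · exact hg₁ t h
  · push Not at h
    have h5 : d ≤ |t - s₂| := by
      have := abs_sub_le s₂ t s₁
      rw [abs_sub_comm s₂ t] at this
      linarith
    have := hFS t ht
    rw [hf, hg₂ t h5, hF0, Pi.zero_apply, mul_zero, sub_zero, eq_comm, Complex.ofReal_eq_zero] at this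
    exact (mul_eq_zero.1 this).resolve_left hφ₂

theorem exists_isMass (H : ExtremeAnnihilator v M φ) (D : IsDeBrangesSubspace M E) :
    ∃ μ : ℝ → ℝ, IsMass φ μ := by
  have hiso : ∀ x : ℝ, ∃ δ > 0, ∀ s ∈ support φ, s ≠ x → δ ≤ |s - x| := fun x => by
    have := H.not_accPt_support D x
    rw [accPt_iff_frequently_nhdsNE, not_frequently, eventually_nhdsWithin_iff,
      Metric.eventually_nhds_iff] at this
    obtain ⟨δ, hδ, h⟩ := this
    exact ⟨δ, hδ, fun s hs hsx => not_lt.1 fun hlt => h hlt hsx hs⟩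
  choose δ hδ hδS using hiso
  have he : ∀ s, ∀ t, 2 * (δ s / 2) ≤ |t - s| → bump s (δ s / 2) t = 0 := fun s t ht =>
    bump_eq_zero (by linarith [hδ s]) ht
  set e : ℝ → WeightedC0 v := fun s => ofCompact (bump s (δ s / 2)) (bump s _).continuous (he s)
  have he1 : ∀ s, (e s).1 s = 1 := fun s => bump_eq_one (by linarith [hδ s])
    (by rw [sub_self, abs_zero]; linarith [hδ s])
  have heS : ∀ s, ∀ t ∈ support φ, t ≠ s → (e s).1 t = 0 := fun s t ht hts =>
    he s t (by linarith [hδS s t ht hts])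
  have hmap : ∀ s ∈ support φ, ∀ g : WeightedC0 v, (∀ t ∈ support φ, t ≠ s → g.1 t = 0) →
      φ g = φ (e s) * g.1 s := fun s hs g hg => by
    have := H.map_eq_zero_of_eqOn_support (g - g.1 s • e s) fun t ht => by
      change g.1 t - g.1 s * (e s).1 t = 0
      rcases eq_or_ne t s with rfl | hts
      · rw [he1, mul_one, sub_self]
      · rw [hg t ht hts, heS s t ht hts, mul_zero, sub_self]
    rw [map_sub, map_smul, smul_eq_mul, sub_eq_zero] at this
    rw [this, mul_comm]
  refine ⟨fun s => φ (e s), fun x => ⟨δ x, hδ x, hδS x⟩, fun s hs h0 => ?_, hmap⟩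
  obtain ⟨g, hg, hφg⟩ := hs (δ s) (hδ s)
  refine hφg ?_
  rw [hmap s hs g fun t ht hts => hg t (hδS s t ht hts), h0, zero_mul]

end ExtremeAnnihilator

namespace IsMass

variable {μ : ℝ → ℝ}

theorem map_eq_sum (hμ : IsMass φ μ) (H : ExtremeAnnihilator v M φ) (T : Finset ℝ)
    (hT : ∀ s ∈ T, s ∈ support φ) (g : WeightedC0 v) (hg : ∀ t ∈ support φ, t ∉ T → g.1 t = 0) :
    φ g = ∑ s ∈ T, μ s * g.1 s := by
  choose δ hδ hδS using hμ.isolated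
  set b : ℝ → ℝ →ᵇ ℝ := fun s => bump s (δ s / 2)
  have hb1 : ∀ s, b s s = 1 := fun s => bump_eq_one (by linarith [hδ s])
    (by rw [sub_self, abs_zero]; linarith [hδ s])
  have hb0 : ∀ s, ∀ t ∈ support φ, t ≠ s → b s t = 0 := fun s t ht hts =>
    bump_eq_zero (by linarith [hδ s]) (by linarith [hδS s t ht hts])
  have hb : ∀ s ∈ T, φ (mul (b s) g) = μ s * g.1 s := fun s hs => by
    rw [hμ.map_eq s (hT s hs) (mul (b s) g) fun t ht hts => by
      rw [mul_apply, hb0 s t ht hts, zero_mul], mul_apply, hb1, one_mul]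
  rw [← Finset.sum_congr rfl hb, ← map_sum, ← sub_eq_zero, ← map_sub]
  refine H.map_eq_zero_of_eqOn_support _ fun t ht => ?_
  have h1 : (g - ∑ s ∈ T, mul (b s) g).1 t = g.1 t - ∑ s ∈ T, b s t * g.1 t := by
    change g.1 t - (∑ s ∈ T, mul (b s) g).1 t = _
    rw [Submodule.coe_sum, Finset.sum_apply]
    rfl
  rw [h1]
  by_cases htT : t ∈ T
  · rw [Finset.sum_eq_single_of_mem t htT fun s _ hst => by rw [hb0 s t ht hst.symm, zero_mul],
      hb1, one_mul, sub_self]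
  · rw [hg t ht htT]
    simp

theorem sum_abs_div_add_le (hμ : IsMass φ μ) (H : ExtremeAnnihilator v M φ) (T : Finset ℝ)
    (hT : ∀ s ∈ T, s ∈ support φ) {ε : ℝ} (hε : 0 < ε) :
    ∑ s ∈ T, |μ s| / (v s + ε) ≤ 1 := by
  choose δ hδ hδS using hμ.isolated
  have hr : ∀ s, ∃ r > 0, 4 * r ≤ δ s ∧ ∀ t, |t - s| < 2 * r → v t < v s + ε := fun s => by
    obtain ⟨r, hr, h⟩ := Metric.eventually_nhds_iff.1 (H.usc s (v s + ε) (by linarith))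
    refine ⟨min (r / 2) (δ s / 4), by have := hδ s; positivity, ?_, fun t ht => h ?_⟩
    · linarith [min_le_right (r / 2) (δ s / 4)]
    · rw [Real.dist_eq]
      linarith [min_le_left (r / 2) (δ s / 4)]
  choose r hr0 hrδ hrv using hr
  have he : ∀ s, ∀ t, 2 * r s ≤ |t - s| → bump s (r s) t = 0 := fun s t ht =>
    bump_eq_zero (hr0 s) ht
  set e : ℝ → WeightedC0 v := fun s => ofCompact (bump s (r s)) (bump s _).continuous (he s)
  have he1 : ∀ s, (e s).1 s = 1 := fun s => bump_eq_one (hr0 s)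
    (by rw [sub_self, abs_zero]; exact (hr0 s).le)
  have heS : ∀ s, ∀ t ∈ support φ, t ≠ s → (e s).1 t = 0 := fun s t ht hts =>
    he s t (by linarith [hδS s t ht hts, hrδ s, hr0 s])
  have hv : ∀ s, 0 < v s + ε := fun s => by linarith [H.nonneg s]
  set c : ℝ → ℝ := fun s => SignType.sign (μ s) / (v s + ε) with hc
  have hcabs : ∀ s, |c s| ≤ 1 / (v s + ε) := fun s => by
    rw [hc]
    simp only [abs_div, abs_of_pos (hv s)]
    have : |((SignType.sign (μ s) : SignType) : ℝ)| ≤ 1 := by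
      rcases SignType.trichotomy (SignType.sign (μ s)) with h | h | h <;> simp [h]
    have := hv s
    gcongr
  have hval : ∀ t, (∑ s ∈ T, c s • e s).1 t = ∑ s ∈ T, c s * (e s).1 t := fun t => by
    rw [Submodule.coe_sum, Finset.sum_apply]
    rfl
  have hb := H.bound (∑ s ∈ T, c s • e s) 1 fun t => by
    rw [hval]
    by_cases hex : ∃ s ∈ T, |t - s| < 2 * r s
    · obtain ⟨s, hs, hts⟩ := hex
      rw [Finset.sum_eq_single_of_mem s hs fun s' hs' hne => by
        have : (e s').1 t = 0 := he s' t <| not_lt.1 fun hlt => by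
          have h1 := hδS s s' (hT s' hs') hne
          have h2 := hδS s' s (hT s hs) hne.symm
          have h3 := abs_sub_le s' t s
          rw [abs_sub_comm s' t] at h3
          rw [abs_sub_comm s s'] at h2
          linarith [hrδ s, hrδ s']
        rw [this, mul_zero]]
      have h1 : |c s * (e s).1 t| ≤ 1 / (v s + ε) := by
        rw [abs_mul]
        have h0 : |(e s).1 t| ≤ 1 := by
          change |bump s (r s) t| ≤ 1
          rw [abs_of_nonneg (bump_nonneg _ _ _)]
          exact bump_le_one _ _ _
        exact (mul_le_of_le_one_right (abs_nonneg _) h0).trans (hcabs s)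
      refine (mul_le_mul h1 (hrv s t hts).le (H.nonneg t) (by have := hv s; positivity)).trans_eq ?_
      exact one_div_mul_cancel (hv s).ne'
    · push Not at hex
      rw [Finset.sum_eq_zero fun s hs => by
        have : (e s).1 t = 0 := he s t (hex s hs)
        rw [this, mul_zero]]
      simp
  rw [map_sum] at hb
  refine le_trans (le_of_eq (Finset.sum_congr rfl fun s hs => ?_)) (le_of_abs_le hb)
  rw [map_smul, hμ.map_eq s (hT s hs) (e s) (heS s), he1, mul_one, smul_eq_mul, hc]
  simp only
  rw [div_mul_eq_mul_div, sign_mul_self]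

theorem pos (hμ : IsMass φ μ) (H : ExtremeAnnihilator v M φ) {s : ℝ} (hs : s ∈ support φ) :
    0 < v s := by
  refine (abs_pos.2 (hμ.ne_zero s hs)).trans_le (le_of_forall_pos_le_add fun ε hε => ?_)
  have h1 := hμ.sum_abs_div_add_le H {s} (by simpa using hs) hε
  rw [Finset.sum_singleton] at h1
  exact (div_le_one (by linarith [H.nonneg s])).1 h1

theorem sum_abs_div_le (hμ : IsMass φ μ) (H : ExtremeAnnihilator v M φ) (T : Finset ℝ)
    (hT : ∀ s ∈ T, s ∈ support φ) : ∑ s ∈ T, |μ s| / v s ≤ 1 := by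
  have hlim : Tendsto (fun ε => ∑ s ∈ T, |μ s| / (v s + ε)) (𝓝[>] 0)
      (𝓝 (∑ s ∈ T, |μ s| / (v s + 0))) := by
    refine tendsto_nhdsWithin_of_tendsto_nhds (tendsto_finsetSum _ fun s hs => ?_)
    refine tendsto_const_nhds.div (tendsto_const_nhds.add tendsto_id) ?_
    rw [add_zero]
    exact (hμ.pos H (hT s hs)).ne'
  simp only [add_zero] at hlim
  exact le_of_tendsto hlim (eventually_mem_nhdsWithin.mono fun ε hε =>
    hμ.sum_abs_div_add_le H T hT hε)

theorem sum_subtype_le (hμ : IsMass φ μ) (H : ExtremeAnnihilator v M φ)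
    (T : Finset (support φ)) : ∑ s ∈ T, |μ s| / v s ≤ 1 := by
  have := hμ.sum_abs_div_le H (T.map (Function.Embedding.subtype _)) fun s hs => by
    obtain ⟨a, -, rfl⟩ := Finset.mem_map.1 hs
    exact a.2
  rwa [Finset.sum_map] at this

theorem summable (hμ : IsMass φ μ) (H : ExtremeAnnihilator v M φ) :
    Summable fun s : support φ => |μ s| / v s :=
  summable_of_sum_le (fun s => div_nonneg (abs_nonneg _) (H.nonneg s)) (hμ.sum_subtype_le H)

theorem tsum_le (hμ : IsMass φ μ) (H : ExtremeAnnihilator v M φ) :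
    ∑' s : support φ, |μ s| / v s ≤ 1 :=
  (hμ.summable H).tsum_le_of_sum_le (hμ.sum_subtype_le H)

theorem abs_mul_le (hμ : IsMass φ μ) (H : ExtremeAnnihilator v M φ) {g : WeightedC0 v} {c : ℝ}
    (hc : ∀ t, |g.1 t| * v t ≤ c) (s : support φ) : |μ s * g.1 s| ≤ |μ s| / v s * c := by
  rw [abs_mul, div_mul_eq_mul_div, le_div_iff₀ (hμ.pos H s.2), mul_assoc]
  exact mul_le_mul_of_nonneg_left (hc s) (abs_nonneg _)

theorem summable_mul (hμ : IsMass φ μ) (H : ExtremeAnnihilator v M φ) (g : WeightedC0 v) :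
    Summable fun s : support φ => |μ s * g.1 s| := by
  obtain ⟨c, hc⟩ := bddAbove_range H.nonneg H.usc g
  exact Summable.of_nonneg_of_le (fun _ => abs_nonneg _)
    (hμ.abs_mul_le H fun t => hc ⟨t, rfl⟩) ((hμ.summable H).mul_right c)

theorem finite_inter (hμ : IsMass φ μ) {K : Set ℝ} (hK : IsCompact K) :
    (support φ ∩ K).Finite := by
  by_contra hinf
  obtain ⟨x, -, hx⟩ := Set.Infinite.exists_accPt_of_subset_isCompact hinf hK Set.inter_subset_right
  obtain ⟨δ, hδ, hS⟩ := hμ.isolated x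
  rw [accPt_iff_frequently_nhdsNE] at hx
  obtain ⟨s, hs, h1, h2⟩ := (hx.and_eventually (eventually_mem_nhdsWithin.and
    (nhdsWithin_le_nhds (Metric.ball_mem_nhds x hδ)))).exists
  have := hS s hs.1 h1
  have h2 : dist s x < δ := h2
  rw [Real.dist_eq] at h2
  linarith

/-- The functional `φ` is the sum of its atoms. -/
theorem hasSum (hμ : IsMass φ μ) (H : ExtremeAnnihilator v M φ) (g : WeightedC0 v) :
    HasSum (fun s : support φ => μ s * g.1 s) (φ g) := by
  have hsum : ∀ g : WeightedC0 v, Summable fun s : support φ => μ s * g.1 s := fun g =>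
    (hμ.summable_mul H g).of_abs
  have hle : ∀ (g : WeightedC0 v) (c : ℝ), 0 ≤ c → (∀ t, |g.1 t| * v t ≤ c) →
      |∑' s : support φ, μ s * g.1 s| ≤ c := fun g c hc0 hc => by
    have h1 := norm_tsum_le_tsum_norm (f := fun s : support φ => μ s * g.1 s) (hμ.summable_mul H g)
    refine h1.trans (((hμ.summable_mul H g).tsum_le_tsum (hμ.abs_mul_le H hc)
      ((hμ.summable H).mul_right c)).trans ?_)
    rw [tsum_mul_right]
    exact mul_le_of_le_one_left hc0 (hμ.tsum_le H)
  have key : ∀ ε > 0, |φ g - ∑' s : support φ, μ s * g.1 s| ≤ 2 * ε := fun ε hε => by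
    obtain ⟨R, hR, hRε⟩ := H.exists_bump_bound g hε
    have hfin := hμ.finite_inter (isCompact_closedBall (0 : ℝ) (2 * R))
    set g' := mul (bump 0 R) g with hg'
    have h0 : ∀ t ∈ support φ, t ∉ hfin.toFinset → g'.1 t = 0 := fun t ht htn => by
      rw [Set.Finite.mem_toFinset] at htn
      have : 2 * R < |t - 0| := by
        rw [← Real.dist_eq, ← not_le]
        exact fun h => htn ⟨ht, h⟩
      rw [hg', mul_apply, bump_eq_zero hR this.le, zero_mul]
    have h1 := hμ.map_eq_sum H hfin.toFinset (fun s hs => ((Set.Finite.mem_toFinset _).1 hs).1) g' h0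
    have h2 : φ g' = ∑' s : support φ, μ s * g'.1 s := by
      rw [h1, tsum_subtype (support φ) (fun s => μ s * g'.1 s), tsum_eq_sum (s := hfin.toFinset)]
      · refine Finset.sum_congr rfl fun s hs => ?_
        rw [Set.indicator_of_mem ((Set.Finite.mem_toFinset _).1 hs).1]
      · intro s hs
        by_cases hsS : s ∈ support φ
        · rw [Set.indicator_of_mem hsS, h0 s hsS hs, mul_zero]
        · exact Set.indicator_of_notMem hsS _
    have h3 : φ g - ∑' s : support φ, μ s * g.1 s =
        φ (g - g') - ∑' s : support φ, μ s * (g - g').1 s := by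
      have h4 : ∀ s : support φ, μ s * (g - g').1 s = μ s * g.1 s - μ s * g'.1 s := fun s =>
        mul_sub _ _ _
      rw [tsum_congr h4, (hsum g).tsum_sub (hsum g'), ← h2, map_sub]
      ring
    rw [h3]
    refine (abs_sub _ _).trans ?_
    linarith [H.bound (g - g') ε hRε, hle (g - g') ε hε.le hRε]
  have h0 : φ g - ∑' s : support φ, μ s * g.1 s = 0 :=
    abs_nonpos_iff.1 (le_of_forall_pos_le_add fun ε hε => by linarith [key (ε / 2) (by positivity)])
  rw [sub_eq_zero.1 h0]
  exact (hsum g).hasSum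

theorem hasSum_cauchyTransform (hμ : IsMass φ μ) (H : ExtremeAnnihilator v M φ) (g : WeightedC0 v)
    {w : ℂ} (hw : w.im ≠ 0) :
    HasSum (fun s : support φ => ((μ s * g.1 s : ℝ) : ℂ) * ((s : ℂ) - w)⁻¹)
      (cauchyTransform φ g w) := by
  have h1 := hμ.hasSum H (mul (rePart (cauchyKernel w)) g)
  have h2 := hμ.hasSum H (mul (imPart (cauchyKernel w)) g)
  rw [Complex.hasSum_iff]
  constructor
  · refine h1.congr_fun fun s => ?_
    rw [Complex.re_ofReal_mul, mul_apply, rePart_apply, cauchyKernel_apply hw]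
    ring
  · refine h2.congr_fun fun s => ?_
    rw [Complex.im_ofReal_mul, mul_apply, imPart_apply, cauchyKernel_apply hw]
    ring

end IsMass

end WeightedC0

/-- A function is a quotient of bounded holomorphic functions on `S`, with zero-free denominator. -/
def IsBddType (S : Set ℂ) (f : ℂ → ℂ) : Prop :=
  ∃ g₁ g₂ : ℂ → ℂ, DifferentiableOn ℂ g₁ S ∧ DifferentiableOn ℂ g₂ S ∧
    (∃ C : ℝ, ∀ z ∈ S, ‖g₁ z‖ ≤ C) ∧ (∃ C : ℝ, ∀ z ∈ S, ‖g₂ z‖ ≤ C) ∧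
    (∀ z ∈ S, g₂ z ≠ 0) ∧ ∀ z ∈ S, f z * g₂ z = g₁ z

namespace IsBddType

variable {S : Set ℂ} {f g : ℂ → ℂ}

theorem const_mul (hf : IsBddType S f) (c : ℂ) : IsBddType S fun z => c * f z := by
  obtain ⟨g₁, g₂, h1, h2, ⟨C, hC⟩, h4, h5, h6⟩ := hf
  refine ⟨fun z => c * g₁ z, g₂, h1.const_mul c, h2, ⟨‖c‖ * C, fun z hz => ?_⟩, h4, h5,
    fun z hz => by rw [mul_assoc, h6 z hz]⟩
  rw [norm_mul]
  gcongr
  exact hC z hz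

theorem add (hf : IsBddType S f) (hg : IsBddType S g) : IsBddType S fun z => f z + g z := by
  obtain ⟨f₁, f₂, h1, h2, ⟨C₁, hC₁⟩, ⟨C₂, hC₂⟩, h5, h6⟩ := hf
  obtain ⟨g₁, g₂, k1, k2, ⟨D₁, hD₁⟩, ⟨D₂, hD₂⟩, k5, k6⟩ := hg
  refine ⟨fun z => f₁ z * g₂ z + g₁ z * f₂ z, fun z => f₂ z * g₂ z, (h1.mul k2).add (k1.mul h2),
    h2.mul k2, ⟨C₁ * D₂ + D₁ * C₂, fun z hz => ?_⟩, ⟨C₂ * D₂, fun z hz => ?_⟩,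
    fun z hz => mul_ne_zero (h5 z hz) (k5 z hz), fun z hz => ?_⟩
  · refine (norm_add_le _ _).trans ?_
    rw [norm_mul, norm_mul]
    exact add_le_add
      (mul_le_mul (hC₁ z hz) (hD₂ z hz) (norm_nonneg _) ((norm_nonneg _).trans (hC₁ z hz)))
      (mul_le_mul (hD₁ z hz) (hC₂ z hz) (norm_nonneg _) ((norm_nonneg _).trans (hD₁ z hz)))
  · rw [norm_mul]
    exact mul_le_mul (hC₂ z hz) (hD₂ z hz) (norm_nonneg _) ((norm_nonneg _).trans (hC₂ z hz))
  · simp only [← h6 z hz, ← k6 z hz]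
    ring

theorem congr (hf : IsBddType S f) (h : ∀ z ∈ S, f z = g z) : IsBddType S g := by
  obtain ⟨g₁, g₂, h1, h2, h3, h4, h5, h6⟩ := hf
  exact ⟨g₁, g₂, h1, h2, h3, h4, h5, fun z hz => by rw [← h z hz, h6 z hz]⟩

theorem of_im_nonneg (hf : DifferentiableOn ℂ f S) (h : ∀ z ∈ S, 0 ≤ (f z).im) :
    IsBddType S f := by
  have h1 : ∀ z ∈ S, 1 ≤ ‖f z + Complex.I‖ := fun z hz => by
    refine le_trans ?_ (Complex.im_le_norm _)
    rw [Complex.add_im, Complex.I_im]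
    linarith [h z hz]
  have h0 : ∀ z ∈ S, f z + Complex.I ≠ 0 := fun z hz => norm_pos_iff.1
    (zero_lt_one.trans_le (h1 z hz))
  have hinv : ∀ z ∈ S, ‖(f z + Complex.I)⁻¹‖ ≤ 1 := fun z hz => by
    rw [norm_inv]
    exact inv_le_one_of_one_le₀ (h1 z hz)
  refine ⟨fun z => 1 - Complex.I * (f z + Complex.I)⁻¹, fun z => (f z + Complex.I)⁻¹,
    (((hf.add_const _).inv h0).const_mul _).const_sub _, (hf.add_const _).inv h0,
    ⟨2, fun z hz => ?_⟩, ⟨1, hinv⟩, fun z hz => inv_ne_zero (h0 z hz), fun z hz => ?_⟩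
  · refine (norm_sub_le _ _).trans ?_
    rw [norm_mul, Complex.norm_I, norm_one]
    linarith [hinv z hz]
  · have := h0 z hz
    field_simp
    ring

/-- Cauchy transforms of positive summable masses on the real line are of bounded type. -/
theorem tsum_of_nonneg {ι : Type*} {a x : ι → ℝ} (ha : ∀ i, 0 ≤ a i) (hs : Summable a) :
    IsBddType UpperHalf (fun w => ∑' i, (a i : ℂ) * ((x i : ℂ) - w)⁻¹) ∧
      IsBddType LowerHalf (fun w => ∑' i, (a i : ℂ) * ((x i : ℂ) - w)⁻¹) := by
  set P : ℂ → ℂ := fun w => ∑' i, (a i : ℂ) * ((x i : ℂ) - w)⁻¹ with hP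
  have hle : ∀ (i : ι) (w : ℂ) (r : ℝ), 0 < r → r ≤ |w.im| →
      ‖(a i : ℂ) * ((x i : ℂ) - w)⁻¹‖ ≤ a i * r⁻¹ := fun i w r hr hw => by
    rw [norm_mul, Complex.norm_real, Real.norm_of_nonneg (ha i), norm_inv]
    have := Complex.abs_im_le_norm ((x i : ℂ) - w)
    simp only [Complex.sub_im, Complex.ofReal_im, zero_sub, abs_neg] at this
    have h2 := ha i
    gcongr
    exact hw.trans this
  have hdiff : ∀ w : ℂ, w.im ≠ 0 → DifferentiableAt ℂ P w := fun w hw => by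
    have h0 := abs_pos.2 hw
    have hU : IsOpen {z : ℂ | |w.im| / 2 < |z.im|} := isOpen_lt (by fun_prop) (by fun_prop)
    refine (Complex.differentiableOn_tsum_of_summable_norm (hs.mul_right (|w.im| / 2)⁻¹)
      (fun i z hz => ?_) hU fun i z hz => hle i z _ (by positivity) (le_of_lt hz)).differentiableAt
      (hU.mem_nhds (half_lt_self h0))
    have hz' : |w.im| / 2 < |z.im| := hz
    have hz0 : z.im ≠ 0 := abs_pos.1 (by linarith)
    have := WeightedC0.ofReal_sub_ne_zero hz0 (x i)
    have : DifferentiableAt ℂ (fun w => (a i : ℂ) * ((x i : ℂ) - w)⁻¹) z := by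
      fun_prop (disch := assumption)
    exact this.differentiableWithinAt
  have him : ∀ w : ℂ, w.im ≠ 0 → (P w).im = ∑' i, a i * (w.im / Complex.normSq ((x i : ℂ) - w)) :=
    fun w hw => by
      have hsum : Summable fun i => (a i : ℂ) * ((x i : ℂ) - w)⁻¹ :=
        Summable.of_norm_bounded (hs.mul_right _)
          fun i => hle i w _ (abs_pos.2 hw) le_rfl
      rw [hP]
      simp only
      rw [Complex.im_tsum hsum]
      refine tsum_congr fun i => ?_
      rw [Complex.im_ofReal_mul, Complex.inv_im]
      simp
  constructor
  · refine of_im_nonneg (fun w hw => (hdiff w (ne_of_gt hw)).differentiableWithinAt) fun w hw => ?_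
    have hw' : 0 < w.im := hw
    rw [him w hw'.ne']
    exact tsum_nonneg fun i => mul_nonneg (ha i) (div_nonneg hw'.le (Complex.normSq_nonneg _))
  · have h1 : IsBddType LowerHalf fun w => -1 * P w := by
      refine of_im_nonneg
        (fun w hw => ((hdiff w (ne_of_lt hw)).const_mul _).differentiableWithinAt) fun w hw => ?_
      have hw' : w.im < 0 := hw
      rw [neg_one_mul, Complex.neg_im, him w hw'.ne, Left.nonneg_neg_iff]
      exact tsum_nonpos fun i => mul_nonpos_of_nonneg_of_nonpos (ha i)
        (div_nonpos_of_nonpos_of_nonneg hw'.le (Complex.normSq_nonneg _))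
    exact (h1.const_mul (-1)).congr fun z _ => by ring

/-- Cauchy transforms of summable real masses on the real line are of bounded type. -/
theorem of_hasSum {ι : Type*} {a x : ι → ℝ} (hs : Summable fun i => |a i|) {f : ℂ → ℂ}
    (hf : ∀ w : ℂ, w.im ≠ 0 → HasSum (fun i => (a i : ℂ) * ((x i : ℂ) - w)⁻¹) (f w)) :
    IsBddType UpperHalf f ∧ IsBddType LowerHalf f := by
  have hp : Summable fun i => max (a i) 0 := Summable.of_nonneg_of_le (fun i => le_max_right _ _)
    (fun i => max_le (le_abs_self _) (abs_nonneg _)) hs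
  have hn : Summable fun i => max (-a i) 0 := Summable.of_nonneg_of_le (fun i => le_max_right _ _)
    (fun i => max_le (neg_le_abs _) (abs_nonneg _)) hs
  have h1 := tsum_of_nonneg (x := x) (fun i => le_max_right (a i) 0) hp
  have h2 := tsum_of_nonneg (x := x) (fun i => le_max_right (-a i) 0) hn
  have hsum : ∀ (b : ι → ℝ), (∀ i, |b i| ≤ |a i|) → ∀ w : ℂ, w.im ≠ 0 →
      Summable fun i => (b i : ℂ) * ((x i : ℂ) - w)⁻¹ := fun b hb w hw => by
    refine Summable.of_norm_bounded (hf w hw).summable.norm fun i => ?_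
    rw [norm_mul, norm_mul, Complex.norm_real, Complex.norm_real]
    exact mul_le_mul_of_nonneg_right (hb i) (norm_nonneg _)
  have heq : ∀ w : ℂ, w.im ≠ 0 → ∑' i, ((max (a i) 0 : ℝ) : ℂ) * ((x i : ℂ) - w)⁻¹ +
      -1 * ∑' i, ((max (-a i) 0 : ℝ) : ℂ) * ((x i : ℂ) - w)⁻¹ = f w := fun w hw => by
    rw [← (hf w hw).tsum_eq, neg_one_mul, ← sub_eq_add_neg, ← Summable.tsum_sub]
    · refine tsum_congr fun i => ?_
      rw [← sub_mul, ← Complex.ofReal_sub]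
      congr 2
      rcases le_total 0 (a i) with h | h
      · rw [max_eq_left h, max_eq_right (by linarith), sub_zero]
      · rw [max_eq_right h, max_eq_left (by linarith), zero_sub, neg_neg]
    · refine hsum _ (fun i => ?_) w hw
      rw [abs_of_nonneg (le_max_right _ _)]
      exact max_le (le_abs_self _) (abs_nonneg _)
    · refine hsum _ (fun i => ?_) w hw
      rw [abs_of_nonneg (le_max_right _ _)]
      exact max_le (neg_le_abs _) (abs_nonneg _)
  exact ⟨(h1.1.add (h2.1.const_mul (-1))).congr fun w hw => heq w (ne_of_gt hw),
    (h1.2.add (h2.2.const_mul (-1))).congr fun w hw => heq w (ne_of_lt hw)⟩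

theorem bddTypeQuot (hf : IsBddType S f) (hS : S.Nonempty) {F G : ℂ → ℂ}
    (h : ∀ z ∈ S, F z = G z * f z) : BddTypeQuot S F G := by
  obtain ⟨g₁, g₂, h1, h2, h3, h4, h5, h6⟩ := hf
  obtain ⟨z, hz⟩ := hS
  exact ⟨g₁, g₂, h1, h2, h3, h4, fun h0 => h5 z hz (h0 z hz),
    fun w hw => by rw [h w hw, mul_assoc, h6 w hw]⟩

end IsBddType

namespace WeightedC0

namespace IsMass

variable {v : ℝ → ℝ} {M : Submodule ℝ (WeightedC0 v)} {φ : WeightedC0 v →ₗ[ℝ] ℝ}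
  {E : WeightedC0 v → ℂ → ℂ} {μ : ℝ → ℝ}

theorem exists_single (hμ : IsMass φ μ) (s c : ℝ) :
    ∃ e : WeightedC0 v, e.1 s = c ∧ ∀ t ∈ support φ, t ≠ s → e.1 t = 0 := by
  obtain ⟨δ, hδ, h⟩ := hμ.isolated s
  have he : ∀ t, δ ≤ |t - s| → c * bump s (δ / 2) t = 0 := fun t ht => by
    rw [bump_eq_zero (by linarith) (by linarith), mul_zero]
  refine ⟨ofCompact (fun t => c * bump s (δ / 2) t) (by fun_prop) he, ?_, fun t ht hts =>
    he t (h t ht hts)⟩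
  change c * bump s (δ / 2) s = c
  rw [bump_eq_one (by linarith) (by rw [sub_self, abs_zero]; linarith), mul_one]

theorem cauchyTransform_single (hμ : IsMass φ μ) (H : ExtremeAnnihilator v M φ) {s : ℝ}
    (hs : s ∈ support φ) {e : WeightedC0 v} (he : ∀ t ∈ support φ, t ≠ s → e.1 t = 0) {w : ℂ}
    (hw : w.im ≠ 0) : cauchyTransform φ e w = (μ s * e.1 s : ℝ) * ((s : ℂ) - w)⁻¹ := by
  refine (hμ.hasSum_cauchyTransform H e hw).unique
    (hasSum_single (f := fun s : support φ => ((μ s * e.1 s : ℝ) : ℂ) * ((s : ℂ) - w)⁻¹)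
      ⟨s, hs⟩ fun t hts => ?_)
  rw [he t t.2 fun h => hts (Subtype.ext h), mul_zero, Complex.ofReal_zero, zero_mul]

/-- Near a point without mass, the Cauchy transform is bounded on vertical lines. -/
theorem exists_norm_cauchyTransform_le (hμ : IsMass φ μ) (H : ExtremeAnnihilator v M φ) {x : ℝ}
    {g : WeightedC0 v} (hg : x ∈ support φ → g.1 x = 0) :
    ∃ K, ∀ y : ℝ, y ≠ 0 → ‖cauchyTransform φ g (x + y * Complex.I)‖ ≤ K := by
  obtain ⟨δ, hδ, h⟩ := hμ.isolated x
  refine ⟨(∑' s : support φ, |μ s * g.1 s|) * δ⁻¹, fun y hy => ?_⟩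
  have hw : ((x : ℂ) + y * Complex.I).im ≠ 0 := by simpa using hy
  rw [← (hμ.hasSum_cauchyTransform H g hw).tsum_eq]
  refine tsum_of_norm_bounded ((hμ.summable_mul H g).hasSum.mul_right δ⁻¹) fun s => ?_
  rw [norm_mul, Complex.norm_real, Real.norm_eq_abs]
  rcases eq_or_ne (s : ℝ) x with hsx | hsx
  · rw [hsx, hg (hsx ▸ s.2), mul_zero, abs_zero, zero_mul, zero_mul]
  · refine mul_le_mul_of_nonneg_left ?_ (abs_nonneg _)
    rw [norm_inv]
    refine inv_anti₀ hδ ((h s s.2 hsx).trans ?_)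
    have := Complex.abs_re_le_norm ((s : ℂ) - (x + y * Complex.I))
    simpa using this

theorem tendsto_vertical (x : ℝ) :
    Tendsto (fun y : ℝ => (x : ℂ) + y * Complex.I) (𝓝[>] 0) (𝓝[≠] (x : ℂ)) := by
  refine tendsto_nhdsWithin_iff.2 ⟨?_, ?_⟩
  · have : Continuous fun y : ℝ => (x : ℂ) + y * Complex.I := by fun_prop
    simpa using (this.tendsto 0).mono_left nhdsWithin_le_nhds
  · filter_upwards [self_mem_nhdsWithin] with y hy h0
    have hy : 0 < y := hy
    have := congrArg Complex.im (Set.mem_singleton_iff.1 h0)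
    simp at this
    exact hy.ne' this

/-- The entire function vanishing exactly on the support of an extreme annihilator. -/
theorem exists_entire (hμ : IsMass φ μ) (H : ExtremeAnnihilator v M φ)
    (D : IsDeBrangesSubspace M E) :
    ∃ B : ℂ → ℂ, Differentiable ℂ B ∧ (∀ z, B (conj z) = conj (B z)) ∧
      (∀ m ∈ M, ∀ w : ℂ, w.im ≠ 0 → E m w = B w * cauchyTransform φ m w) ∧
      (∀ z, B z = 0 → z.im = 0) ∧ (∀ x : ℝ, B x = 0 ↔ x ∈ support φ) ∧
      ∀ x ∈ support φ, deriv B x = -(μ x : ℂ)⁻¹ := by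
  obtain ⟨s₁, hs₁⟩ := H.support_nonempty
  obtain ⟨s₂, hs₂, h12⟩ := Set.not_subset.1 (H.not_support_subset_singleton D s₁)
  have h12 : s₂ ≠ s₁ := h12
  have h12' : (s₂ : ℂ) - s₁ ≠ 0 := sub_ne_zero.2 fun h => h12 (Complex.ofReal_injective h)
  obtain ⟨e₁, he₁, he₁'⟩ := hμ.exists_single s₁ (μ s₁)⁻¹
  obtain ⟨e₂, he₂, he₂'⟩ := hμ.exists_single s₂ (μ s₂)⁻¹
  have hμ₁ := hμ.ne_zero s₁ hs₁
  have hμ₂ := hμ.ne_zero s₂ hs₂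
  have hφ : φ (e₁ - e₂) = 0 := by
    rw [map_sub, hμ.map_eq s₁ hs₁ e₁ he₁', hμ.map_eq s₂ hs₂ e₂ he₂', he₁, he₂,
      mul_inv_cancel₀ hμ₁, mul_inv_cancel₀ hμ₂, sub_self]
  obtain ⟨F, hFd, hFc, hFC, -⟩ := H.exists_entire_extension D hφ
  set B : ℂ → ℂ := fun w => F w * ((s₁ - w) * (s₂ - w) * ((s₂ : ℂ) - s₁)⁻¹) with hB
  have hBd : Differentiable ℂ B := by fun_prop
  have hBC : ∀ m ∈ M, ∀ w : ℂ, w.im ≠ 0 → E m w = B w * cauchyTransform φ m w := by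
    intro m hm w hw
    have h1 := hFC m hm w hw
    rw [cauchyTransform_sub, hμ.cauchyTransform_single H hs₁ he₁' hw,
      hμ.cauchyTransform_single H hs₂ he₂' hw, he₁, he₂, mul_inv_cancel₀ hμ₁,
      mul_inv_cancel₀ hμ₂, Complex.ofReal_one, one_mul, one_mul] at h1
    have k1 := ofReal_sub_ne_zero hw s₁
    have k2 := ofReal_sub_ne_zero hw s₂
    have h2 : B w * cauchyTransform φ m w =
        (F w * cauchyTransform φ m w) * ((s₁ - w) * (s₂ - w) * ((s₂ : ℂ) - s₁)⁻¹) := by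
      rw [hB]
      ring
    rw [h2, h1]
    field_simp
    ring
  have hB0 : ∀ x : ℝ, x ∉ support φ → B x ≠ 0 := by
    intro x hx h0
    obtain ⟨m, hm, hmx⟩ := D.exists_ne_zero x
    obtain ⟨K, hK⟩ := hμ.exists_norm_cauchyTransform_le H (x := x) (g := m) fun h => absurd h hx
    have t1 := ((D.differentiable m hm x).continuousAt.norm.tendsto.mono_left
      nhdsWithin_le_nhds).comp (tendsto_vertical x)
    have t2 := (((hBd x).continuousAt.norm.tendsto.mono_left
      nhdsWithin_le_nhds).comp (tendsto_vertical x)).mul_const K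
    rw [h0, norm_zero, zero_mul] at t2
    refine hmx (norm_le_zero_iff.1 (le_of_tendsto_of_tendsto t1 t2 ?_))
    filter_upwards [self_mem_nhdsWithin] with y hy
    have hy : 0 < y := hy
    simp only [Function.comp_apply]
    rw [hBC m hm _ (by simpa using hy.ne'), norm_mul]
    exact mul_le_mul_of_nonneg_left (hK y hy.ne') (norm_nonneg _)
  have hB1 : ∀ x ∈ support φ, B x = 0 ∧ deriv B x = -(μ x : ℂ)⁻¹ := by
    intro x hx
    obtain ⟨m, hm, hmx⟩ := D.exists_ne_zero x
    obtain ⟨e, he, he'⟩ := hμ.exists_single x (m.1 x)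
    obtain ⟨K, hK⟩ := hμ.exists_norm_cauchyTransform_le H (x := x) (g := m - e) fun _ => by
      change m.1 x - e.1 x = 0
      rw [he, sub_self]
    have hmx' : (m.1 x : ℂ) ≠ 0 := by rwa [← D.eq_ofReal m hm]
    have hμx : (μ x : ℂ) ≠ 0 := Complex.ofReal_ne_zero.2 (hμ.ne_zero x hx)
    have tv := tendsto_vertical x
    have tv0 : Tendsto (fun y : ℝ => (x : ℂ) - (x + y * Complex.I)) (𝓝[>] 0) (𝓝 0) := by
      simpa using (tv.mono_right nhdsWithin_le_nhds).const_sub (x : ℂ)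
    have tE := ((D.differentiable m hm x).continuousAt.tendsto.mono_left
      nhdsWithin_le_nhds).comp tv
    have tB := ((hBd x).continuousAt.tendsto.mono_left nhdsWithin_le_nhds).comp tv
    have tC : Tendsto (fun y : ℝ => ((x : ℂ) - (x + y * Complex.I)) *
        cauchyTransform φ (m - e) (x + y * Complex.I)) (𝓝[>] 0) (𝓝 0) := by
      refine squeeze_zero_norm' (a := fun y : ℝ => ‖(x : ℂ) - (x + y * Complex.I)‖ * K) ?_
        (by simpa using tv0.norm.mul_const K)
      filter_upwards [self_mem_nhdsWithin] with y hy
      have hy : 0 < y := hy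
      rw [norm_mul]
      exact mul_le_mul_of_nonneg_left (hK y hy.ne') (norm_nonneg _)
    have key : ∀ y : ℝ, 0 < y → ((x : ℂ) - (x + y * Complex.I)) * E m (x + y * Complex.I) =
        B (x + y * Complex.I) * (((μ x * m.1 x : ℝ) : ℂ) + ((x : ℂ) - (x + y * Complex.I)) *
          cauchyTransform φ (m - e) (x + y * Complex.I)) := by
      intro y hy
      have hw : ((x : ℂ) + y * Complex.I).im ≠ 0 := by simpa using hy.ne'
      have k1 := ofReal_sub_ne_zero hw x
      rw [hBC m hm _ hw, cauchyTransform_sub, hμ.cauchyTransform_single H hx he' hw, he, mul_sub,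
        mul_left_comm _ _ (_⁻¹), mul_inv_cancel₀ k1, mul_one]
      ring
    have tR := (tendsto_const_nhds (x := ((μ x * m.1 x : ℝ) : ℂ))).add tC
    rw [add_zero] at tR
    have hx0 : B x = 0 := by
      have h1 := tendsto_nhds_unique ((tv0.mul tE).congr' ?_) (tB.mul tR)
      · rw [zero_mul, Complex.ofReal_mul] at h1
        exact (mul_eq_zero.1 h1.symm).resolve_right (mul_ne_zero hμx hmx')
      · filter_upwards [self_mem_nhdsWithin] with y hy
        exact key y hy
    refine ⟨hx0, ?_⟩
    have tS := ((hBd x).hasDerivAt.tendsto_slope).comp tv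
    have h2 := tendsto_nhds_unique (tE.congr' ?_) ((tS.mul tR).neg)
    · rw [D.eq_ofReal m hm, Complex.ofReal_mul] at h2
      have h3 : (1 + deriv B x * μ x) * (m.1 x : ℂ) = 0 := by
        linear_combination h2
      have h4 := (mul_eq_zero.1 h3).resolve_right hmx'
      rw [← inv_neg]
      exact eq_inv_of_mul_eq_one_left (by linear_combination -h4)
    · filter_upwards [self_mem_nhdsWithin] with y hy
      have hw : ((x : ℂ) + y * Complex.I).im ≠ 0 := by simpa using (show (0 : ℝ) < y from hy).ne'
      have k1 := ofReal_sub_ne_zero hw x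
      have k2 : (x : ℂ) + y * Complex.I - x ≠ 0 := by rwa [← neg_ne_zero, neg_sub]
      have := key y hy
      simp only [Function.comp_apply, slope_def_field, hx0, sub_zero]
      refine mul_left_cancel₀ k1 (this.trans ?_)
      rw [← neg_sub (x : ℂ) (x + y * Complex.I), div_neg, neg_mul, neg_neg, ← mul_assoc,
        mul_div_cancel₀ _ k1]
  refine ⟨B, hBd, fun z => ?_, hBC, fun z hz => ?_, fun x => ⟨fun h => ?_, fun h => (hB1 x h).1⟩,
    fun x hx => (hB1 x hx).2⟩
  · simp only [hB, hFc, map_mul, map_sub, map_inv₀, Complex.conj_ofReal]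
  · by_contra hw
    obtain ⟨m, hm, hmz⟩ := D.exists_ne_zero z
    exact hmz (by rw [hBC m hm z hw, hz, zero_mul])
  · by_contra hx
    exact hB0 x hx h

end IsMass

end WeightedC0

/-- The reciprocal of an extended weight, as a real function. -/
noncomputable def recipWeight (W : ℝ → ℝ≥0∞) (t : ℝ) : ℝ := (W t)⁻¹.toReal

section recipWeight

variable {W : ℝ → ℝ≥0∞}

theorem recipWeight_nonneg (W : ℝ → ℝ≥0∞) (t : ℝ) : 0 ≤ recipWeight W t := ENNReal.toReal_nonneg

theorem nnnorm_div_weight (hW : ∀ x, 0 < W x) (z : ℂ) (t : ℝ) :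
    (‖z‖₊ : ℝ≥0∞) / W t = ENNReal.ofReal (‖z‖ * recipWeight W t) := by
  rw [ENNReal.ofReal_mul (norm_nonneg z), recipWeight,
    ENNReal.ofReal_toReal (ENNReal.inv_ne_top.2 (hW t).ne'), div_eq_mul_inv, ofReal_norm]
  rfl

theorem upperSemicontinuous_recipWeight (hW : IsWeight W) :
    UpperSemicontinuous (recipWeight W) := by
  intro x y hy
  have hy0 : 0 < y := (recipWeight_nonneg W x).trans_lt hy
  have key : ∀ t, recipWeight W t < y ↔ (ENNReal.ofReal y)⁻¹ < W t := fun t => by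
    rw [ENNReal.inv_lt_iff_inv_lt, recipWeight,
      ENNReal.lt_ofReal_iff_toReal_lt (ENNReal.inv_ne_top.2 (hW.2.1 t).ne')]
  filter_upwards [hW.1 x _ ((key x).1 hy)] with t ht
  exact (key t).2 ht

theorem MemC0e.tendsto_norm_mul (hW : ∀ x, 0 < W x) {f : ℝ → ℂ} (hf : MemC0e W f) :
    Tendsto (fun t => ‖f t‖ * recipWeight W t) (cocompact ℝ) (𝓝 0) := by
  have h := (ENNReal.tendsto_toReal ENNReal.zero_ne_top).comp hf.2
  refine h.congr fun t => ?_
  simp only [Function.comp_apply]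
  rw [nnnorm_div_weight hW, ENNReal.toReal_ofReal
    (mul_nonneg (norm_nonneg _) (recipWeight_nonneg W t))]

theorem MemC0e.comp_mem (hW : ∀ x, 0 < W x) {f : ℝ → ℂ} (hf : MemC0e W f) {p : ℂ → ℝ}
    (hp : Continuous p) (hp' : ∀ z, |p z| ≤ ‖z‖) :
    (fun t => p (f t)) ∈ WeightedC0 (recipWeight W) := by
  refine ⟨hp.comp hf.1, squeeze_zero_norm (fun t => ?_) (hf.tendsto_norm_mul hW)⟩
  rw [norm_mul, Real.norm_eq_abs, Real.norm_eq_abs, abs_of_nonneg (recipWeight_nonneg W t)]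
  exact mul_le_mul_of_nonneg_right (hp' _) (recipWeight_nonneg W t)

end recipWeight

section realPart

variable {W : ℝ → ℝ≥0∞} {L : Submodule ℂ (ℂ → ℂ)}

/-- The restrictions to the real line of the real entire functions in `L`. -/
def realRestrictions (L : Submodule ℂ (ℂ → ℂ)) (v : ℝ → ℝ) : Submodule ℝ (WeightedC0 v) where
  carrier := {g | ∃ F ∈ L, ∀ t : ℝ, F t = g.1 t}
  add_mem' := by
    rintro f g ⟨F, hF, hF'⟩ ⟨G, hG, hG'⟩
    exact ⟨F + G, L.add_mem hF hG, fun t => by simp [hF', hG']⟩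
  zero_mem' := ⟨0, L.zero_mem, fun t => by simp⟩
  smul_mem' := by
    rintro c f ⟨F, hF, hF'⟩
    exact ⟨(c : ℂ) • F, L.smul_mem _ hF, fun t => by simp [hF']⟩

open scoped Classical in
/-- The extension in `L` of a function on the real line (zero if there is none). -/
noncomputable def entireExtension (L : Submodule ℂ (ℂ → ℂ)) {v : ℝ → ℝ} (g : WeightedC0 v) :
    ℂ → ℂ :=
  if h : ∃ F ∈ L, ∀ t : ℝ, F t = g.1 t then h.choose else 0

theorem entireExtension_mem {v : ℝ → ℝ} {g : WeightedC0 v} (hg : g ∈ realRestrictions L v) :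
    entireExtension L g ∈ L := by
  have hg : ∃ F ∈ L, ∀ t : ℝ, F t = g.1 t := hg
  rw [entireExtension, dif_pos hg]
  exact hg.choose_spec.1

theorem entireExtension_ofReal {v : ℝ → ℝ} {g : WeightedC0 v} (hg : g ∈ realRestrictions L v)
    (t : ℝ) : entireExtension L g t = g.1 t := by
  have hg : ∃ F ∈ L, ∀ t : ℝ, F t = g.1 t := hg
  rw [entireExtension, dif_pos hg]
  exact hg.choose_spec.2 t

theorem IsAlgebraicDeBranges.exists_re_im (hL : IsAlgebraicDeBranges L) (hW : ∀ x, 0 < W x)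
    (hsub : SubsetC0e W L) {F : ℂ → ℂ} (hF : F ∈ L) :
    ∃ a ∈ realRestrictions L (recipWeight W), ∃ b ∈ realRestrictions L (recipWeight W),
      (∀ t : ℝ, a.1 t = (F t).re) ∧ ∀ t : ℝ, b.1 t = (F t).im := by
  have hF' := hL.2.2 F hF
  refine ⟨⟨_, (hsub F hF).comp_mem hW Complex.continuous_re Complex.abs_re_le_norm⟩,
    ⟨(1 / 2 : ℂ) • (F + fun z => conj (F (conj z))), L.smul_mem _ (L.add_mem hF hF'), fun t => ?_⟩,
    ⟨_, (hsub F hF).comp_mem hW Complex.continuous_im Complex.abs_im_le_norm⟩,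
    ⟨(1 / (2 * Complex.I) : ℂ) • (F - fun z => conj (F (conj z))),
      L.smul_mem _ (L.sub_mem hF hF'), fun t => ?_⟩, fun t => rfl, fun t => rfl⟩
  · simp [Complex.re_eq_add_conj]
    ring
  · change 1 / (2 * Complex.I) * (F t - conj (F (conj (t : ℂ)))) = ((F t).im : ℂ)
    rw [Complex.conj_ofReal, Complex.im_eq_sub_conj]
    ring

theorem IsAlgebraicDeBranges.exists_eq_add (hL : IsAlgebraicDeBranges L) (hW : ∀ x, 0 < W x)
    (hsub : SubsetC0e W L) {F : ℂ → ℂ} (hF : F ∈ L) :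
    ∃ a ∈ realRestrictions L (recipWeight W), ∃ b ∈ realRestrictions L (recipWeight W),
      ∀ z, F z = entireExtension L a z + Complex.I * entireExtension L b z := by
  obtain ⟨a, ha, b, hb, ha', hb'⟩ := hL.exists_re_im hW hsub hF
  refine ⟨a, ha, b, hb, congrFun (WeightedC0.eq_of_eq_on_real (hL.1 F hF)
    ((hL.1 _ (entireExtension_mem ha)).add
      ((hL.1 _ (entireExtension_mem hb)).const_mul Complex.I)) fun t => ?_)⟩
  rw [entireExtension_ofReal ha, entireExtension_ofReal hb, ha', hb', mul_comm,
    Complex.re_add_im]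

theorem IsAlgebraicDeBranges.exists_ne_zero (hL : IsAlgebraicDeBranges L) {F : ℂ → ℂ}
    (hF : F ∈ L) (h0 : F ≠ 0) (w : ℂ) : ∃ G ∈ L, G w ≠ 0 := by
  have key : ∀ n : ℕ, ∀ F ∈ L, ∀ g : ℂ → ℂ, ContinuousAt g w → g w ≠ 0 →
      (∀ᶠ z in 𝓝[≠] w, F z = (z - w) ^ n * g z) → ∃ G ∈ L, G w ≠ 0 := by
    intro n
    induction n with
    | zero =>
      intro F hF g hg hgw h
      refine ⟨F, hF, fun hFw => hgw ?_⟩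
      have h1 := (hL.1 F hF w).continuousAt.tendsto.mono_left (nhdsWithin_le_nhds (s := {w}ᶜ))
      rw [← hFw]
      exact tendsto_nhds_unique (hg.tendsto.mono_left nhdsWithin_le_nhds)
        (h1.congr' (h.mono fun z hz => by rw [hz, pow_zero, one_mul]))
    | succ n ih =>
      intro F hF g hg hgw h
      by_cases hFw : F w = 0
      · obtain ⟨G, hG, hGF⟩ := hL.2.1 F hF w hFw
        refine ih G hG g hg hgw ?_
        filter_upwards [h, self_mem_nhdsWithin] with z hz hzw
        rw [hGF z hzw, hz, pow_succ', mul_assoc, mul_div_cancel_left₀ _ (sub_ne_zero.2 hzw)]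
      · exact ⟨F, hF, hFw⟩
  have han : AnalyticOnNhd ℂ F Set.univ := (hL.1 F hF).differentiableOn.analyticOnNhd isOpen_univ
  have hne : ¬ ∀ᶠ z in 𝓝 w, F z = 0 := fun h => h0 (han.eq_of_eventuallyEq
    (fun z _ => analyticAt_const (v := (0 : ℂ))) h)
  obtain ⟨n, g, hg, hgw, h⟩ :=
    ((han w (Set.mem_univ w)).exists_eventuallyEq_pow_smul_nonzero_iff).2 hne
  exact key n F hF g hg.continuousAt hgw (nhdsWithin_le_nhds h)

theorem IsAlgebraicDeBranges.isDeBrangesSubspace (hL : IsAlgebraicDeBranges L)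
    (hW : ∀ x, 0 < W x) (hsub : SubsetC0e W L) {F : ℂ → ℂ} (hF : F ∈ L) (h0 : F ≠ 0) :
    WeightedC0.IsDeBrangesSubspace (realRestrictions L (recipWeight W)) (entireExtension L) where
  differentiable m hm := hL.1 _ (entireExtension_mem hm)
  eq_ofReal m hm t := entireExtension_ofReal hm t
  quot m hm n hn w hw := by
    obtain ⟨Q, hQ, hQ'⟩ := hL.2.1 (entireExtension L m w • entireExtension L n -
      entireExtension L n w • entireExtension L m)
      (L.sub_mem (L.smul_mem _ (entireExtension_mem hn)) (L.smul_mem _ (entireExtension_mem hm))) w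
      (by simp only [Pi.sub_apply, Pi.smul_apply, smul_eq_mul]; ring)
    obtain ⟨a, ha, b, hb, ha', hb'⟩ := hL.exists_re_im hW hsub hQ
    refine ⟨a, ha, b, hb, fun t => ?_⟩
    rw [ha', hb', Complex.re_add_im, hQ' t (sub_ne_zero.1 (WeightedC0.ofReal_sub_ne_zero hw t)),
      ← entireExtension_ofReal hm, ← entireExtension_ofReal hn, div_eq_mul_inv]
    rfl
  exists_ne_zero w := by
    obtain ⟨G, hG, hGw⟩ := hL.exists_ne_zero hF h0 w
    obtain ⟨a, ha, b, hb, hab⟩ := hL.exists_eq_add hW hsub hG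
    by_cases h : entireExtension L a w = 0
    · exact ⟨b, hb, fun h' => hGw (by rw [hab, h, h', mul_zero, add_zero])⟩
    · exact ⟨a, ha, h⟩

theorem exists_forall_exists_le (hW : ∀ x, 0 < W x) (hnd : ¬ DenseInC0e W L) :
    ∃ f : WeightedC0 (recipWeight W), ∃ ε > 0, ∀ m ∈ realRestrictions L (recipWeight W),
      ∃ t, ε ≤ |f.1 t - m.1 t| * recipWeight W t := by
  by_contra! hc
  refine hnd fun f hf ε hε => ?_
  have hε1 : min ε 1 ≠ ⊤ := ((min_le_right ε 1).trans_lt ENNReal.one_lt_top).ne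
  have hε0 : 0 < (min ε 1).toReal := ENNReal.toReal_pos (lt_min hε one_pos).ne' hε1
  obtain ⟨a, ⟨A, hA, hA'⟩, ha⟩ := hc
    ⟨_, hf.comp_mem hW Complex.continuous_re Complex.abs_re_le_norm⟩ _ (by positivity :
      0 < (min ε 1).toReal / 4)
  obtain ⟨b, ⟨B, hB, hB'⟩, hb⟩ := hc
    ⟨_, hf.comp_mem hW Complex.continuous_im Complex.abs_im_le_norm⟩ _ (by positivity :
      0 < (min ε 1).toReal / 4)
  refine ⟨A + Complex.I • B, L.add_mem hA (L.smul_mem _ hB), ?_⟩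
  have hle : eC0norm W (fun x : ℝ => f x - (A + Complex.I • B) (x : ℂ)) ≤
      ENNReal.ofReal ((min ε 1).toReal / 2) := by
    refine iSup_le fun t => ?_
    rw [nnnorm_div_weight hW]
    refine ENNReal.ofReal_le_ofReal ?_
    have h1 : ‖f t - (A + Complex.I • B) (t : ℂ)‖ ≤
        |(f t).re - a.1 t| + |(f t).im - b.1 t| := by
      refine (Complex.norm_le_abs_re_add_abs_im _).trans_eq ?_
      simp [hA', hB']
    have h2 := mul_le_mul_of_nonneg_right h1 (recipWeight_nonneg W t)
    have h3 : |(f t).re - a.1 t| * recipWeight W t < _ := ha t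
    have h4 : |(f t).im - b.1 t| * recipWeight W t < _ := hb t
    rw [add_mul] at h2
    linarith
  refine hle.trans_lt (lt_of_lt_of_le ?_ (min_le_left ε 1))
  rw [← ENNReal.ofReal_toReal hε1, ENNReal.toReal_ofReal hε0.le]
  exact (ENNReal.ofReal_lt_ofReal_iff hε0).2 (by linarith)

end realPart

theorem kreinClass_nonempty_of_trivial {L : Submodule ℂ (ℂ → ℂ)} {W : ℝ → ℝ≥0∞} (hW : IsWeight W)
    (hL : ∀ F ∈ L, F = 0) : (KreinClass L W).Nonempty := by
  obtain ⟨x₀, hx₀⟩ := not_forall.1 hW.2.2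
  have hd : ∀ z : ℂ, deriv (fun z : ℂ => z - x₀) z = 1 := fun z => by simp
  refine ⟨fun z => z - x₀, by fun_prop, ⟨x₀, sub_self _⟩, fun z hz => ⟨?_, by simp⟩,
    fun z => by simp, fun F hF => ?_, fun F hF => ?_, ?_⟩
  · rw [sub_eq_zero.1 hz, Complex.ofReal_im]
  · obtain rfl := hL F hF
    have : ∀ S : Set ℂ, S.Nonempty → BddTypeQuot S 0 fun z => z - x₀ := fun S ⟨z, hz⟩ =>
      ⟨0, fun _ => 1, differentiableOn_const 0, differentiableOn_const 1,
        ⟨0, fun z _ => by simp⟩, ⟨1, fun z _ => by simp⟩, fun h => one_ne_zero (h z hz),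
        fun z _ => by simp⟩
    exact ⟨this _ ⟨Complex.I, by simp [UpperHalf]⟩, this _ ⟨-Complex.I, by simp [LowerHalf]⟩⟩
  · obtain rfl := hL F hF
    exact isLittleO_zero _ _
  · rw [tsum_eq_single ⟨x₀, sub_self _⟩ fun t ht => absurd
      (Subtype.ext (Complex.ofReal_injective (sub_eq_zero.1 t.2))) ht, hd]
    simpa using hx₀

open WeightedC0 in
theorem IsAlgebraicDeBranges.kreinClass_nonempty {L : Submodule ℂ (ℂ → ℂ)} {W : ℝ → ℝ≥0∞}
    (hL : IsAlgebraicDeBranges L) (hW : IsWeight W) (hsub : SubsetC0e W L)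
    (hnd : ¬ DenseInC0e W L) {F₀ : ℂ → ℂ} (hF₀ : F₀ ∈ L) (h0 : F₀ ≠ 0) :
    (KreinClass L W).Nonempty := by
  have D := hL.isDeBrangesSubspace hW.2.1 hsub hF₀ h0
  obtain ⟨f, ε, hε, hf⟩ := exists_forall_exists_le hW.2.1 hnd
  obtain ⟨φ, H⟩ := exists_extremeAnnihilator (recipWeight_nonneg W)
    (upperSemicontinuous_recipWeight hW) _ f hε hf
  obtain ⟨μ, hμ⟩ := H.exists_isMass D
  obtain ⟨B, hBd, hBc, hBC, hB0, hBS, hB'⟩ := hμ.exists_entire H D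
  have hB'' : ∀ x ∈ support φ, ‖deriv B x‖ = |μ x|⁻¹ := fun x hx => by
    rw [hB' x hx, norm_neg, norm_inv, Complex.norm_real, Real.norm_eq_abs]
  refine ⟨B, hBd, ?_, fun z hz => ?_, fun z => ?_, fun F hF => ?_, fun F hF => ?_, ?_⟩
  · obtain ⟨s, hs⟩ := H.support_nonempty
    exact ⟨s, (hBS s).2 hs⟩
  · have hz' : ((z.re : ℝ) : ℂ) = z := Complex.ext rfl (hB0 z hz).symm
    rw [← hz'] at hz ⊢
    have hs := (hBS _).1 hz
    refine ⟨Complex.ofReal_im _, ?_⟩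
    rw [hB' _ hs]
    exact neg_ne_zero.2 (inv_ne_zero (Complex.ofReal_ne_zero.2 (hμ.ne_zero _ hs)))
  · rw [hBc, Complex.conj_conj]
  · obtain ⟨a, ha, b, hb, hab⟩ := hL.exists_eq_add hW.2.1 hsub hF
    have hFB : ∀ w : ℂ, w.im ≠ 0 →
        F w = B w * (cauchyTransform φ a w + Complex.I * cauchyTransform φ b w) := fun w hw => by
      rw [hab, hBC a ha w hw, hBC b hb w hw]
      ring
    have ta := IsBddType.of_hasSum (hμ.summable_mul H a) fun w hw =>
      hμ.hasSum_cauchyTransform H a hw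
    have tb := IsBddType.of_hasSum (hμ.summable_mul H b) fun w hw =>
      hμ.hasSum_cauchyTransform H b hw
    exact ⟨(ta.1.add (tb.1.const_mul Complex.I)).bddTypeQuot ⟨Complex.I, by simp [UpperHalf]⟩
        fun z hz => hFB z (ne_of_gt hz),
      (ta.2.add (tb.2.const_mul Complex.I)).bddTypeQuot ⟨-Complex.I, by simp [LowerHalf]⟩
        fun z hz => hFB z (ne_of_lt hz)⟩
  · obtain ⟨a, ha, b, hb, hab⟩ := hL.exists_eq_add hW.2.1 hsub hF
    have hne : ∀ᶠ y : ℝ in atTop ⊔ atBot, y ≠ 0 :=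
      eventually_sup.2 ⟨eventually_ne_atTop 0, eventually_ne_atBot 0⟩
    have hC : ∀ g : WeightedC0 (recipWeight W),
        Tendsto (fun y : ℝ => cauchyTransform φ g (y * Complex.I)) (atTop ⊔ atBot) (𝓝 0) := by
      intro g
      have h1 : Tendsto (fun y : ℝ => |y|⁻¹) (atTop ⊔ atBot) (𝓝 0) :=
        tendsto_inv_atTop_zero.comp (tendsto_abs_atTop_atTop.sup tendsto_abs_atBot_atTop)
      refine squeeze_zero_norm (fun y => (H.norm_cauchyTransform_le g _).trans_eq ?_)
        (by simpa using h1.const_mul (2 * variation φ g))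
      simp
    have hC' := (hC a).add ((hC b).const_mul Complex.I)
    rw [mul_zero, add_zero] at hC'
    refine IsLittleO.congr' (((isLittleO_one_iff ℂ).2 hC').mul_isBigO
      (isBigO_refl (fun y : ℝ => B (y * Complex.I)) _)) ?_
      (Eventually.of_forall fun y => one_mul _)
    filter_upwards [hne] with y hy
    have hw : ((y : ℂ) * Complex.I).im ≠ 0 := by simpa using hy
    rw [hab, hBC a ha _ hw, hBC b hb _ hw]
    ring
  · have hterm : ∀ x : support φ, W x / (‖deriv B ((x : ℝ) : ℂ)‖₊ : ℝ≥0∞) =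
        ENNReal.ofReal (|μ x| / recipWeight W x) := fun x => by
      have hv := hμ.pos H x.2
      have hμx := abs_pos.2 (hμ.ne_zero x x.2)
      have h1 : (‖deriv B ((x : ℝ) : ℂ)‖₊ : ℝ≥0∞) = (ENNReal.ofReal |μ x|)⁻¹ := by
        rw [← ENNReal.ofReal_inv_of_pos hμx, ← hB'' x x.2, ofReal_norm]
        rfl
      have h2 : W x = (ENNReal.ofReal (recipWeight W x))⁻¹ := by
        rw [recipWeight, ENNReal.ofReal_toReal (ENNReal.inv_ne_top.2 (hW.2.1 x).ne'), inv_inv]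
      rw [h1, ENNReal.ofReal_div_of_pos hv, div_eq_mul_inv, inv_inv, h2, mul_comm,
        ← div_eq_mul_inv]
    have hsum := ((Equiv.subtypeEquivRight fun x => (hBS x).symm).tsum_eq
      fun x : {t : ℝ // B (t : ℂ) = 0} => W x.1 / (‖deriv B (x.1 : ℂ)‖₊ : ℝ≥0∞)).symm.trans
      (tsum_congr hterm)
    rw [hsum, ← ENNReal.ofReal_tsum_of_nonneg
      (fun x => div_nonneg (abs_nonneg _) (recipWeight_nonneg W _)) (hμ.summable H)]
    exact ENNReal.ofReal_ne_top

/-- De Branges' theorem for algebraic de Branges spaces, necessity: if `𝓛` is not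
dense in `C₀(W)`, then the Krein class `𝒦(𝓛,W)` is nonempty. -/
theorem stmt5 (L : Submodule ℂ (ℂ → ℂ)) (hL : IsAlgebraicDeBranges L)
    (W : ℝ → ℝ≥0∞) (hW : IsWeight W) (hsub : SubsetC0e W L)
    (hnd : ¬ DenseInC0e W L) :
    (KreinClass L W).Nonempty := by
  by_cases h : ∀ F ∈ L, F = 0
  · exact kreinClass_nonempty_of_trivial hW h
  · push Not at h
    obtain ⟨F, hF, h0⟩ := h
    exact hL.kreinClass_nonempty hW hsub hnd hF h0
end

section
/- Let μ be a discrete positive Borel measure on ℝ whose support contains at least two points, let 𝓛 be an algebraic de Branges space, 𝓛 ≠ {0}, with ∫_ℝ |F| dμ < ∞ for all F ∈ 𝓛 and F ↦ F|_ℝ injective from 𝓛 into L¹(μ), and let g₀ ∈ L^∞(μ) with |g₀| = 1 μ-a.e. be such that the closure of {F|_ℝ : F ∈ 𝓛} in L¹(μ) equals {f ∈ L¹(μ) : ∫_ℝ f·g₀ dμ = 0}. Let 𝔪(z) := sup{|F(z)| : F ∈ 𝓛, ‖F|_ℝ‖_{L¹(μ)} ≤ 1}. Then sup{ limsup_{y→+∞}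 (1/y) log(|F(iy)|/𝔪(iy)) : F ∈ 𝓛, F ≠ 0 } = 0. -/
open Filter MeasureTheory
open scoped ENNReal NNReal

/-- The norm of the point evaluation at `z`:
`𝔪(z) = sup {|F(z)| : F ∈ 𝓛, ‖F|_ℝ‖_{L¹(μ)} ≤ 1}`. -/
noncomputable def L1Majorant (μ : Measure ℝ) (L : Submodule ℂ (ℂ → ℂ)) (z : ℂ) : ℝ≥0∞ :=
  ⨆ F : {F : ℂ → ℂ // F ∈ L ∧ (∫⁻ x : ℝ, (‖F (x : ℂ)‖₊ : ℝ≥0∞) ∂μ) ≤ 1},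
    (‖F.1 z‖₊ : ℝ≥0∞)

/-- `μ` is a discrete measure: it lives on a countable set. -/
def IsDiscreteMeasure (μ : Measure ℝ) : Prop :=
  ∃ s : Set ℝ, s.Countable ∧ μ sᶜ = 0

/-- `x` belongs to the (topological) support of `μ`. -/
def MemSupport (μ : Measure ℝ) (x : ℝ) : Prop :=
  ∀ U ∈ nhds x, μ U ≠ 0

/-- Membership in the space `𝒦`: `F` entire, `F|_ℝ ∈ L¹(μ)`,
`|F(iy)| = O(𝔪(iy))` as `|y| → ∞`, and `F/F₀` of bounded type in both
half-planes for some `F₀ ∈ 𝓛 \ {0}`. -/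
def MemKcal (μ : Measure ℝ) (L : Submodule ℂ (ℂ → ℂ)) (F : ℂ → ℂ) : Prop :=
  Differentiable ℂ F ∧
  (∫⁻ x : ℝ, (‖F (x : ℂ)‖₊ : ℝ≥0∞) ∂μ) < ⊤ ∧
  (∃ C : ℝ≥0, ∀ᶠ (y : ℝ) in (atTop ⊔ atBot : Filter ℝ),
    (‖F ((y : ℂ) * Complex.I)‖₊ : ℝ≥0∞) ≤ C * L1Majorant μ L ((y : ℂ) * Complex.I)) ∧
  ∃ F₀ ∈ L, F₀ ≠ (0 : ℂ → ℂ) ∧ BddTypeQuot UpperHalf F F₀ ∧ BddTypeQuot LowerHalf F F₀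


theorem integrable_exp_mul {μ : Measure ℝ} {h : ℝ → ℂ} (hh : Integrable h μ) (t : ℝ) :
    Integrable (fun x : ℝ => Complex.exp (-(Complex.I * t * x)) * h x) μ := by
  refine hh.bdd_mul (c := 1) (by fun_prop) (ae_of_all _ fun x => ?_)
  rw [Complex.norm_exp]; simp

theorem norm_fourier_le {μ : Measure ℝ} (h : ℝ → ℂ) (t : ℝ) :
    ‖∫ x : ℝ, Complex.exp (-(Complex.I * t * x)) * h x ∂μ‖ ≤ ∫ x, ‖h x‖ ∂μ := by
  refine (norm_integral_le_integral_norm _).trans_eq (integral_congr_ae (ae_of_all _ fun x => ?_))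
  simp [Complex.norm_exp]

theorem continuous_fourier {μ : Measure ℝ} {h : ℝ → ℂ} (hh : Integrable h μ) :
    Continuous (fun t : ℝ => ∫ x : ℝ, Complex.exp (-(Complex.I * t * x)) * h x ∂μ) := by
  refine continuous_of_dominated (fun t => (integrable_exp_mul hh t).1) (bound := fun x => ‖h x‖)
    (fun t => ae_of_all _ fun x => ?_) hh.norm (ae_of_all _ fun x => by fun_prop)
  simp [Complex.norm_exp]

/-- A truncated Laplace transform of a continuous function, rescaled to be bounded in the lower
half-plane. -/
noncomputable def truncLaplace (φ : ℝ → ℂ) (b : ℝ) (z : ℂ) : ℂ :=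
  ∫ t in (0 : ℝ)..b, Complex.exp (-(Complex.I * (b - t) * z)) * φ t

theorem norm_truncLaplace_le {φ : ℝ → ℂ} {M b : ℝ} (hM : ∀ t, ‖φ t‖ ≤ M) (hb : 0 ≤ b) (z : ℂ) :
    ‖truncLaplace φ b z‖ ≤ M * b * Real.exp (b * max z.im 0) := by
  have hM0 : 0 ≤ M := (norm_nonneg _).trans (hM 0)
  have := intervalIntegral.norm_integral_le_of_norm_le_const (a := 0) (b := b)
    (f := fun t : ℝ => Complex.exp (-(Complex.I * (b - t) * z)) * φ t)
    (C := Real.exp (b * max z.im 0) * M) (by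
      intro t ht
      rw [Set.uIoc_of_le hb] at ht
      rw [norm_mul, Complex.norm_exp]
      gcongr
      · simp
        calc (b - t) * z.im ≤ (b - t) * max z.im 0 := by
              gcongr
              · linarith [ht.2]
              · exact le_max_left _ _
          _ ≤ b * max z.im 0 := by
              gcongr
              linarith [ht.1]
      · exact hM t)
  refine this.trans_eq ?_
  rw [sub_zero, abs_of_nonneg hb]; ring

theorem differentiable_truncLaplace {φ : ℝ → ℂ} (hφ : Continuous φ) {M b : ℝ}
    (hM : ∀ t, ‖φ t‖ ≤ M) (hb : 0 ≤ b) : Differentiable ℂ (truncLaplace φ b) := by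
  intro z₀
  have hM0 : 0 ≤ M := (norm_nonneg _).trans (hM 0)
  have := intervalIntegral.hasDerivAt_integral_of_dominated_loc_of_deriv_le (𝕜 := ℂ)
    (μ := volume) (a := 0) (b := b) (x₀ := z₀)
    (F := fun z t => Complex.exp (-(Complex.I * (b - t) * z)) * φ t)
    (F' := fun z t => Complex.exp (-(Complex.I * (b - t) * z)) * (-(Complex.I * (b - t))) * φ t)
    (bound := fun _ => Real.exp (b * (‖z₀‖ + 1)) * b * M)
    (Metric.ball_mem_nhds z₀ one_pos)
    (Eventually.of_forall fun z => by fun_prop) (Continuous.intervalIntegrable (by fun_prop) _ _)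
    (by fun_prop)
    (ae_of_all _ fun t ht z hz => ?_) intervalIntegrable_const (ae_of_all _ fun t ht z hz => ?_)
  · exact this.2.differentiableAt
  · rw [Set.uIoc_of_le hb] at ht
    have hz' : ‖z‖ ≤ ‖z₀‖ + 1 := by
      have h1 : ‖z - z₀‖ < 1 := by simpa [dist_eq_norm] using hz
      have h2 := norm_add_le (z - z₀) z₀
      rw [sub_add_cancel] at h2; linarith
    have hbt : ‖Complex.I * ((b : ℂ) - t)‖ ≤ b := by
      rw [norm_mul, Complex.norm_I, one_mul, ← Complex.ofReal_sub, Complex.norm_real,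
        Real.norm_of_nonneg (by linarith [ht.2])]
      linarith [ht.1]
    rw [norm_mul, norm_mul, norm_neg]
    gcongr
    · refine (Complex.norm_exp_le_exp_norm _).trans ?_
      rw [norm_neg, norm_mul]
      gcongr
    · exact hM t
  · refine HasDerivAt.mul_const ?_ _
    refine HasDerivAt.cexp ?_
    simpa using ((hasDerivAt_id z).const_mul (Complex.I * ((b : ℂ) - t))).fun_neg

theorem exp_mul_integral_exp {b y : ℝ} (hy : y ≠ 0) (x : ℝ) :
    ∫ t in (0 : ℝ)..b, Complex.exp (-(Complex.I * (b - t) * (y * Complex.I))) *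
        Complex.exp (-(Complex.I * t * x)) =
      Complex.I * (Complex.exp (-(Complex.I * b * x)) - Complex.exp (b * y)) *
        ((x : ℂ) - y * Complex.I)⁻¹ := by
  have hne : (x : ℂ) - y * Complex.I ≠ 0 := by
    intro h; apply hy; simpa using congrArg Complex.im h
  have hne' : -Complex.I * ((x : ℂ) - y * Complex.I) ≠ 0 := by simp [hne]
  have key : ∀ t : ℝ, Complex.exp (-(Complex.I * (b - t) * (y * Complex.I))) *
        Complex.exp (-(Complex.I * t * x)) = Complex.exp (b * y) *
          Complex.exp (-Complex.I * ((x : ℂ) - y * Complex.I) * t) := by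
    intro t
    rw [← Complex.exp_add, ← Complex.exp_add]
    congr 1
    linear_combination (-(b : ℂ) * y) * Complex.I_sq
  simp_rw [key]
  rw [intervalIntegral.integral_const_mul, integral_exp_mul_complex hne']
  have : Complex.exp (-(Complex.I * b * x)) = Complex.exp (b * y) *
      Complex.exp (-Complex.I * ((x : ℂ) - y * Complex.I) * b) := by
    rw [← Complex.exp_add]
    congr 1
    linear_combination (-(b : ℂ) * y) * Complex.I_sq
  rw [this]
  have hI := Complex.I_sq
  field_simp
  simp

theorem integrable_mul_cauchyKernel {μ : Measure ℝ} {h : ℝ → ℂ} (hh : Integrable h μ) {y : ℝ}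
    (hy : y ≠ 0) : Integrable (fun x : ℝ => h x * ((x : ℂ) - y * Complex.I)⁻¹) μ := by
  refine hh.mul_bdd (c := |y|⁻¹) (by fun_prop) (ae_of_all _ fun x => ?_)
  rw [norm_inv]
  have := Complex.abs_im_le_norm ((x : ℂ) - y * Complex.I)
  simp at this
  gcongr

theorem norm_integral_mul_cauchyKernel_le {μ : Measure ℝ} {h : ℝ → ℂ} (hh : Integrable h μ)
    {y : ℝ} (hy : y ≠ 0) :
    ‖∫ x : ℝ, h x * ((x : ℂ) - y * Complex.I)⁻¹ ∂μ‖ ≤ (∫ x, ‖h x‖ ∂μ) * |y|⁻¹ := by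
  rw [← integral_mul_const]
  refine norm_integral_le_of_norm_le (hh.norm.mul_const _) (ae_of_all _ fun x => ?_)
  rw [norm_mul, norm_inv]
  have := Complex.abs_im_le_norm ((x : ℂ) - y * Complex.I)
  simp at this
  gcongr

theorem truncLaplace_fourier {μ : Measure ℝ} [SFinite μ] {h : ℝ → ℂ} (hh : Integrable h μ)
    {b y : ℝ} (hb : 0 ≤ b) (hy : y ≠ 0) :
    truncLaplace (fun t => ∫ x : ℝ, Complex.exp (-(Complex.I * t * x)) * h x ∂μ) b
        (y * Complex.I) =
      Complex.I * (∫ x : ℝ, Complex.exp (-(Complex.I * b * x)) * h x *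
          ((x : ℂ) - y * Complex.I)⁻¹ ∂μ) -
        Complex.I * Complex.exp (b * y) * ∫ x : ℝ, h x * ((x : ℂ) - y * Complex.I)⁻¹ ∂μ := by
  unfold truncLaplace
  simp_rw [← integral_const_mul]
  rw [intervalIntegral.integral_of_le hb, integral_integral_swap,
    ← integral_sub ((integrable_mul_cauchyKernel (integrable_exp_mul hh b) hy).const_mul _)
      ((integrable_mul_cauchyKernel hh hy).const_mul _)]
  · refine integral_congr_ae (ae_of_all _ fun x => ?_)
    have := congrArg (· * h x) (exp_mul_integral_exp (b := b) hy x)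
    simp only [← intervalIntegral.integral_mul_const] at this
    simp only [← intervalIntegral.integral_of_le hb]
    exact (intervalIntegral.integral_congr fun t _ => (mul_assoc _ _ _).symm).trans
      (this.trans (by ring))
  · have h1 : Integrable (fun t : ℝ => Complex.exp (-(Complex.I * (b - t) * (y * Complex.I))))
        (volume.restrict (Set.Ioc 0 b)) :=
      (Continuous.integrableOn_Ioc (by fun_prop))
    refine ((h1.mul_prod hh).bdd_mul (c := 1)
      (f := fun p : ℝ × ℝ => Complex.exp (-(Complex.I * p.1 * p.2)))
      (by fun_prop) (ae_of_all _ fun x => ?_)).congr (ae_of_all _ fun p => ?_)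
    · simp [Complex.norm_exp]
    · simp only [Function.uncurry]; ring

/-- An entire function of exponential type which is bounded in the lower half-plane and on the
positive imaginary axis, and tends to zero along the negative imaginary axis, vanishes. -/
theorem eq_zero_of_bounded_of_exp_type {K : ℂ → ℂ} (hK : Differentiable ℂ K) {A b C : ℝ}
    (hA : ∀ z, ‖K z‖ ≤ A * Real.exp (b * max z.im 0)) (hA0 : 0 ≤ A) (hb : 0 ≤ b)
    (hC : ∀ y : ℝ, 0 ≤ y → ‖K (y * Complex.I)‖ ≤ C)
    (hlim : Tendsto (fun y : ℝ => K (y * Complex.I)) atBot (nhds 0)) (z : ℂ) : K z = 0 := by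
  have hreal : ∀ x : ℝ, ‖K x‖ ≤ max A C := fun x =>
    (by simpa using hA x : ‖K x‖ ≤ A).trans (le_max_left _ _)
  have him : ∀ y : ℝ, 0 ≤ y → ‖K (y * Complex.I)‖ ≤ max A C := fun y hy =>
    (hC y hy).trans (le_max_right _ _)
  have hgrow : ∀ l : Filter ℂ, K =O[l] fun z => Real.exp (b * ‖z‖ ^ (1 : ℝ)) := fun l => by
    refine Asymptotics.IsBigO.of_bound A (Eventually.of_forall fun z => (hA z).trans ?_)
    rw [Real.norm_of_nonneg (Real.exp_nonneg _), Real.rpow_one]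
    gcongr
    exact max_le ((le_abs_self _).trans (Complex.abs_im_le_norm z)) (norm_nonneg _)
  have hbdd : ∀ z, ‖K z‖ ≤ max A C := by
    intro z
    rcases le_total z.im 0 with h | h
    · have := hA z
      rw [max_eq_right h, mul_zero, Real.exp_zero, mul_one] at this
      exact this.trans (le_max_left _ _)
    · rcases le_total 0 z.re with h' | h'
      · exact PhragmenLindelof.quadrant_I hK.diffContOnCl ⟨1, by norm_num, b, hgrow _⟩
          (fun x _ => hreal x) him h' h
      · exact PhragmenLindelof.quadrant_II hK.diffContOnCl ⟨1, by norm_num, b, hgrow _⟩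
          (fun x _ => hreal x) him h' h
  have hbd : Bornology.IsBounded (Set.range K) := by
    refine (Metric.isBounded_closedBall (x := 0) (r := max A C)).subset ?_
    rintro _ ⟨w, rfl⟩
    simpa using hbdd w
  refine tendsto_nhds_unique (tendsto_const_nhds (f := atBot (α := ℝ))) (hlim.congr fun y => ?_)
  exact hK.apply_eq_apply_of_bounded hbd _ _

/-- If the Cauchy transform of an integrable density decays exponentially along the positive
imaginary axis, its Fourier transform vanishes on an interval. -/
theorem fourier_eq_zero_of_cauchy_decay {μ : Measure ℝ} [SFinite μ] {h : ℝ → ℂ}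
    (hh : Integrable h μ) {a : ℝ}
    (hdec : ∀ᶠ y : ℝ in atTop,
      ‖∫ x : ℝ, h x * ((x : ℂ) - y * Complex.I)⁻¹ ∂μ‖ ≤ Real.exp (-(a * y)))
    {b : ℝ} (hb : b ∈ Set.Ioo 0 a) :
    ∫ x : ℝ, Complex.exp (-(Complex.I * b * x)) * h x ∂μ = 0 := by
  set φ : ℝ → ℂ := fun t => ∫ x : ℝ, Complex.exp (-(Complex.I * t * x)) * h x ∂μ with hφ
  set M := ∫ x, ‖h x‖ ∂μ with hMdef
  have hM : ∀ t, ‖φ t‖ ≤ M := norm_fourier_le h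
  have hM0 : 0 ≤ M := integral_nonneg fun x => norm_nonneg _
  have hcont : Continuous φ := continuous_fourier hh
  have hform : ∀ c y : ℝ, 0 ≤ c → y ≠ 0 → ‖truncLaplace φ c (y * Complex.I)‖ ≤ M * |y|⁻¹ +
      Real.exp (c * y) * ‖∫ x : ℝ, h x * ((x : ℂ) - y * Complex.I)⁻¹ ∂μ‖ := by
    intro c y hc hy
    rw [truncLaplace_fourier hh hc hy]
    refine (norm_sub_le _ _).trans (add_le_add ?_ ?_)
    · rw [norm_mul, Complex.norm_I, one_mul]
      refine (norm_integral_mul_cauchyKernel_le (integrable_exp_mul hh c) hy).trans_eq ?_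
      congr 1
      refine integral_congr_ae (ae_of_all _ fun x => ?_)
      simp [Complex.norm_exp]
    · rw [norm_mul, norm_mul, Complex.norm_I, one_mul, Complex.norm_exp]
      simp
  have hzero : ∀ c ∈ Set.Ioo 0 a, ∫ t in (0 : ℝ)..c, φ t = 0 := by
    intro c hc
    have hbd := norm_truncLaplace_le hM hc.1.le
    obtain ⟨y₀, hy₀⟩ := eventually_atTop.1 hdec
    have hvan := eq_zero_of_bounded_of_exp_type (differentiable_truncLaplace hcont hM hc.1.le)
      (A := M * c) (b := c) (C := max (M * c * Real.exp (c * max y₀ 1)) (M + 1)) hbd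
      (mul_nonneg hM0 hc.1.le) hc.1.le ?_ ?_ 0
    · simpa [truncLaplace] using hvan
    · intro y hy
      rcases le_total y (max y₀ 1) with h' | h'
      · refine ((hbd _).trans ?_).trans (le_max_left _ _)
        have : max ((y : ℂ) * Complex.I).im 0 ≤ max y₀ 1 := by
          simp only [Complex.mul_im, Complex.ofReal_re, Complex.I_im, mul_one, Complex.ofReal_im,
            Complex.I_re, mul_zero, add_zero]
          exact max_le h' (zero_le_one.trans (le_max_right _ _))
        have := hc.1.le
        gcongr
      · have hy1 : 1 ≤ y := (le_max_right _ _).trans h'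
        refine ((hform c y hc.1.le (by linarith)).trans (add_le_add ?_ ?_)).trans
          (le_max_right _ _)
        · rw [abs_of_nonneg hy]
          exact mul_le_of_le_one_right hM0 (inv_le_one_of_one_le₀ hy1)
        · calc _ ≤ Real.exp (c * y) * Real.exp (-(a * y)) := by
                gcongr
                exact hy₀ y ((le_max_left _ _).trans h')
            _ ≤ 1 := by
                rw [← Real.exp_add, Real.exp_le_one_iff]
                nlinarith [hc.2]
    · have hlim : Tendsto (fun y : ℝ => (2 * M) * |y|⁻¹) atBot (nhds 0) := by
        simpa using (tendsto_inv_atTop_zero.comp tendsto_abs_atBot_atTop).const_mul (2 * M)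
      refine squeeze_zero_norm' ?_ hlim
      filter_upwards [eventually_lt_atBot 0] with y hy
      refine (hform c y hc.1.le hy.ne).trans ?_
      have h1 : Real.exp (c * y) ≤ 1 := by
        rw [Real.exp_le_one_iff]
        nlinarith [hc.1]
      have h2 := norm_integral_mul_cauchyKernel_le hh hy.ne
      have h3 := mul_le_mul h1 h2 (norm_nonneg _) zero_le_one
      linarith
  have hderiv : HasDerivAt (fun c => ∫ t in (0 : ℝ)..c, φ t) (φ b) b :=
    intervalIntegral.integral_hasDerivAt_right (hcont.intervalIntegrable _ _)
      (hcont.stronglyMeasurableAtFilter _ _) hcont.continuousAt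
  refine hderiv.unique ((hasDerivAt_const b (0 : ℂ)).congr_of_eventuallyEq ?_)
  filter_upwards [isOpen_Ioo.mem_nhds hb] with c hc using hzero c hc

theorem IsAlgebraicDeBranges.exists_apply_ne_zero {L : Submodule ℂ (ℂ → ℂ)}
    (hdb : IsAlgebraicDeBranges L) (hL : L ≠ ⊥) (w : ℂ) : ∃ F ∈ L, F w ≠ 0 := by
  by_contra! hw
  obtain ⟨F, hF, hF0⟩ := L.exists_mem_ne_zero_of_ne_bot hL
  have hpow : ∀ n : ℕ, ∃ G ∈ L, ∀ z, F z = (z - w) ^ n * G z := by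
    intro n
    induction n with
    | zero => exact ⟨F, hF, fun z => by simp⟩
    | succ n ih =>
      obtain ⟨G, hG, hFG⟩ := ih
      obtain ⟨H, hH, hGH⟩ := hdb.2.1 G hG w (hw G hG)
      refine ⟨H, hH, fun z => ?_⟩
      rcases eq_or_ne z w with rfl | hz
      · simp [hw F hF]
      · rw [hFG, hGH z hz]
        have := sub_ne_zero.2 hz
        field_simp
        ring
  have hFd := hdb.1 F hF
  have htop : analyticOrderAt F w = ⊤ := by
    refine ENat.eq_top_iff_forall_ge.2 fun n => ?_
    rw [natCast_le_analyticOrderAt (hFd.analyticAt w)]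
    obtain ⟨G, hG, hFG⟩ := hpow n
    exact ⟨G, (hdb.1 G hG).analyticAt w, Eventually.of_forall fun z => by simp [hFG z]⟩
  refine hF0 (AnalyticOnNhd.eq_of_eventuallyEq (z₀ := w) (fun z _ => hFd.analyticAt z)
    (fun z _ => analyticAt_const) (analyticOrderAt_eq_top.1 htop))

theorem enorm_apply_le_mul_L1Majorant {μ : Measure ℝ} {L : Submodule ℂ (ℂ → ℂ)} {F : ℂ → ℂ}
    (hF : F ∈ L) {C : ℝ≥0} (hC : C ≠ 0) (hFC : ∫⁻ x : ℝ, (‖F (x : ℂ)‖₊ : ℝ≥0∞) ∂μ ≤ C) (z : ℂ) :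
    (‖F z‖₊ : ℝ≥0∞) ≤ C * L1Majorant μ L z := by
  have hmem : ((C : ℂ)⁻¹ • F) ∈ L ∧
      (∫⁻ x : ℝ, (‖((C : ℂ)⁻¹ • F) (x : ℂ)‖₊ : ℝ≥0∞) ∂μ) ≤ 1 := by
    refine ⟨L.smul_mem _ hF, ?_⟩
    simp only [Pi.smul_apply, smul_eq_mul, nnnorm_mul, nnnorm_inv, ENNReal.coe_mul]
    rw [lintegral_const_mul' _ _ ENNReal.coe_ne_top]
    have : ‖(C : ℂ)‖₊ = C := by ext; simp
    rw [this, ENNReal.coe_inv hC, mul_comm, ← div_eq_mul_inv]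
    exact ENNReal.div_le_of_le_mul (by simpa using hFC)
  have hle : (‖((C : ℂ)⁻¹ • F) z‖₊ : ℝ≥0∞) ≤ L1Majorant μ L z :=
    le_iSup (fun F : {F : ℂ → ℂ // F ∈ L ∧ (∫⁻ x : ℝ, (‖F (x : ℂ)‖₊ : ℝ≥0∞) ∂μ) ≤ 1} =>
      (‖F.1 z‖₊ : ℝ≥0∞)) ⟨_, hmem⟩
  have hCC : ‖(C : ℂ)‖₊ = C := by ext; simp
  calc (‖F z‖₊ : ℝ≥0∞) = C * (‖((C : ℂ)⁻¹ • F) z‖₊ : ℝ≥0∞) := by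
        rw [← ENNReal.coe_mul]
        congr 1
        simp only [Pi.smul_apply, smul_eq_mul, nnnorm_mul, nnnorm_inv, hCC]
        field_simp
    _ ≤ _ := by gcongr

/-- Functionals annihilating an algebraic de Branges space have Cauchy transforms proportional to
the evaluations. -/
theorem apply_mul_cauchy_comm {μ : Measure ℝ} {L : Submodule ℂ (ℂ → ℂ)}
    (hdb : IsAlgebraicDeBranges L) {g : ℝ → ℂ}
    (hint : ∀ F ∈ L, Integrable (fun x : ℝ => F x * g x) μ)
    (hann : ∀ F ∈ L, ∫ x : ℝ, F x * g x ∂μ = 0) {F G : ℂ → ℂ} (hF : F ∈ L) (hG : G ∈ L)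
    {y : ℝ} (hy : y ≠ 0) :
    F (y * Complex.I) * ∫ x : ℝ, G x * g x * ((x : ℂ) - y * Complex.I)⁻¹ ∂μ =
      G (y * Complex.I) * ∫ x : ℝ, F x * g x * ((x : ℂ) - y * Complex.I)⁻¹ ∂μ := by
  set w : ℂ := y * Complex.I with hw
  obtain ⟨Q, hQ, hQeq⟩ := hdb.2.1 (G w • F - F w • G)
    (L.sub_mem (L.smul_mem _ hF) (L.smul_mem _ hG)) w (by simp [mul_comm])
  have h0 := hann Q hQ
  have hx : ∀ x : ℝ, (x : ℂ) ≠ w := by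
    intro x h
    apply hy
    simpa [hw] using (congrArg Complex.im h).symm
  rw [← integral_const_mul, ← integral_const_mul, eq_comm, ← sub_eq_zero, ← integral_sub, ← h0]
  · refine integral_congr_ae (ae_of_all _ fun x => ?_)
    simp only [hQeq x (hx x), Pi.sub_apply, Pi.smul_apply, smul_eq_mul]
    ring
  · exact (integrable_mul_cauchyKernel (hint F hF) hy).const_mul _
  · exact (integrable_mul_cauchyKernel (hint G hG) hy).const_mul _

theorem L1Majorant_mul_cauchy_le {μ : Measure ℝ} {L : Submodule ℂ (ℂ → ℂ)}
    (hdb : IsAlgebraicDeBranges L) {g : ℝ → ℂ} (hg : ∀ᵐ x ∂μ, ‖g x‖ = 1)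
    (hint : ∀ F ∈ L, Integrable (fun x : ℝ => F x * g x) μ)
    (hann : ∀ F ∈ L, ∫ x : ℝ, F x * g x ∂μ = 0) {G : ℂ → ℂ} (hG : G ∈ L)
    {y : ℝ} (hy : 0 < y) :
    L1Majorant μ L (y * Complex.I) *
        ENNReal.ofReal (‖∫ x : ℝ, G x * g x * ((x : ℂ) - y * Complex.I)⁻¹ ∂μ‖ * y) ≤
      ‖G (y * Complex.I)‖₊ := by
  rw [L1Majorant, ENNReal.iSup_mul]
  refine iSup_le fun ⟨F, hF, hF1⟩ => ?_
  have hnorm : ∫ x : ℝ, ‖F x * g x‖ ∂μ ≤ 1 := by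
    rw [integral_norm_eq_lintegral_enorm (hint F hF).1]
    refine ENNReal.toReal_le_of_le_ofReal zero_le_one ?_
    rw [ENNReal.ofReal_one]
    refine (lintegral_congr_ae ?_).trans_le hF1
    filter_upwards [hg] with x hx
    rw [enorm_mul, ← ofReal_norm (g x), hx, ENNReal.ofReal_one, mul_one]
    rfl
  have hcauchy := norm_integral_mul_cauchyKernel_le (hint F hF) hy.ne'
  have hcomm := congrArg norm (apply_mul_cauchy_comm hdb hint hann hF hG hy.ne')
  rw [norm_mul, norm_mul] at hcomm
  have hreal : ‖F (y * Complex.I)‖ *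
      (‖∫ x : ℝ, G x * g x * ((x : ℂ) - y * Complex.I)⁻¹ ∂μ‖ * y) ≤ ‖G (y * Complex.I)‖ := by
    rw [← mul_assoc, hcomm, mul_assoc]
    refine mul_le_of_le_one_right (norm_nonneg _) ?_
    rw [abs_of_pos hy] at hcauchy
    calc _ ≤ (∫ x : ℝ, ‖F x * g x‖ ∂μ) * y⁻¹ * y := by gcongr
      _ = ∫ x : ℝ, ‖F x * g x‖ ∂μ := by field_simp
      _ ≤ 1 := hnorm
  have := ENNReal.ofReal_le_ofReal hreal
  rw [ENNReal.ofReal_mul (norm_nonneg _), ofReal_norm, ofReal_norm] at this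
  exact this

theorem exists_atom_of_isDiscreteMeasure {μ : Measure ℝ} (hdisc : IsDiscreteMeasure μ)
    {U : Set ℝ} (hU : μ U ≠ 0) : ∃ p ∈ U, μ {p} ≠ 0 := by
  by_contra! h
  obtain ⟨s, hs, hsc⟩ := hdisc
  apply hU
  refine measure_mono_null (t := (U ∩ s) ∪ sᶜ) (fun x hx => ?_) (measure_union_null ?_ hsc)
  · by_cases hxs : x ∈ s
    · exact Or.inl ⟨hx, hxs⟩
    · exact Or.inr hxs
  · rw [← Set.biUnion_of_singleton (U ∩ s),
      measure_biUnion_null_iff (hs.mono Set.inter_subset_right)]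
    exact fun x hx => h x hx.1

/-- If every integrable function annihilated by the unimodular `g` is annihilated by `e * g`,
then `e` is constant on the atoms. -/
theorem eq_of_ker_le_ker {μ : Measure ℝ} [IsLocallyFiniteMeasure μ] {g e : ℝ → ℂ}
    (hg : ∀ᵐ x ∂μ, ‖g x‖ = 1)
    (hker : ∀ f : ℝ → ℂ, Integrable f μ → ∫ x, f x * g x ∂μ = 0 → ∫ x, f x * (e x * g x) ∂μ = 0)
    {p q : ℝ} (hp : μ {p} ≠ 0) (hq : μ {q} ≠ 0) : e p = e q := by
  have hatom : ∀ r, μ {r} ≠ 0 → g r ≠ 0 ∧ (μ.real {r} : ℂ) ≠ 0 := by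
    intro r hr
    constructor
    · intro h0
      apply hr
      refine measure_mono_null ?_ hg
      rintro _ rfl
      simp [h0]
    · have : μ {r} ≠ ⊤ := isCompact_singleton.measure_lt_top.ne
      simp [Measure.real, ENNReal.toReal_eq_zero_iff, hr, this]
  obtain ⟨hgp, hmp⟩ := hatom p hp
  obtain ⟨hgq, hmq⟩ := hatom q hq
  have hind : ∀ (r : ℝ) (c : ℂ), Integrable (Set.indicator {r} (fun _ => c)) μ := by
    intro r c
    exact (integrable_indicator_iff (measurableSet_singleton r)).2
      (integrableOn_const isCompact_singleton.measure_lt_top.ne)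
  have hval : ∀ (r : ℝ) (c : ℂ) (u : ℝ → ℂ),
      Integrable (fun x => Set.indicator {r} (fun _ => c) x * u x) μ ∧
      ∫ x, Set.indicator {r} (fun _ => c) x * u x ∂μ = μ.real {r} * (c * u r) := by
    intro r c u
    have : (fun x => Set.indicator {r} (fun _ => c) x * u x) =
        Set.indicator {r} (fun _ => c * u r) := by
      ext x
      by_cases hx : x = r
      · simp [hx]
      · simp [hx]
    rw [this]
    refine ⟨hind _ _, ?_⟩
    rw [integral_indicator_const _ (measurableSet_singleton r)]
    simp
  have hboth : ∀ u : ℝ → ℂ, ∫ x, (Set.indicator {p} (fun _ => (g p * μ.real {p})⁻¹) x -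
      Set.indicator {q} (fun _ => (g q * μ.real {q})⁻¹) x) * u x ∂μ =
      (g p)⁻¹ * u p - (g q)⁻¹ * u q := by
    intro u
    simp_rw [sub_mul]
    rw [integral_sub (hval _ _ _).1 (hval _ _ _).1, (hval _ _ _).2, (hval _ _ _).2]
    field_simp
  have h1 := hker _ ((hind p (g p * μ.real {p})⁻¹).sub (hind q (g q * μ.real {q})⁻¹))
  simp only [Pi.sub_apply] at h1
  rw [hboth, hboth] at h1
  have h2 := h1 (by field_simp; simp)
  field_simp at h2
  exact sub_eq_zero.1 h2

theorem exists_small_exp_ne {p q a : ℝ} (hpq : p ≠ q) (ha : 0 < a) :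
    ∃ b ∈ Set.Ioo 0 a,
      Complex.exp (-(Complex.I * b * p)) ≠ Complex.exp (-(Complex.I * b * q)) := by
  have hd : 0 < |p - q| := abs_pos.2 (sub_ne_zero.2 hpq)
  refine ⟨min (a / 2) (1 / |p - q|), ⟨by positivity, (min_le_left _ _).trans_lt (by linarith)⟩, ?_⟩
  set b := min (a / 2) (1 / |p - q|) with hb
  have hb0 : 0 < b := by positivity
  have hle : b * |p - q| ≤ 1 := by
    rw [← le_div_iff₀ hd]
    exact min_le_right _ _
  intro h
  obtain ⟨n, hn⟩ := Complex.exp_eq_exp_iff_exists_int.1 h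
  have him := congrArg Complex.im hn
  simp at him
  have habs : |(n : ℝ) * (2 * Real.pi)| = b * |p - q| := by
    rw [show (n : ℝ) * (2 * Real.pi) = -(b * (p - q)) by linarith, abs_neg, abs_mul,
      abs_of_pos hb0]
  rw [abs_mul, abs_of_pos Real.two_pi_pos] at habs
  have hn0 : n ≠ 0 := by
    rintro rfl
    simp at habs
    rcases habs with h | h
    · exact hb0.ne' h
    · exact hpq (sub_eq_zero.1 h)
  have : (1 : ℝ) ≤ |(n : ℝ)| := by exact_mod_cast Int.one_le_abs hn0
  nlinarith [Real.pi_gt_three]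

theorem limsup_inv_mul_log_le_zero {u : ℝ → ℝ≥0∞} {C : ℝ} (hC : 1 ≤ C)
    (hu : ∀ y, u y ≤ ENNReal.ofReal C) :
    limsup (fun y : ℝ => ((y⁻¹ : ℝ) : EReal) * ENNReal.log (u y)) atTop ≤ 0 := by
  have hlim : Tendsto (fun y : ℝ => ((y⁻¹ * Real.log C : ℝ) : EReal)) atTop (nhds 0) := by
    have : Tendsto (fun y : ℝ => y⁻¹ * Real.log C) atTop (nhds 0) := by
      simpa using tendsto_inv_atTop_zero.mul_const (Real.log C)
    exact_mod_cast (continuous_coe_real_ereal.tendsto 0).comp this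
  refine le_trans (limsup_le_limsup ?_) hlim.limsup_eq.le
  filter_upwards [eventually_gt_atTop 0] with y hy
  rw [EReal.coe_mul, ← ENNReal.log_ofReal_of_pos (by linarith)]
  exact mul_le_mul_of_nonneg_left (ENNReal.log_le_log (hu y))
    (by exact_mod_cast (inv_pos.2 hy).le)

theorem eventually_le_exp_of_limsup_lt {u : ℝ → ℝ≥0∞} {a : ℝ}
    (h : limsup (fun y : ℝ => ((y⁻¹ : ℝ) : EReal) * ENNReal.log (u y)) atTop < (-a : ℝ)) :
    ∀ᶠ y : ℝ in atTop, u y ≤ ENNReal.ofReal (Real.exp (-(a * y))) := by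
  filter_upwards [eventually_lt_of_limsup_lt h, eventually_gt_atTop 0] with y hy hy0
  by_contra! hlt
  refine hy.not_ge ?_
  have h1 : ((-(a * y) : ℝ) : EReal) ≤ ENNReal.log (u y) := by
    have := ENNReal.log_le_log hlt.le
    rwa [ENNReal.log_ofReal_of_pos (Real.exp_pos _), Real.log_exp] at this
  calc ((-a : ℝ) : EReal) = ((y⁻¹ : ℝ) : EReal) * ((-(a * y) : ℝ) : EReal) := by
        rw [← EReal.coe_mul]
        congr 1
        field_simp
    _ ≤ _ := mul_le_mul_of_nonneg_left h1 (by exact_mod_cast (inv_pos.2 hy0).le)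

/-- The supremum of the mean types `limsup_{y→+∞} (1/y)·log(|F(iy)|/𝔪(iy))` over
`F ∈ 𝓛`, `F ≠ 0`, equals `0`. -/
theorem stmt18 (μ : MeasureTheory.Measure ℝ) [MeasureTheory.IsLocallyFiniteMeasure μ]
    (hdisc : IsDiscreteMeasure μ)
    (hsupp : ∃ a b : ℝ, a ≠ b ∧ MemSupport μ a ∧ MemSupport μ b)
    (L : Submodule ℂ (ℂ → ℂ)) (hdb : IsAlgebraicDeBranges L)
    (hint : ∀ F ∈ L, (∫⁻ x : ℝ, (‖F (x : ℂ)‖₊ : ℝ≥0∞) ∂μ) < ⊤)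
    (hinj : ∀ F ∈ L, ∀ G ∈ L, (fun x : ℝ => F (x : ℂ)) =ᵐ[μ] (fun x : ℝ => G (x : ℂ)) → F = G)
    (g₀ : ℝ → ℂ) (hg₀m : Measurable g₀) (hg₀u : ∀ᵐ x ∂μ, ‖g₀ x‖ = 1)
    (hclos : ∀ f : ℝ → ℂ, MeasureTheory.Integrable f μ →
      ((∀ ε : ℝ, 0 < ε → ∃ F ∈ L,
          (∫⁻ x : ℝ, (‖f x - F (x : ℂ)‖₊ : ℝ≥0∞) ∂μ) < ENNReal.ofReal ε) ↔
        ∫ x, f x * g₀ x ∂μ = 0))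
    (hLne : L ≠ ⊥) :
    sSup {t : EReal | ∃ F ∈ L, F ≠ (0 : ℂ → ℂ) ∧
      t = Filter.limsup (fun y : ℝ => ((y⁻¹ : ℝ) : EReal) *
            ENNReal.log ((‖F ((y : ℂ) * Complex.I)‖₊ : ℝ≥0∞) /
              L1Majorant μ L ((y : ℂ) * Complex.I))) atTop} = 0 := by
  have hcont : ∀ F ∈ L, Continuous (fun x : ℝ => F (x : ℂ)) := fun F hF =>
    (hdb.1 F hF).continuous.comp Complex.continuous_ofReal
  have hintF : ∀ F ∈ L, Integrable (fun x : ℝ => F (x : ℂ)) μ := fun F hF =>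
    ⟨(hcont F hF).aestronglyMeasurable, hint F hF⟩
  have hintFg : ∀ F ∈ L, Integrable (fun x : ℝ => F x * g₀ x) μ := fun F hF =>
    (hintF F hF).mul_bdd (c := 1) hg₀m.aestronglyMeasurable (hg₀u.mono fun x hx => hx.le)
  have hann : ∀ F ∈ L, ∫ x : ℝ, F x * g₀ x ∂μ = 0 := fun F hF =>
    (hclos _ (hintF F hF)).1 fun ε hε => ⟨F, hF, by simpa using hε⟩
  have hmpos : ∀ w, L1Majorant μ L w ≠ 0 := by
    intro w h0
    obtain ⟨F, hF, hFw⟩ := hdb.exists_apply_ne_zero hLne w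
    have := enorm_apply_le_mul_L1Majorant (μ := μ) hF
      (C := (∫⁻ x : ℝ, (‖F (x : ℂ)‖₊ : ℝ≥0∞) ∂μ).toNNReal + 1) (by positivity)
      (by push_cast; rw [ENNReal.coe_toNNReal (hint F hF).ne]; exact le_self_add) w
    rw [h0, mul_zero] at this
    simp at this
    exact hFw this
  refine le_antisymm (sSup_le ?_) ?_
  · rintro _ ⟨F, hF, -, rfl⟩
    refine limsup_inv_mul_log_le_zero
      (C := ((∫⁻ x : ℝ, (‖F (x : ℂ)‖₊ : ℝ≥0∞) ∂μ).toNNReal + 1 : ℝ≥0)) ?_ fun y => ?_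
    · exact_mod_cast le_add_self
    · rw [ENNReal.ofReal_coe_nnreal]
      refine ENNReal.div_le_of_le_mul ?_
      exact enorm_apply_le_mul_L1Majorant hF (by positivity)
        (by push_cast; rw [ENNReal.coe_toNNReal (hint F hF).ne]; exact le_self_add) _
  · by_contra! hneg
    obtain ⟨a', ha1, ha2⟩ := EReal.lt_iff_exists_real_btwn.1 hneg
    have ha : 0 < -a' := by
      have : a' < 0 := by exact_mod_cast ha2
      linarith
    have hfour : ∀ F ∈ L, ∀ b ∈ Set.Ioo 0 (-a'),
        ∫ x : ℝ, Complex.exp (-(Complex.I * b * x)) * (F x * g₀ x) ∂μ = 0 := by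
      intro F hF b hb
      rcases eq_or_ne F 0 with rfl | hF0
      · simp
      refine fourier_eq_zero_of_cauchy_decay (hintFg F hF) ?_ hb
      have hlt := lt_of_le_of_lt (le_sSup (Set.mem_ofPred.2 ⟨F, hF, hF0, rfl⟩)) ha1
      rw [← neg_neg a'] at hlt
      filter_upwards [eventually_le_exp_of_limsup_lt hlt, eventually_ge_atTop 1] with y hy hy1
      have hbound := L1Majorant_mul_cauchy_le hdb hg₀u hintFg hann hF (y := y) (by linarith)
      set c := ‖∫ x : ℝ, F x * g₀ x * ((x : ℂ) - y * Complex.I)⁻¹ ∂μ‖ with hc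
      have hc0 : 0 ≤ c := norm_nonneg _
      have hm0 := hmpos (y * Complex.I)
      by_cases htop : L1Majorant μ L (y * Complex.I) = ⊤
      · have hz : ENNReal.ofReal (c * y) = 0 := by
          by_contra hne
          rw [htop, ENNReal.top_mul hne] at hbound
          simp at hbound
        have : c * y ≤ 0 := ENNReal.ofReal_eq_zero.1 hz
        nlinarith [Real.exp_pos (-(-a' * y))]
      · rw [ENNReal.div_le_iff hm0 htop, mul_comm (ENNReal.ofReal _)] at hy
        have := (ENNReal.mul_le_mul_iff_right hm0 htop).1 (hbound.trans hy)
        rw [ENNReal.ofReal_le_ofReal_iff (Real.exp_pos _).le] at this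
        nlinarith
    obtain ⟨p, q, hpq, hp, hq⟩ : ∃ p q : ℝ, p ≠ q ∧ μ {p} ≠ 0 ∧ μ {q} ≠ 0 := by
      obtain ⟨s, t, hst, hs, ht⟩ := hsupp
      obtain ⟨U, V, hU, hV, hsU, htV, hUV⟩ := t2_separation hst
      obtain ⟨p, hpU, hp⟩ := exists_atom_of_isDiscreteMeasure hdisc (hs U (hU.mem_nhds hsU))
      obtain ⟨q, hqV, hq⟩ := exists_atom_of_isDiscreteMeasure hdisc (ht V (hV.mem_nhds htV))
      exact ⟨p, q, fun h => Set.disjoint_left.1 hUV hpU (h ▸ hqV), hp, hq⟩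
    obtain ⟨b, hb, hne⟩ := exists_small_exp_ne hpq ha
    refine hne (eq_of_ker_le_ker (e := fun x : ℝ => Complex.exp (-(Complex.I * b * x))) hg₀u
      (fun f hf hf0 => ?_) hp hq)
    have happrox := (hclos f hf).2 hf0
    have hunit : ∀ᵐ x : ℝ ∂μ, ‖Complex.exp (-(Complex.I * b * x)) * g₀ x‖ = 1 := by
      filter_upwards [hg₀u] with x hx
      rw [norm_mul, hx, Complex.norm_exp]
      simp
    have hmeas : AEStronglyMeasurable
        (fun x : ℝ => Complex.exp (-(Complex.I * b * x)) * g₀ x) μ := by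
      have : Measurable (fun x : ℝ => Complex.exp (-(Complex.I * b * x)) * g₀ x) := by fun_prop
      exact this.aestronglyMeasurable
    have hmul : ∀ k : ℝ → ℂ, Integrable k μ →
        Integrable (fun x : ℝ => k x * (Complex.exp (-(Complex.I * b * x)) * g₀ x)) μ :=
      fun k hk => hk.mul_bdd (c := 1) hmeas (hunit.mono fun x hx => hx.le)
    refine norm_le_zero_iff.1 (le_of_forall_pos_le_add fun ε hε => ?_)
    rw [zero_add]
    obtain ⟨F, hF, hFε⟩ := happrox ε hε
    have hF0 : ∫ x : ℝ, F x * (Complex.exp (-(Complex.I * b * x)) * g₀ x) ∂μ = 0 := by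
      rw [← hfour F hF b hb]
      exact integral_congr_ae (ae_of_all _ fun x => by ring)
    rw [← sub_zero (∫ x, _ ∂μ), ← hF0, ← integral_sub (hmul f hf) (hmul _ (hintF F hF))]
    simp_rw [← sub_mul]
    refine (norm_integral_le_lintegral_norm _).trans ?_
    refine ENNReal.toReal_le_of_le_ofReal hε.le (le_trans (le_of_eq ?_) hFε.le)
    refine lintegral_congr_ae ?_
    filter_upwards [hunit] with x hx
    rw [norm_mul, hx, mul_one, ofReal_norm]
    rfl
end
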